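/- Let k ≥ 1 and A ≥ 2 be integers with A > binom(2k,k)/(2k), let ε ∈ (0,1), and let f:ℝ→ℝ be supported on (−∞,1] with f ∈ C^A(ℝ), with f, f′, …, f^{(A)} all uniformly bounded, and with f(0) ≠ 0. Then there exist constants c_{k,f} > 0 and C(k,f,ε) > 0 such that for all R ≥ 3 and x ≥ R^{2k}(log R)², |(1/x)·Σ_{n ≤ x} M_f(n;R)^{2k} − c_{k,f}/log R| ≤ C(k,f,ε)/(log R)^{2−ε}. -/

import Mathlib

open scoped Classical

/-- `M_f(n;R) := Σ_{d | n} μ(d) f(log d / log R)`. -/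
noncomputable def Mf (f : ℝ → ℝ) (n : ℕ) (R : ℝ) : ℝ :=
  ∑ d ∈ n.divisors,
    ((ArithmeticFunction.moebius d : ℤ) : ℝ) * f (Real.log d / Real.log R)

namespace SieveMoment

theorem le_choose {n i : ℕ} (hi : 1 ≤ i) (hin : i < n) : n ≤ n.choose i := by
  induction n generalizing i with
  | zero => omega
  | succ n ih =>
    obtain ⟨i, rfl⟩ : ∃ j, i = j + 1 := ⟨i - 1, by omega⟩
    rw [Nat.choose_succ_succ]
    rcases Nat.eq_zero_or_pos i with rfl | hi0
    · simp
    have h1 := ih hi0 (by omega)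
    have h2 : 0 < n.choose (i + 1) := Nat.choose_pos (by omega)
    rw [Nat.succ_eq_add_one]
    omega

/-- The product of two central binomial coefficients of complementary sizes is noticeably smaller
than the central binomial coefficient of the total size. -/
theorem choose_half_mul_choose_half_le {k s z : ℕ} (hk : 3 ≤ k) (hs : 1 ≤ s) (hsz : s ≤ z)
    (h : s + z = 2 * k) :
    s.choose (s / 2) * z.choose (z / 2) + (2 * k - 2) ≤ (2 * k).choose k := by
  have hz : z.choose (k - s / 2) = z.choose (z / 2) := by
    rcases Nat.even_or_odd' s with ⟨a, rfl | rfl⟩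
    · congr 1; omega
    · apply Nat.choose_symm_of_eq_add; omega
  have key : ∀ j, j ≤ k → j ≠ s / 2 → ∀ j', j' ≤ k → j' ≠ s / 2 → j ≠ j' →
      s.choose (s / 2) * z.choose (z / 2) + (s.choose j * z.choose (k - j) +
        s.choose j' * z.choose (k - j')) ≤ (2 * k).choose k := by
    intro j hj hj2 j' hj' hj2' hne
    rw [← h, Nat.add_choose_eq, ← hz]
    have hsub : ({(s / 2, k - s / 2), (j, k - j), (j', k - j')} : Finset (ℕ × ℕ)) ⊆
        Finset.HasAntidiagonal.antidiagonal k := by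
      intro x hx
      simp only [Finset.mem_insert, Finset.mem_singleton] at hx
      rw [Finset.HasAntidiagonal.mem_antidiagonal]
      rcases hx with rfl | rfl | rfl <;> simp <;> omega
    refine le_trans (le_of_eq ?_) (Finset.sum_le_sum_of_subset hsub)
    rw [Finset.sum_insert, Finset.sum_insert, Finset.sum_singleton]
    · simp [hne]
    · simp [hj2.symm, hj2'.symm]
  rcases Nat.even_or_odd' s with ⟨a, rfl | rfl⟩
  · have := key (a - 1) (by omega) (by omega) (a + 1) (by omega) (by omega) (by omega)
    have h1 : 1 ≤ (2 * a).choose (a - 1) := Nat.choose_pos (by omega)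
    have h2 : 1 ≤ (2 * a).choose (a + 1) := Nat.choose_pos (by omega)
    have h3 : z ≤ z.choose (k - (a - 1)) := le_choose (by omega) (by omega)
    have h4 : z ≤ z.choose (k - (a + 1)) := le_choose (by omega) (by omega)
    nlinarith [Nat.mul_le_mul h1 h3, Nat.mul_le_mul h2 h4, Nat.sub_le (2 * k) 2]
  · rcases Nat.eq_zero_or_pos a with rfl | ha
    · have := key 1 (by omega) (by omega) k (by omega) (by omega) (by omega)
      have h3 : z ≤ z.choose (k - 1) := le_choose (by omega) (by omega)
      have h5 : 2 * 0 + 1 = 1 := rfl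
      have h6 : Nat.choose 1 1 = 1 := rfl
      rw [h5, h6, one_mul] at this
      rw [h5] at h ⊢
      have := Nat.zero_le (Nat.choose 1 k * z.choose (k - k))
      omega
    · have := key (a + 1) (by omega) (by omega) 0 (by omega) (by omega) (by omega)
      have h1 : 2 * a + 1 ≤ (2 * a + 1).choose (a + 1) := le_choose (by omega) (by omega)
      have h3 : z ≤ z.choose (k - (a + 1)) := le_choose (by omega) (by omega)
      have h4 := Nat.mul_le_mul h1 h3
      have h5 : 2 * k ≤ (2 * a + 1) * z := by nlinarith
      omega

/-- The **Erdős–Littlewood–Offord inequality**. -/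
theorem card_filter_sum_eq_le {ι : Type*} [Fintype ι] (w : ι → ℝ) (hw : ∀ i, w i ≠ 0) (t : ℝ) :
    (Finset.univ.filter fun J : Finset ι => ∑ i ∈ J, w i = t).card ≤
      (Fintype.card ι).choose (Fintype.card ι / 2) := by
  set N : Finset ι := Finset.univ.filter fun i => w i < 0 with hN
  have hind : ∀ (S : Finset ι) (u : ι → ℝ), ∑ i ∈ S, u i = ∑ i, if i ∈ S then u i else 0 := by
    simp
  have hsum : ∀ J : Finset ι, ∑ i ∈ symmDiff J N, |w i| = ∑ i ∈ J, w i - ∑ i ∈ N, w i := by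
    intro J
    rw [hind, hind J, hind N, ← Finset.sum_sub_distrib]
    refine Finset.sum_congr rfl fun i _ => ?_
    by_cases hJ : i ∈ J <;> by_cases hi : w i < 0
    · simp [Finset.mem_symmDiff, hN, hJ, hi]
    · simp [Finset.mem_symmDiff, hN, hJ, hi, abs_of_nonneg (not_lt.1 hi)]
    · simp [Finset.mem_symmDiff, hN, hJ, hi, abs_of_neg hi]
    · simp [Finset.mem_symmDiff, hN, hJ, hi]
  rw [← Finset.card_image_of_injective _ (symmDiff_left_injective N)]
  apply IsAntichain.sperner
  intro A hA B hB hne hAB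
  simp only [Finset.coe_image, Set.mem_image, Finset.coe_filter, Finset.mem_univ, true_and,
    Set.mem_ofPred_eq] at hA hB
  obtain ⟨J, hJ, rfl⟩ := hA
  obtain ⟨K, hK, rfl⟩ := hB
  have hss := Finset.ssubset_iff_subset_ne.2 ⟨hAB, hne⟩
  obtain ⟨i, hi, hi'⟩ := Finset.exists_of_ssubset hss
  have := Finset.sum_lt_sum_of_subset hAB hi hi' (abs_pos.2 (hw i))
    (fun j _ _ => abs_nonneg (w j))
  rw [hsum, hsum, hJ, hK] at this
  exact lt_irrefl _ this

/-- A two-dimensional version of the Littlewood–Offord inequality. -/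
theorem card_filter_sum_eq_and_le {ι : Type*} [Fintype ι] (w v : ι → ℝ) (hw : ∀ i, w i ≠ 0) :
    (Finset.univ.filter fun J : Finset ι => ∑ i ∈ J, w i = 0 ∧ ∑ i ∈ J, v i = 0).card ≤
      (Fintype.card {i // v i ≠ 0}).choose (Fintype.card {i // v i ≠ 0} / 2) *
      (Fintype.card {i // ¬ v i ≠ 0}).choose (Fintype.card {i // ¬ v i ≠ 0} / 2) := by
  set F := Finset.univ.filter fun J : Finset ι => ∑ i ∈ J, w i = 0 ∧ ∑ i ∈ J, v i = 0 with hF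
  set T := Finset.univ.filter fun I : Finset {i // v i ≠ 0} => ∑ i ∈ I, v i = 0 with hT
  have hsplit : ∀ (J : Finset ι) (u : ι → ℝ), ∑ i ∈ J, u i =
      ∑ i ∈ J.subtype (fun i => v i ≠ 0), u i + ∑ i ∈ J.subtype (fun i => ¬ v i ≠ 0), u i := by
    intro J u
    rw [← Finset.sum_filter_add_sum_filter_not J (fun i => v i ≠ 0), ← Finset.subtype_map,
      ← Finset.subtype_map, Finset.sum_map, Finset.sum_map]
    rfl
  have hmaps : ∀ J ∈ F, J.subtype (fun i => v i ≠ 0) ∈ T := by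
    intro J hJ
    simp only [hF, Finset.mem_filter, Finset.mem_univ, true_and] at hJ
    simp only [hT, Finset.mem_filter, Finset.mem_univ, true_and]
    have := hsplit J v
    rw [hJ.2, Finset.sum_eq_zero (s := J.subtype (fun i => ¬ v i ≠ 0))] at this
    · linarith
    · intro i _; exact not_not.1 i.2
  have hfib : ∀ I ∈ T, (F.filter fun J => J.subtype (fun i => v i ≠ 0) = I).card ≤
      (Fintype.card {i // ¬ v i ≠ 0}).choose (Fintype.card {i // ¬ v i ≠ 0} / 2) := by
    intro I _
    refine le_trans ?_ (card_filter_sum_eq_le (fun i : {i // ¬ v i ≠ 0} => w i)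
      (fun i => hw i) (-∑ i ∈ I, w i))
    refine Finset.card_le_card_of_injOn (fun J => J.subtype (fun i => ¬ v i ≠ 0)) ?_ ?_
    · intro J hJ
      simp only [hF, Finset.coe_filter, Finset.mem_filter, Finset.mem_univ, true_and,
        Set.mem_ofPred_eq] at hJ ⊢
      have := hsplit J w
      rw [hJ.1.1, hJ.2] at this
      linarith
    · intro J hJ K hK hJK
      simp only [Finset.coe_filter, Set.mem_ofPred_eq] at hJ hK
      have h1 := hJ.2.trans hK.2.symm
      ext i
      by_cases hi : v i ≠ 0
      · have := Finset.ext_iff.1 h1 ⟨i, hi⟩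
        simpa using this
      · have := Finset.ext_iff.1 hJK ⟨i, hi⟩
        simpa using this
  have := Finset.card_le_mul_card_image_of_maps_to hmaps _ hfib
  refine this.trans ?_
  rw [mul_comm]
  exact Nat.mul_le_mul_right _ (card_filter_sum_eq_le (fun i : {i // v i ≠ 0} => v i)
      (fun i => i.2) 0)

/-- The indicator vector of a set of coordinates. -/
noncomputable def ind {m : ℕ} (J : Finset (Fin m)) : Fin m → ℝ := fun j => if j ∈ J then 1 else 0

/-- The number of even sets minus the number of odd sets whose indicator vector lies in `V`. -/
noncomputable def signedCount {m : ℕ} (V : Submodule ℝ (Fin m → ℝ)) : ℝ :=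
  ∑ J : Finset (Fin m) with ind J ∈ V, (-1) ^ J.card

/-- The number of coordinate vectors in `V`. -/
noncomputable def coordCount {m : ℕ} (V : Submodule ℝ (Fin m → ℝ)) : ℕ :=
  (Finset.univ.filter fun j : Fin m => ind {j} ∈ V).card

theorem ind_eq_sum {m : ℕ} (J : Finset (Fin m)) : ind J = ∑ j ∈ J, ind {j} := by
  ext i
  simp [ind, Finset.sum_apply]

theorem ind_empty {m : ℕ} : ind (∅ : Finset (Fin m)) = 0 := by
  ext i; simp [ind]

theorem ind_singleton {m : ℕ} (j : Fin m) : ind {j} = Pi.single j (1 : ℝ) := by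
  ext i; simp [ind, Pi.single_apply]

theorem ind_ne_zero {m : ℕ} {J : Finset (Fin m)} (hJ : J.Nonempty) : ind J ≠ 0 := by
  obtain ⟨j, hj⟩ := hJ
  intro h
  have := congrFun h j
  simp [ind, hj] at this

theorem eq_top_of_forall_ind_mem {m : ℕ} {V : Submodule ℝ (Fin m → ℝ)}
    (h : ∀ j, ind {j} ∈ V) : V = ⊤ := by
  rw [eq_top_iff, ← (Pi.basisFun ℝ (Fin m)).span_eq, Submodule.span_le]
  rintro _ ⟨j, rfl⟩
  simpa [ind_singleton] using h j

theorem signedCount_eq_zero {m : ℕ} {V : Submodule ℝ (Fin m → ℝ)} {j : Fin m}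
    (hj : ind {j} ∈ V) : signedCount V = 0 := by
  have hins : ∀ J : Finset (Fin m), j ∉ J → ind (insert j J) = ind {j} + ind J := by
    intro J hJ
    rw [ind_eq_sum (insert j J), Finset.sum_insert hJ, ← ind_eq_sum]
  have hmem : ∀ J : Finset (Fin m), j ∉ J → (ind (insert j J) ∈ V ↔ ind J ∈ V) := by
    intro J hJ
    rw [hins J hJ, Submodule.add_mem_iff_right _ hj]
  unfold signedCount
  refine Finset.sum_involution (fun J _ => if j ∈ J then J.erase j else insert j J) ?_ ?_ ?_ ?_
  · intro J _
    by_cases h : j ∈ J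
    · simp only [h, if_true]
      rw [← Finset.card_erase_add_one h, pow_succ]; ring
    · simp only [h, if_false, Finset.card_insert_of_notMem h, pow_succ]; ring
  · intro J _ _ 
    by_cases h : j ∈ J
    · simp only [h, if_true]; intro h'; rw [← h'] at h; simp at h
    · simp only [h, if_false]; intro h'; rw [← h'] at h; simp at h
  · intro J hJ
    simp only [Finset.mem_filter, Finset.mem_univ, true_and] at hJ ⊢
    by_cases h : j ∈ J
    · simp only [h, if_true]
      rw [← hmem _ (by simp), Finset.insert_erase h]; exact hJ
    · simp only [h, if_false]; exact (hmem J h).2 hJ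
  · intro J _
    by_cases h : j ∈ J <;> simp [h]

theorem signedCount_le_card {m : ℕ} (V : Submodule ℝ (Fin m → ℝ)) :
    signedCount V ≤ (Finset.univ.filter fun J : Finset (Fin m) => ind J ∈ V).card := by
  rw [Finset.card_eq_sum_ones]; push_cast
  refine Finset.sum_le_sum fun J _ => ?_
  rcases neg_one_pow_eq_or ℝ J.card with h | h <;> rw [h]; norm_num

theorem coordCount_le_finrank {m : ℕ} (V : Submodule ℝ (Fin m → ℝ)) :
    coordCount V ≤ Module.finrank ℝ V := by
  have hli : LinearIndependent ℝ
      (fun j : {j : Fin m // ind {j} ∈ V} => (⟨ind {j.1}, j.2⟩ : V)) := by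
    apply LinearIndependent.of_comp V.subtype
    have h := (Pi.basisFun ℝ (Fin m)).linearIndependent.comp
      (fun j : {j : Fin m // ind {j} ∈ V} => j.1) Subtype.val_injective
    convert h using 1
    ext j : 1
    simp [ind_singleton]
  have := hli.fintype_card_le_finrank
  rwa [Fintype.card_subtype] at this

theorem apply_ind {m : ℕ} (φ : Module.Dual ℝ (Fin m → ℝ)) (J : Finset (Fin m)) :
    φ (ind J) = ∑ j ∈ J, φ (ind {j}) := by
  rw [ind_eq_sum, map_sum]

theorem exists_dual_ne_zero {m : ℕ} {V : Submodule ℝ (Fin m → ℝ)} (hV : ∀ j, ind {j} ∉ V) :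
    ∃ φ : Module.Dual ℝ (Fin m → ℝ), (∀ v ∈ V, φ v = 0) ∧ ∀ j, φ (ind {j}) ≠ 0 := by
  obtain ⟨ψ, hψ⟩ := Module.exists_dual_forall_apply_ne_zero (K := ℝ)
    (fun j : Fin m => V.mkQ (ind {j})) (fun j h => hV j (by simpa using h))
  refine ⟨ψ.comp V.mkQ, fun v hv => ?_, fun j => hψ j⟩
  simp [(Submodule.Quotient.mk_eq_zero V).2 hv]

theorem signedCount_le_choose {k : ℕ} {V : Submodule ℝ (Fin (2 * k) → ℝ)}
    (hV : ∀ j, ind {j} ∉ V) : signedCount V ≤ (2 * k).choose k := by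
  obtain ⟨φ, hφ, hne⟩ := exists_dual_ne_zero hV
  refine (signedCount_le_card V).trans ?_
  have := card_filter_sum_eq_le (fun j => φ (ind {j})) hne 0
  simp only [Fintype.card_fin, Nat.mul_div_cancel_left k two_pos] at this
  refine le_trans ?_ (Nat.cast_le.2 this)
  gcongr with J
  intro hJ
  rw [← apply_ind, hφ _ hJ]

theorem signedCount_le_of_codim {k : ℕ} {V : Submodule ℝ (Fin (2 * k) → ℝ)}
    (hV : ∀ j, ind {j} ∉ V) (hdim : Module.finrank ℝ V + 2 ≤ 2 * k) :
    ∃ s z : ℕ, 1 ≤ s ∧ 1 ≤ z ∧ s + z = 2 * k ∧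
      signedCount V ≤ (s.choose (s / 2) * z.choose (z / 2) : ℕ) := by
  obtain ⟨φ, hφ, hne⟩ := exists_dual_ne_zero hV
  let j₀ : Fin (2 * k) := ⟨0, by omega⟩
  have hlt : V ⊔ Submodule.span ℝ {ind {j₀}} < ⊤ := by
    apply Submodule.lt_top_of_finrank_lt_finrank
    have h1 := Submodule.finrank_add_le_finrank_add_finrank V (Submodule.span ℝ {ind {j₀}})
    have h2 := finrank_span_le_card (R := ℝ) ({ind {j₀}} : Set (Fin (2 * k) → ℝ))
    simp at h2
    simp
    omega
  obtain ⟨ψ, hψ0, hψ⟩ := Submodule.exists_le_ker_of_lt_top _ hlt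
  have hψV : ∀ v ∈ V, ψ v = 0 := fun v hv => hψ (Submodule.mem_sup_left hv)
  have hψj : ψ (ind {j₀}) = 0 :=
    hψ (Submodule.mem_sup_right (Submodule.mem_span_singleton_self _))
  have := card_filter_sum_eq_and_le (fun j => φ (ind {j})) (fun j => ψ (ind {j})) hne
  refine ⟨_, _, ?_, ?_, ?_, (signedCount_le_card V).trans (Nat.cast_le.2 (le_trans ?_ this))⟩
  · rw [Nat.one_le_iff_ne_zero, ← Nat.pos_iff_ne_zero, Fintype.card_pos_iff]
    by_contra hcon
    apply hψ0
    refine (Pi.basisFun ℝ _).ext fun j => ?_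
    rw [not_nonempty_iff] at hcon
    by_contra hj
    exact hcon.false ⟨j, by simpa [ind_singleton] using hj⟩
  · rw [Nat.one_le_iff_ne_zero, ← Nat.pos_iff_ne_zero, Fintype.card_pos_iff]
    exact ⟨j₀, by simpa using hψj⟩
  · have h1 := Fintype.card_subtype_compl (fun j => ψ (ind {j}) ≠ 0)
    have h2 := Fintype.card_subtype_le (fun j => ψ (ind {j}) ≠ 0)
    rw [Fintype.card_fin] at h1 h2
    omega
  · refine Finset.card_le_card fun J hJ => ?_
    simp only [Finset.mem_filter, Finset.mem_univ, true_and] at hJ ⊢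
    rw [← apply_ind, ← apply_ind]
    exact ⟨hφ _ hJ, hψV _ hJ⟩

/-- The combinatorial inequality governing the convergence of the main term. -/
theorem signedCount_add_codim_le {k A : ℕ} (hk : 1 ≤ k) (hA2 : 2 ≤ A)
    (hA : (2 * k).choose k + 2 ≤ 2 * k * A) {V : Submodule ℝ (Fin (2 * k) → ℝ)} (hV : V ≠ ⊤) :
    signedCount V + ((2 * k : ℕ) - Module.finrank ℝ V : ℝ) + 1 ≤
      A * ((2 * k : ℕ) - coordCount V : ℝ) := by
  have hlt : Module.finrank ℝ V < 2 * k := by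
    have := Submodule.finrank_lt hV
    simpa using this
  have ha := coordCount_le_finrank V
  by_cases h : ∃ j, ind {j} ∈ V
  · obtain ⟨j, hj⟩ := h
    rw [signedCount_eq_zero hj]
    have h1 : (coordCount V : ℝ) + 1 ≤ (2 * k : ℕ) := by exact_mod_cast (by omega)
    have h2 : (coordCount V : ℝ) ≤ Module.finrank ℝ V := by exact_mod_cast ha
    have h3 : (2 : ℝ) ≤ A := by exact_mod_cast hA2
    nlinarith
  push Not at h
  have hc0 : coordCount V = 0 := by
    simp [coordCount, h]
  rw [hc0]
  have hA' : 2 * k * 2 ≤ 2 * k * A := Nat.mul_le_mul_left _ hA2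
  have key : ∀ N : ℕ, signedCount V ≤ N → N + (2 * k - Module.finrank ℝ V) + 1 ≤ 2 * k * A →
      signedCount V + ((2 * k : ℕ) - Module.finrank ℝ V : ℝ) + 1 ≤
      A * ((2 * k : ℕ) - (0 : ℕ) : ℝ) := by
    intro N h1 h2
    have h3 : (N : ℝ) + ((2 * k : ℕ) - Module.finrank ℝ V : ℝ) + 1 ≤ 2 * k * A := by
      rw [← Nat.cast_sub hlt.le]; exact_mod_cast h2
    push_cast at h3 ⊢
    linarith
  rcases Nat.lt_or_ge (2 * k) (Module.finrank ℝ V + 2) with hc | hc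
  · exact key _ (signedCount_le_choose h) (by omega)
  rcases Nat.eq_zero_or_pos (Module.finrank ℝ V) with h0 | h0
  · refine key 1 ?_ (by omega)
    have hbot : V = ⊥ := Submodule.finrank_eq_zero.1 h0
    refine (signedCount_le_card V).trans ?_
    rw [Nat.cast_le, Finset.card_le_one]
    intro J hJ K hK
    simp only [Finset.mem_filter, Finset.mem_univ, true_and, hbot, Submodule.mem_bot] at hJ hK
    rw [Finset.not_nonempty_iff_eq_empty.1 fun hn => ind_ne_zero hn hJ,
      Finset.not_nonempty_iff_eq_empty.1 fun hn => ind_ne_zero hn hK]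
  obtain ⟨s, z, hs, hz, hsz, hN⟩ := signedCount_le_of_codim h hc
  refine key _ hN ?_
  rcases Nat.lt_or_ge k 3 with hk3 | hk3
  · have hk2 : k = 2 := by omega
    subst hk2
    have hs4 : s ≤ 3 := by omega
    obtain rfl : z = 4 - s := by omega
    have : s.choose (s / 2) * (4 - s).choose ((4 - s) / 2) ≤ 4 := by
      interval_cases s <;> decide
    omega
  · rcases le_total s z with hle | hle
    · have := choose_half_mul_choose_half_le hk3 hs hle hsz
      omega
    · have := choose_half_mul_choose_half_le hk3 hz hle (by omega)
      rw [mul_comm (z.choose (z / 2))] at this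
      omega

/-- The sum of the entries of `σ` over `J`. -/
noncomputable def subsum {m : ℕ} (σ : Fin m → ℂ) (J : Finset (Fin m)) : ℂ := ∑ j ∈ J, σ j

/-- The span of the indicator vectors of a family of sets. -/
noncomputable def indSpan {m : ℕ} (T : Finset (Finset (Fin m))) : Submodule ℝ (Fin m → ℝ) :=
  Submodule.span ℝ (Set.image ind (T : Set (Finset (Fin m))))

theorem indSpan_insert {m : ℕ} (T : Finset (Finset (Fin m))) (J : Finset (Fin m)) :
    indSpan (insert J T) = Submodule.span ℝ {ind J} ⊔ indSpan T := by
  simp [indSpan, Set.image_insert_eq, Submodule.span_insert]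

theorem finrank_indSpan_le {m : ℕ} (T : Finset (Finset (Fin m))) :
    Module.finrank ℝ (indSpan T) ≤ T.card := by
  have h := finrank_span_finset_le_card (R := ℝ) (T.image ind)
  rw [Finset.coe_image] at h
  exact h.trans Finset.card_image_le

theorem exists_forall_norm_subsum_le (m : ℕ) :
    ∃ C : ℝ, 1 ≤ C ∧ ∀ (J : Finset (Fin m)) (T : Finset (Finset (Fin m))), ind J ∈ indSpan T →
      ∀ (σ : Fin m → ℂ) (H : ℝ), (∀ K ∈ T, ‖subsum σ K‖ ≤ H) → 0 ≤ H → ‖subsum σ J‖ ≤ C * H := by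
  have h1 : ∀ p : Finset (Fin m) × Finset (Finset (Fin m)), ∃ C : ℝ, 0 ≤ C ∧
      (ind p.1 ∈ indSpan p.2 → ∀ (σ : Fin m → ℂ) (H : ℝ), (∀ K ∈ p.2, ‖subsum σ K‖ ≤ H) →
        0 ≤ H → ‖subsum σ p.1‖ ≤ C * H) := by
    rintro ⟨J, T⟩
    by_cases hJ : ind J ∈ indSpan T
    · obtain ⟨c, hc⟩ := (Submodule.mem_span_image_finset_iff_exists_fun ℝ).1 hJ
      refine ⟨∑ K : T, |c K|, Finset.sum_nonneg fun _ _ => abs_nonneg _, fun _ σ H hH _ => ?_⟩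
      have hlin : ∀ K : Finset (Fin m), subsum σ K = ∑ j, ind K j • σ j := by
        intro K; simp [subsum, ind]
      have : subsum σ J = ∑ K : T, c K • subsum σ K := by
        rw [hlin J, ← hc]
        simp only [hlin, Finset.sum_apply, Finset.sum_smul, Finset.smul_sum, Pi.smul_apply,
          smul_smul, smul_eq_mul]
        rw [Finset.sum_comm]
      rw [this, Finset.sum_mul]
      refine (norm_sum_le _ _).trans (Finset.sum_le_sum fun K _ => ?_)
      rw [norm_smul, Real.norm_eq_abs]
      exact mul_le_mul_of_nonneg_left (hH K K.2) (abs_nonneg _)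
    · exact ⟨0, le_rfl, fun h => absurd h hJ⟩
  choose c hc0 hc using h1
  refine ⟨1 + ∑ p, c p, by linarith [Finset.sum_nonneg fun p (_ : p ∈ Finset.univ) => hc0 p], ?_⟩
  intro J T hJ σ H hH hH0
  refine (hc (J, T) hJ σ H hH hH0).trans (mul_le_mul_of_nonneg_right ?_ hH0)
  linarith [Finset.single_le_sum (fun p (_ : p ∈ Finset.univ) => hc0 p) (Finset.mem_univ (J, T))]

/-- The greedy choice of a basis of indicator vectors of minimal weights. -/
theorem exists_greedy {m : ℕ} (ρ : Finset (Fin m) → ℝ) :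
    ∃ (b : ℕ → Finset (Fin m)) (T : ℕ → Finset (Finset (Fin m))), T 0 = ∅ ∧
      (∀ i, T (i + 1) = insert (b i) (T i)) ∧
      (∀ i < m, ind (b i) ∉ indSpan (T i) ∧ ∀ J, ind J ∉ indSpan (T i) → ρ (b i) ≤ ρ J) := by
  have h1 : ∀ T : Finset (Finset (Fin m)), ∃ K : Finset (Fin m), T.card < m →
      ind K ∉ indSpan T ∧ ∀ J, ind J ∉ indSpan T → ρ K ≤ ρ J := by
    intro T
    by_cases hT : T.card < m
    · have hne : (Finset.univ.filter fun J : Finset (Fin m) => ind J ∉ indSpan T).Nonempty := by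
        by_contra hcon
        rw [Finset.not_nonempty_iff_eq_empty, Finset.filter_eq_empty_iff] at hcon
        have htop : indSpan T = ⊤ :=
          eq_top_of_forall_ind_mem fun j => not_not.1 (hcon (Finset.mem_univ {j}))
        have := finrank_indSpan_le T
        rw [htop, finrank_top, Module.finrank_fin_fun] at this
        omega
      obtain ⟨K, hK, hmin⟩ := Finset.exists_min_image _ ρ hne
      simp only [Finset.mem_filter, Finset.mem_univ, true_and] at hK hmin
      exact ⟨K, fun _ => ⟨hK, hmin⟩⟩
    · exact ⟨∅, fun h => absurd h hT⟩
  choose g hg using h1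
  let T : ℕ → Finset (Finset (Fin m)) := fun i => Nat.rec ∅ (fun _ S => insert (g S) S) i
  have hcard : ∀ i, (T i).card ≤ i := by
    intro i
    induction i with
    | zero => simp [T]
    | succ i ih => exact (Finset.card_insert_le _ _).trans (Nat.succ_le_succ ih)
  exact ⟨fun i => g (T i), T, rfl, fun i => rfl, fun i hi => hg _ ((hcard i).trans_lt hi)⟩

theorem sum_abel_le {m : ℕ} {A ℓ : ℝ} {g N a : ℕ → ℝ} (hℓ : 0 ≤ ℓ) (hg0 : g 0 = 0)
    (hg : ∀ i < m, g i ≤ g (i + 1)) (ha : a m = m)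
    (hY : ∀ i < m, (m - i : ℝ) - A * (m - a i) + 1 ≤ 0)
    (hNY : ∀ i < m, N i + ((m - i : ℝ) - A * (m - a i) + 1) ≤ 0) (hN : N m = 0) :
    ∑ i ∈ Finset.range m, (min (g (i + 1)) ℓ * (N i - N (i + 1)) +
      g (i + 1) * (1 - A * (a (i + 1) - a i))) + g m ≤ 0 := by
  have key : ∀ n ≤ m, ∑ i ∈ Finset.range n, (min (g (i + 1)) ℓ * (N i - N (i + 1)) +
      g (i + 1) * (1 - A * (a (i + 1) - a i))) + min (g n) ℓ * N n +
        g n * ((m - n : ℝ) - A * (m - a n) + 1) ≤ 0 := by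
    intro n
    induction n with
    | zero => intro _; simp [hg0, hℓ]
    | succ n ih =>
      intro hn
      have ih := ih (by omega)
      rw [Finset.sum_range_succ]
      have h1 := hY n (by omega)
      have h2 := hNY n (by omega)
      have h3 := hg n (by omega)
      have h4 : 0 ≤ min (g (n + 1)) ℓ - min (g n) ℓ := sub_nonneg.2 (min_le_min_right _ h3)
      have h5 : min (g (n + 1)) ℓ - min (g n) ℓ ≤ g (n + 1) - g n := by
        rcases le_total (g (n + 1)) ℓ with h | h
        · rw [min_eq_left h, min_eq_left (h3.trans h)]
        · rw [min_eq_right h]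
          rcases le_total (g n) ℓ with h' | h'
          · rw [min_eq_left h']; linarith
          · rw [min_eq_right h']; linarith
      push_cast
      nlinarith [mul_nonneg h4 (neg_nonneg.2 h2), mul_nonneg (sub_nonneg.2 h5) (neg_nonneg.2 h1)]
  have := key m le_rfl
  rw [hN, ha] at this
  linarith

theorem sum_eq_sum_range_sdiff {α : Type*} [DecidableEq α] {S : ℕ → Finset α}
    (hS : ∀ i, S i ⊆ S (i + 1))
    (φ : α → ℝ) (n : ℕ) :
    ∑ x ∈ S n, φ x = ∑ x ∈ S 0, φ x + ∑ i ∈ Finset.range n, ∑ x ∈ S (i + 1) \ S i, φ x := by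
  induction n with
  | zero => simp
  | succ n ih => rw [Finset.sum_range_succ, ← add_assoc, ← ih, add_comm (∑ x ∈ S n, φ x),
    Finset.sum_sdiff (hS n)]

theorem subsum_re {m : ℕ} {σ : Fin m → ℂ} (hσ : ∀ j, (σ j).re = 1) (J : Finset (Fin m)) :
    (subsum σ J).re = J.card := by
  simp [subsum, hσ]

theorem one_le_norm_subsum {m : ℕ} {σ : Fin m → ℂ} (hσ : ∀ j, (σ j).re = 1)
    {J : Finset (Fin m)} (hJ : J.Nonempty) : 1 ≤ ‖subsum σ J‖ := by
  refine le_trans ?_ ((le_abs_self _).trans (Complex.abs_re_le_norm _))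
  rw [subsum_re hσ]
  exact_mod_cast hJ.card_pos

theorem subsum_singleton {m : ℕ} (σ : Fin m → ℂ) (j : Fin m) : subsum σ {j} = σ j := by
  simp [subsum]

/-- Along any `σ` with real parts one, a basis of indicator vectors controls the kernel. -/
theorem exists_basis_log_le {k A : ℕ} (hk : 1 ≤ k) (hA2 : 2 ≤ A)
    (hA : (2 * k).choose k + 2 ≤ 2 * k * A) :
    ∃ C : ℝ, ∀ (ℓ : ℝ), 0 ≤ ℓ → ∀ σ : Fin (2 * k) → ℂ, (∀ j, (σ j).re = 1) →
      ∃ b : Fin (2 * k) → Finset (Fin (2 * k)), LinearIndependent ℝ (fun i => ind (b i)) ∧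
        ∀ j₀, ∑ J : Finset (Fin (2 * k)) with J.Nonempty,
            -(-1) ^ J.card * min (Real.log ‖subsum σ J‖) ℓ + ∑ i, Real.log ‖subsum σ (b i)‖ -
          A * ∑ j, Real.log ‖σ j‖ + Real.log ‖σ j₀‖ ≤ C := by
  obtain ⟨C, hC1, hC⟩ := exists_forall_norm_subsum_le (2 * k)
  obtain ⟨m, hm⟩ : ∃ m, m = 2 * k := ⟨_, rfl⟩
  have hm0 : 0 < m := by omega
  have hlogC : 0 ≤ Real.log C := Real.log_nonneg hC1
  refine ⟨(Finset.univ : Finset (Finset (Fin (2 * k)))).card * Real.log C + Real.log C,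
    fun ℓ hℓ σ hσ => ?_⟩
  obtain ⟨b, T, hT0, hT, hb⟩ := exists_greedy (fun J => ‖subsum σ J‖)
  have hb := fun i (hi : i < m) => hb i (hm ▸ hi)
  set V : ℕ → Submodule ℝ (Fin (2 * k) → ℝ) := fun i => indSpan (T i) with hV
  have hVsucc : ∀ i, V (i + 1) = Submodule.span ℝ {ind (b i)} ⊔ V i := by
    intro i; simp only [hV, hT, indSpan_insert]
  have hVmono : Monotone V := monotone_nat_of_le_succ fun i => by rw [hVsucc]; exact le_sup_right
  have hbmem : ∀ i, ind (b i) ∈ V (i + 1) := fun i => by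
    rw [hVsucc]
    exact Submodule.mem_sup_left (Submodule.mem_span_singleton_self _)
  have hTeq : ∀ i, T i = (Finset.range i).image b := by
    intro i
    induction i with
    | zero => simp [hT0]
    | succ i ih => rw [hT, ih, Finset.range_add_one, Finset.image_insert]
  have hV0 : V 0 = ⊥ := by simp [hV, hT0, indSpan]
  have hrank_ge : ∀ i ≤ m, i ≤ Module.finrank ℝ (V i) := by
    intro i
    induction i with
    | zero => intro _; simp
    | succ i ih =>
      intro hi
      have h1 : V i < V (i + 1) := by
        refine lt_of_le_of_ne (hVmono i.le_succ) fun h => ?_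
        exact (hb i (by omega)).1 (by rw [show indSpan (T i) = V i from rfl, h]; exact hbmem i)
      have := Submodule.finrank_lt_finrank_of_lt h1
      have := ih (by omega)
      omega
  have hrank : ∀ i ≤ m, Module.finrank ℝ (V i) = i := by
    intro i hi
    refine le_antisymm ((finrank_indSpan_le _).trans ?_) (hrank_ge i hi)
    rw [hTeq]
    exact Finset.card_image_le.trans (by simp)
  have hVm : V m = ⊤ := by
    apply Submodule.eq_top_of_finrank_eq
    rw [hrank m le_rfl, Module.finrank_fin_fun, hm]
  have hVne : ∀ i < m, V i ≠ ⊤ := by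
    intro i hi h
    have := hrank i hi.le
    rw [h, finrank_top, Module.finrank_fin_fun] at this
    omega
  have hbne : ∀ i < m, (b i).Nonempty := by
    intro i hi
    rw [Finset.nonempty_iff_ne_empty]
    intro h
    refine (hb i hi).1 ?_
    rw [h, ind_empty]
    exact Submodule.zero_mem _
  set g : ℕ → ℝ := fun i => Nat.casesOn i 0 (fun i => Real.log ‖subsum σ (b i)‖) with hg
  have hg0 : g 0 = 0 := rfl
  have hgs : ∀ i, g (i + 1) = Real.log ‖subsum σ (b i)‖ := fun i => rfl
  have hlow : ∀ i < m, ∀ J, ind J ∉ V i → g (i + 1) ≤ Real.log ‖subsum σ J‖ := by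
    intro i hi J hJ
    exact Real.log_le_log (zero_lt_one.trans_le (one_le_norm_subsum hσ (hbne i hi)))
      ((hb i hi).2 J hJ)
  have hgmono : ∀ i < m, g i ≤ g (i + 1) := by
    intro i hi
    rcases i with _ | i
    · rw [hg0, hgs]
      exact Real.log_nonneg (one_le_norm_subsum hσ (hbne 0 hi))
    · refine hlow i (by omega) _ fun h => (hb (i + 1) hi).1 (hVmono i.le_succ h)
  have hnormmono : ∀ i < m, ∀ K ∈ T (i + 1), ‖subsum σ K‖ ≤ ‖subsum σ (b i)‖ := by
    intro i hi K hK
    rw [hTeq, Finset.mem_image] at hK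
    obtain ⟨i', hi', rfl⟩ := hK
    rw [Finset.mem_range] at hi'
    refine (hb i' (by omega)).2 _ fun h => (hb i hi).1 (hVmono (by omega) h)
  have hup : ∀ i < m, ∀ J, J.Nonempty → ind J ∈ V (i + 1) →
      Real.log ‖subsum σ J‖ ≤ g (i + 1) + Real.log C := by
    intro i hi J hJ hJV
    have h1 := hC J (T (i + 1)) hJV σ _ (hnormmono i hi) (norm_nonneg _)
    have h2 := one_le_norm_subsum hσ (hbne i hi)
    rw [hgs, add_comm, ← Real.log_mul (by positivity) (by positivity)]
    exact Real.log_le_log (zero_lt_one.trans_le (one_le_norm_subsum hσ hJ)) h1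
  have hup' : ∀ J, J.Nonempty → Real.log ‖subsum σ J‖ ≤ g m + Real.log C := by
    intro J hJ
    obtain ⟨i, rfl⟩ := Nat.exists_eq_succ_of_ne_zero hm0.ne'
    exact hup i (by omega) J hJ (by rw [← Nat.succ_eq_add_one, hVm]; trivial)
  have hnonempty : ∀ i (J : Finset (Fin (2 * k))), ind J ∉ V i → J.Nonempty := by
    intro i J hJ
    rw [Finset.nonempty_iff_ne_empty]
    rintro rfl
    exact hJ (by rw [ind_empty]; exact Submodule.zero_mem _)
  -- the sum over all nonempty sets, split into levels
  have hset : ∀ φ : Finset (Fin (2 * k)) → ℝ,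
      ∑ J : Finset (Fin (2 * k)) with J.Nonempty, φ J = ∑ i ∈ Finset.range m,
        ∑ J ∈ (Finset.univ.filter fun J => ind J ∈ V (i + 1)) \
          (Finset.univ.filter fun J => ind J ∈ V i), φ J := by
    intro φ
    have h1 := sum_eq_sum_range_sdiff
      (S := fun i => Finset.univ.filter fun J : Finset (Fin (2 * k)) => ind J ∈ V i)
      (fun i => Finset.monotone_filter_right _ fun J _ h => hVmono i.le_succ h) φ m
    have h2 : (Finset.univ.filter fun J : Finset (Fin (2 * k)) => ind J ∈ V 0) = {∅} := by
      ext J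
      simp only [Finset.mem_filter, Finset.mem_univ, true_and, hV0, Submodule.mem_bot,
        Finset.mem_singleton]
      refine ⟨fun h => ?_, fun h => h ▸ ind_empty⟩
      by_contra hne
      exact ind_ne_zero (Finset.nonempty_iff_ne_empty.2 hne) h
    have h3 : (Finset.univ.filter fun J : Finset (Fin (2 * k)) => ind J ∈ V m) = Finset.univ := by
      simp [hVm]
    rw [h2, h3, Finset.sum_singleton] at h1
    have h4 : (Finset.univ.filter fun J : Finset (Fin (2 * k)) => J.Nonempty) =
        Finset.univ.erase ∅ := by
      ext J; simp [Finset.nonempty_iff_ne_empty]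
    rw [h4]
    have h5 := Finset.add_sum_erase Finset.univ φ (Finset.mem_univ ∅)
    linarith
  have hcoord : ∀ φ : Fin (2 * k) → ℝ, ∑ j, φ j = ∑ i ∈ Finset.range m,
        ∑ j ∈ (Finset.univ.filter fun j => ind {j} ∈ V (i + 1)) \
          (Finset.univ.filter fun j => ind {j} ∈ V i), φ j := by
    intro φ
    have h1 := sum_eq_sum_range_sdiff
      (S := fun i => Finset.univ.filter fun j : Fin (2 * k) => ind {j} ∈ V i)
      (fun i => Finset.monotone_filter_right _ fun J _ h => hVmono i.le_succ h) φ m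
    have h2 : (Finset.univ.filter fun j : Fin (2 * k) => ind {j} ∈ V 0) = ∅ := by
      ext j
      simp only [Finset.mem_filter, Finset.mem_univ, true_and, hV0, Submodule.mem_bot]
      simpa using ind_ne_zero (Finset.singleton_nonempty j)
    have h3 : (Finset.univ.filter fun j : Fin (2 * k) => ind {j} ∈ V m) = Finset.univ := by
      simp [hVm]
    rwa [h2, h3, Finset.sum_empty, zero_add] at h1
  have hsignedlev : ∀ i, ∑ J ∈ (Finset.univ.filter fun J => ind J ∈ V (i + 1)) \
          (Finset.univ.filter fun J => ind J ∈ V i), (-1 : ℝ) ^ J.card =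
        signedCount (V (i + 1)) - signedCount (V i) := by
    intro i
    rw [eq_sub_iff_add_eq]
    exact Finset.sum_sdiff (Finset.monotone_filter_right _ fun J _ h => hVmono i.le_succ h)
  have hcoordlev : ∀ i, ((((Finset.univ.filter fun j => ind {j} ∈ V (i + 1)) \
          (Finset.univ.filter fun j => ind {j} ∈ V i)).card : ℕ) : ℝ) =
        coordCount (V (i + 1)) - coordCount (V i) := by
    intro i
    rw [Finset.cast_card_sdiff (Finset.monotone_filter_right _ fun J _ h => hVmono i.le_succ h)]
    rfl
  have habel := sum_abel_le (m := m) (A := A) (ℓ := ℓ) (g := g)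
    (N := fun i => signedCount (V i)) (a := fun i => coordCount (V i)) hℓ hg0 hgmono
    (by
      have : coordCount (V m) = m := by rw [coordCount, hVm]; simp [hm]
      exact_mod_cast this)
    (by
      intro i hi
      have h1 : coordCount (V i) ≤ i := (coordCount_le_finrank _).trans (hrank i hi.le).le
      have h2 : (coordCount (V i) : ℝ) ≤ i := by exact_mod_cast h1
      have h3 : (i : ℝ) + 1 ≤ m := by exact_mod_cast hi
      have h4 : (2 : ℝ) ≤ A := by exact_mod_cast hA2
      nlinarith)
    (by
      intro i hi
      have := signedCount_add_codim_le hk hA2 hA (hVne i hi)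
      have hmR : (m : ℝ) = (2 * k : ℕ) := by rw [hm]
      rw [hrank i hi.le, ← hmR] at this
      linarith)
    (signedCount_eq_zero (j := ⟨0, by omega⟩) (by rw [hVm]; trivial))
  refine ⟨fun i => b i, ?_, fun j₀ => ?_⟩
  · apply linearIndependent_of_top_le_span_of_card_eq_finrank
    · rw [← hVm]
      refine Submodule.span_mono ?_
      rintro _ ⟨J, hJ, rfl⟩
      rw [Finset.mem_coe, hTeq, Finset.mem_image] at hJ
      obtain ⟨i, hi, rfl⟩ := hJ
      exact ⟨⟨i, by rw [← hm]; simpa using hi⟩, rfl⟩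
    · simp
  have e1 : ∑ J : Finset (Fin (2 * k)) with J.Nonempty,
      -(-1) ^ J.card * min (Real.log ‖subsum σ J‖) ℓ ≤
      ∑ i ∈ Finset.range m, min (g (i + 1)) ℓ * (signedCount (V i) - signedCount (V (i + 1))) +
        (Finset.univ : Finset (Finset (Fin (2 * k)))).card * Real.log C := by
    have h1 : ∑ J : Finset (Fin (2 * k)) with J.Nonempty,
        (-(-1) ^ J.card * min (Real.log ‖subsum σ J‖) ℓ - Real.log C) ≤
        ∑ i ∈ Finset.range m, min (g (i + 1)) ℓ *
          (signedCount (V i) - signedCount (V (i + 1))) := by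
      rw [hset]
      refine Finset.sum_le_sum fun i hi => ?_
      rw [← neg_sub, ← hsignedlev i, mul_neg, Finset.mul_sum, ← Finset.sum_neg_distrib]
      refine Finset.sum_le_sum fun J hJ => ?_
      simp only [Finset.mem_sdiff, Finset.mem_filter, Finset.mem_univ, true_and] at hJ
      have hi' := Finset.mem_range.1 hi
      have h2 := hlow i hi' J hJ.2
      have h3 := hup i hi' J (hnonempty i J hJ.2) hJ.1
      have h4 : min (g (i + 1)) ℓ ≤ min (Real.log ‖subsum σ J‖) ℓ := min_le_min_right _ h2
      have h5 : min (Real.log ‖subsum σ J‖) ℓ ≤ min (g (i + 1)) ℓ + Real.log C := by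
        rw [← min_add_add_right]
        exact min_le_min h3 (by linarith)
      rcases neg_one_pow_eq_or ℝ J.card with h | h <;> rw [h] <;> linarith
    rw [Finset.sum_sub_distrib, Finset.sum_const, nsmul_eq_mul] at h1
    have h2 : ((Finset.univ.filter fun J : Finset (Fin (2 * k)) => J.Nonempty).card : ℝ) ≤
        (Finset.univ : Finset (Finset (Fin (2 * k)))).card := by
      exact_mod_cast Finset.card_filter_le _ _
    nlinarith [mul_le_mul_of_nonneg_right h2 hlogC]
  have e2 : ∑ i ∈ Finset.range m, g (i + 1) * ((coordCount (V (i + 1)) : ℝ) - coordCount (V i)) ≤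
      ∑ j, Real.log ‖σ j‖ := by
    rw [hcoord]
    refine Finset.sum_le_sum fun i hi => ?_
    rw [← hcoordlev, mul_comm, ← nsmul_eq_mul]
    refine Finset.card_nsmul_le_sum _ _ _ fun j hj => ?_
    simp only [Finset.mem_sdiff, Finset.mem_filter, Finset.mem_univ, true_and] at hj
    have := hlow i (Finset.mem_range.1 hi) {j} hj.2
    rwa [subsum_singleton] at this
  have e3 : ∑ i : Fin (2 * k), Real.log ‖subsum σ (b i)‖ = ∑ i ∈ Finset.range m, g (i + 1) := by
    rw [hm, Finset.sum_range]
  have e4 : Real.log ‖σ j₀‖ ≤ g m + Real.log C := by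
    have := hup' {j₀} (Finset.singleton_nonempty _)
    rwa [subsum_singleton] at this
  have e5 : ∑ i ∈ Finset.range m, (min (g (i + 1)) ℓ *
        (signedCount (V i) - signedCount (V (i + 1))) +
      g (i + 1) * (1 - A * ((coordCount (V (i + 1)) : ℝ) - coordCount (V i)))) =
      ∑ i ∈ Finset.range m, min (g (i + 1)) ℓ * (signedCount (V i) - signedCount (V (i + 1))) +
      ∑ i ∈ Finset.range m, g (i + 1) -
      A * ∑ i ∈ Finset.range m, g (i + 1) *
        ((coordCount (V (i + 1)) : ℝ) - coordCount (V i)) := by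
    rw [Finset.mul_sum, ← Finset.sum_add_distrib, ← Finset.sum_sub_distrib]
    exact Finset.sum_congr rfl fun i _ => by ring
  rw [e5] at habel
  have e6 := mul_le_mul_of_nonneg_left e2 (Nat.cast_nonneg (α := ℝ) A)
  rw [e3]
  linarith

section

open MeasureTheory

/-- The points `1 - 2πi v_j`. -/
noncomputable def sig {m : ℕ} (v : Fin m → ℝ) (j : Fin m) : ℂ := 1 - 2 * Real.pi * v j * Complex.I

theorem sig_re {m : ℕ} (v : Fin m → ℝ) (j : Fin m) : (sig v j).re = 1 := by
  simp [sig]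

theorem subsum_sig_im {m : ℕ} (v : Fin m → ℝ) (J : Finset (Fin m)) :
    (subsum (sig v) J).im = -(2 * Real.pi * ∑ j ∈ J, v j) := by
  simp [subsum, sig, Finset.mul_sum]

theorem one_add_abs_le_norm_subsum {m : ℕ} (v : Fin m → ℝ) {J : Finset (Fin m)}
    (hJ : J.Nonempty) : 1 + |∑ j ∈ J, v j| ≤ 2 * ‖subsum (sig v) J‖ := by
  have h1 := one_le_norm_subsum (sig_re v) hJ
  have h2 := Complex.abs_im_le_norm (subsum (sig v) J)
  rw [subsum_sig_im, abs_neg, abs_mul, abs_of_pos Real.two_pi_pos] at h2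
  nlinarith [Real.pi_gt_three, abs_nonneg (∑ j ∈ J, v j)]

theorem integrable_prod_one_add_abs_rpow {m : ℕ} {b : Fin m → Finset (Fin m)}
    (hb : LinearIndependent ℝ fun i => ind (b i)) {p : ℝ} (hp : 1 < p) :
    Integrable fun v : Fin m → ℝ => ∏ i, (1 + |∑ j ∈ b i, v j|) ^ (-p) := by
  let M : Matrix (Fin m) (Fin m) ℝ := fun i => ind (b i)
  have hM : IsUnit M := Matrix.linearIndependent_rows_iff_isUnit.1 hb
  have hdet : LinearMap.det (Matrix.toLin' M) ≠ 0 := by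
    rw [LinearMap.det_toLin']
    exact ((Matrix.isUnit_iff_isUnit_det M).1 hM).ne_zero
  have h1 : Integrable (fun x : ℝ => (1 + |x|) ^ (-p)) := by
    simpa using integrable_one_add_norm (E := ℝ) (μ := volume) (r := p) (by simpa using hp)
  have h2 : Integrable fun v : Fin m → ℝ => ∏ i, (1 + |v i|) ^ (-p) :=
    Integrable.fintype_prod (f := fun _ (x : ℝ) => (1 + |x|) ^ (-p)) fun _ => h1
  have h3 : Integrable (fun v : Fin m → ℝ => ∏ i, (1 + |v i|) ^ (-p))
      (Measure.map (Matrix.toLin' M) volume) := by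
    rw [Measure.map_linearMap_addHaar_eq_smul_addHaar _ hdet]
    exact h2.smul_measure ENNReal.ofReal_ne_top
  have h4 := h3.comp_aemeasurable
    ((LinearMap.continuous_of_finiteDimensional (Matrix.toLin' M)).measurable.aemeasurable)
  convert h4 using 1
  ext v
  rw [Function.comp_apply]
  refine Finset.prod_congr rfl fun i _ => ?_
  have : Matrix.toLin' M v i = ∑ j ∈ b i, v j := by
    rw [Matrix.toLin'_apply]
    simp [M, Matrix.mulVec, dotProduct, ind]
  rw [this]

/-- The logarithm of the kernel `∏_J min(|s_J|, e^ℓ)^{-(-1)^|J|}`. -/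
noncomputable def logKer {m : ℕ} (σ : Fin m → ℂ) (ℓ : ℝ) : ℝ :=
  ∑ J : Finset (Fin m) with J.Nonempty, -(-1) ^ J.card * min (Real.log ‖subsum σ J‖) ℓ

theorem exists_integrable_majorant {k A : ℕ} (hk : 1 ≤ k) (hA2 : 2 ≤ A)
    (hA : (2 * k).choose k + 2 ≤ 2 * k * A) {δ : ℝ} (hδ : 0 < δ) :
    ∃ G : (Fin (2 * k) → ℝ) → ℝ, Integrable G ∧ ∀ v, ∀ ℓ, 0 ≤ ℓ →
      (∏ j, ‖sig v j‖ ^ A)⁻¹ * (Real.exp (logKer (sig v) ℓ) * (∑ j, ‖sig v j‖) ^ (1 - δ)) ≤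
        G v := by
  obtain ⟨C, hC⟩ := exists_basis_log_le hk hA2 hA
  set m := 2 * k with hm
  have hm0 : (0 : ℝ) < m := by rw [hm]; positivity
  set p := 1 + δ / m with hp
  have hp1 : 1 < p := by have := div_pos hδ hm0; linarith
  let B : Finset (Fin m → Finset (Fin m)) :=
    Finset.univ.filter fun b => LinearIndependent ℝ fun i => ind (b i)
  refine ⟨fun v => ∑ b ∈ B, Real.exp C * m * (2 ^ p) ^ m *
    ∏ i, (1 + |∑ j ∈ b i, v j|) ^ (-p), ?_, fun v ℓ hℓ => ?_⟩
  · refine integrable_finsetSum _ fun b hb => Integrable.const_mul ?_ _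
    exact integrable_prod_one_add_abs_rpow (Finset.mem_filter.1 hb).2 hp1
  obtain ⟨b, hb, hb2⟩ := hC ℓ hℓ (sig v) (sig_re v)
  have hbne : ∀ i, (b i).Nonempty := by
    intro i
    rw [Finset.nonempty_iff_ne_empty]
    intro h
    exact hb.ne_zero i (by rw [h, ind_empty])
  have h1s : ∀ J : Finset (Fin m), J.Nonempty → 1 ≤ ‖subsum (sig v) J‖ :=
    fun J hJ => one_le_norm_subsum (sig_re v) hJ
  have h1σ : ∀ j, 1 ≤ ‖sig v j‖ := fun j => by
    have := h1s {j} (Finset.singleton_nonempty j)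
    rwa [subsum_singleton] at this
  obtain ⟨j₀, -, hj₀⟩ := Finset.exists_max_image (Finset.univ : Finset (Fin m))
    (fun j => ‖sig v j‖) ⟨⟨0, by omega⟩, Finset.mem_univ _⟩
  set S := ∑ j, ‖sig v j‖ with hS
  have hSle : S ≤ m * ‖sig v j₀‖ := by
    have := Finset.sum_le_card_nsmul Finset.univ (fun j => ‖sig v j‖) _ (fun j _ => hj₀ j (by simp))
    simpa using this
  have hSb : ∀ J : Finset (Fin m), ‖subsum (sig v) J‖ ≤ S := fun J =>
    (norm_sum_le _ _).trans (Finset.sum_le_univ_sum_of_nonneg fun _ => norm_nonneg _)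
  have hS1 : 1 ≤ S := (h1s _ (hbne ⟨0, by omega⟩)).trans (hSb _)
  have hS0 : 0 < S := by linarith
  have hmain : (∏ j, ‖sig v j‖ ^ A)⁻¹ * (Real.exp (logKer (sig v) ℓ) * ‖sig v j₀‖) ≤
      Real.exp C * ∏ i, ‖subsum (sig v) (b i)‖⁻¹ := by
    have e1 : (∏ j, ‖sig v j‖ ^ A)⁻¹ = Real.exp (-(A * ∑ j, Real.log ‖sig v j‖)) := by
      rw [Real.exp_neg, Finset.mul_sum, Real.exp_sum]
      congr 1
      refine Finset.prod_congr rfl fun j _ => ?_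
      rw [mul_comm, Real.exp_mul, Real.exp_log (by linarith [h1σ j]), Real.rpow_natCast]
    have e2 : ∏ i, ‖subsum (sig v) (b i)‖⁻¹ =
        Real.exp (-(∑ i, Real.log ‖subsum (sig v) (b i)‖)) := by
      rw [← Finset.sum_neg_distrib, Real.exp_sum]
      refine Finset.prod_congr rfl fun i _ => ?_
      rw [Real.exp_neg, Real.exp_log (by linarith [h1s _ (hbne i)])]
    have e3 : ‖sig v j₀‖ = Real.exp (Real.log ‖sig v j₀‖) :=
      (Real.exp_log (by linarith [h1σ j₀])).symm
    rw [e1, e2, e3, ← Real.exp_add, ← Real.exp_add, ← Real.exp_add]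
    have := hb2 j₀
    refine Real.exp_le_exp.2 ?_
    unfold logKer
    linarith
  have hpow : S ^ (-δ) ≤ ∏ i : Fin m, ‖subsum (sig v) (b i)‖ ^ (-(δ / m)) := by
    have : S ^ (-δ) = ∏ i : Fin m, S ^ (-(δ / m)) := by
      rw [Finset.prod_const, Finset.card_univ, Fintype.card_fin, ← Real.rpow_mul_natCast hS0.le]
      congr 1; field_simp
    rw [this]
    refine Finset.prod_le_prod (fun _ _ => (Real.rpow_pos_of_pos hS0 _).le) fun i _ => ?_
    exact Real.rpow_le_rpow_of_nonpos (by linarith [h1s _ (hbne i)]) (hSb _)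
      (by have := div_pos hδ hm0; linarith)
  have hfac : ∀ i, ‖subsum (sig v) (b i)‖⁻¹ * ‖subsum (sig v) (b i)‖ ^ (-(δ / m)) ≤
      2 ^ p * (1 + |∑ j ∈ b i, v j|) ^ (-p) := by
    intro i
    have hpos : 0 < ‖subsum (sig v) (b i)‖ := by linarith [h1s _ (hbne i)]
    have h0 := abs_nonneg (∑ j ∈ b i, v j)
    rw [← Real.rpow_neg_one, ← Real.rpow_add hpos]
    have : (-1 + -(δ / m) : ℝ) = -p := by rw [hp]; ring
    rw [this]
    have h2 : (1 + |∑ j ∈ b i, v j|) / 2 ≤ ‖subsum (sig v) (b i)‖ := by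
      linarith [one_add_abs_le_norm_subsum v (hbne i)]
    refine (Real.rpow_le_rpow_of_nonpos (by positivity) h2 (by linarith)).trans (le_of_eq ?_)
    rw [Real.div_rpow (by positivity) (by norm_num), Real.rpow_neg (by norm_num : (0:ℝ) ≤ 2)]
    field_simp
  have hP0 : 0 ≤ (∏ j, ‖sig v j‖ ^ A)⁻¹ * Real.exp (logKer (sig v) ℓ) :=
    mul_nonneg (inv_nonneg.2 (Finset.prod_nonneg fun _ _ => by positivity)) (Real.exp_pos _).le
  have hb' : b ∈ B := Finset.mem_filter.2 ⟨Finset.mem_univ _, hb⟩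
  have hSplit : S ^ (1 - δ) = S * S ^ (-δ) := by
    rw [sub_eq_add_neg, Real.rpow_add hS0, Real.rpow_one]
  calc (∏ j, ‖sig v j‖ ^ A)⁻¹ * (Real.exp (logKer (sig v) ℓ) * S ^ (1 - δ))
      = ((∏ j, ‖sig v j‖ ^ A)⁻¹ * Real.exp (logKer (sig v) ℓ)) * S * S ^ (-δ) := by
        rw [hSplit]; ring
    _ ≤ ((∏ j, ‖sig v j‖ ^ A)⁻¹ * Real.exp (logKer (sig v) ℓ)) * (m * ‖sig v j₀‖) * S ^ (-δ) := by
        gcongr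
    _ = m * ((∏ j, ‖sig v j‖ ^ A)⁻¹ * (Real.exp (logKer (sig v) ℓ) * ‖sig v j₀‖)) * S ^ (-δ) := by
        ring
    _ ≤ m * (Real.exp C * ∏ i, ‖subsum (sig v) (b i)‖⁻¹) *
          ∏ i : Fin m, ‖subsum (sig v) (b i)‖ ^ (-(δ / m)) := by
        gcongr
    _ = Real.exp C * m * ∏ i, (‖subsum (sig v) (b i)‖⁻¹ *
          ‖subsum (sig v) (b i)‖ ^ (-(δ / m))) := by
        rw [Finset.prod_mul_distrib]; ring
    _ ≤ Real.exp C * m * ∏ i : Fin m, (2 ^ p * (1 + |∑ j ∈ b i, v j|) ^ (-p)) := by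
        refine mul_le_mul_of_nonneg_left (Finset.prod_le_prod (fun i _ => by positivity)
          fun i _ => hfac i) (by positivity)
    _ = Real.exp C * m * (2 ^ p) ^ m * ∏ i, (1 + |∑ j ∈ b i, v j|) ^ (-p) := by
        rw [Finset.prod_mul_distrib, Finset.prod_const, Finset.card_univ, Fintype.card_fin]; ring
    _ ≤ _ := Finset.single_le_sum (f := fun b : Fin m → Finset (Fin m) =>
          Real.exp C * m * (2 ^ p) ^ m * ∏ i, (1 + |∑ j ∈ b i, v j|) ^ (-p))
          (fun b _ => mul_nonneg (by positivity) (Finset.prod_nonneg fun i _ => by positivity)) hb'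

end

section

open MeasureTheory

open scoped FourierTransform

/-- A compactly supported `C^A` function is a Fourier integral of a function decaying like
`|v|^{-A}`. -/
theorem exists_fourier_of_hasCompactSupport {A : ℕ} (hA2 : 2 ≤ A) {h : ℝ → ℂ}
    (hh : ContDiff ℝ A h) (hc : HasCompactSupport h) :
    ∃ (F : ℝ → ℂ) (C : ℝ), Continuous F ∧ 0 < C ∧
      (∀ v : ℝ, ‖F v‖ ≤ C * (‖1 - 2 * Real.pi * v * Complex.I‖ ^ A)⁻¹) ∧ Integrable F ∧
      ∀ t : ℝ, h t = ∫ v : ℝ, F v * Complex.exp (2 * Real.pi * v * t * Complex.I) := by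
  have hint : ∀ n : ℕ, n ≤ A → Integrable (iteratedDeriv n h) := by
    intro n hn
    refine Continuous.integrable_of_hasCompactSupport
      (hh.continuous_iteratedDeriv n (by exact_mod_cast hn)) ?_
    rw [iteratedDeriv_eq_equiv_comp]
    exact (hc.iteratedFDeriv (𝕜 := ℝ) n).comp_left (by simp)
  have hint0 : Integrable h := by simpa using hint 0 (Nat.zero_le _)
  have hcont : Continuous (𝓕 h) := VectorFourier.fourierIntegral_continuous
    Real.continuous_fourierChar (innerSL ℝ).continuous₂ hint0
  have hb : ∀ n ≤ A, ∃ B : ℝ, 0 ≤ B ∧ ∀ v : ℝ, (2 * Real.pi * |v|) ^ n * ‖𝓕 h v‖ ≤ B := by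
    intro n hn
    refine ⟨∫ t, ‖iteratedDeriv n h t‖, integral_nonneg fun _ => norm_nonneg _, fun v => ?_⟩
    have h1 := congrFun (Real.fourier_iteratedDeriv (f := h) (N := (A : ℕ∞)) (n := n)
      (by exact_mod_cast hh) (fun n hn => hint n (by exact_mod_cast hn)) (by exact_mod_cast hn)) v
    have h2 : ‖𝓕 (iteratedDeriv n h) v‖ ≤ ∫ t, ‖iteratedDeriv n h t‖ :=
      VectorFourier.norm_fourierIntegral_le_integral_norm _ _ _ _ _
    rw [h1] at h2
    simpa [abs_of_pos Real.pi_pos] using h2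
  obtain ⟨B0, hB0, h0⟩ := hb 0 (Nat.zero_le _)
  obtain ⟨B, hB, h1⟩ := hb A le_rfl
  have hdecay : ∀ v : ℝ, ‖𝓕 h v‖ ≤ (2 ^ A * (B0 + B) + 1) *
      (‖1 - 2 * Real.pi * v * Complex.I‖ ^ A)⁻¹ := by
    intro v
    have hpos : 0 < ‖1 - 2 * Real.pi * v * Complex.I‖ := by
      rw [norm_pos_iff]
      intro h
      have := congrArg Complex.re h
      simp at this
    have hle : ‖1 - 2 * Real.pi * v * Complex.I‖ ≤ 2 * max 1 (2 * Real.pi * |v|) := by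
      refine (norm_sub_le _ _).trans ?_
      simp only [norm_one, Complex.norm_mul, Complex.norm_ofNat, Complex.norm_real,
        Real.norm_eq_abs, Complex.norm_I, mul_one, abs_of_pos Real.pi_pos]
      linarith [le_max_left 1 (2 * Real.pi * |v|), le_max_right 1 (2 * Real.pi * |v|)]
    rw [← div_eq_mul_inv, le_div_iff₀ (by positivity)]
    have hmax : max 1 (2 * Real.pi * |v|) ^ A * ‖𝓕 h v‖ ≤ B0 + B := by
      have e0 := h0 v
      have e1 := h1 v
      simp only [pow_zero, one_mul] at e0
      rcases max_cases 1 (2 * Real.pi * |v|) with ⟨h, _⟩ | ⟨h, _⟩ <;> rw [h]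
      · simp; linarith
      · linarith
    calc ‖𝓕 h v‖ * ‖1 - 2 * Real.pi * v * Complex.I‖ ^ A
        ≤ ‖𝓕 h v‖ * (2 * max 1 (2 * Real.pi * |v|)) ^ A := by gcongr
      _ = 2 ^ A * (max 1 (2 * Real.pi * |v|) ^ A * ‖𝓕 h v‖) := by rw [mul_pow]; ring
      _ ≤ 2 ^ A * (B0 + B) := by gcongr
      _ ≤ _ := by linarith
  have hFint : Integrable (𝓕 h) := by
    have h1 : Integrable (fun x : ℝ => (1 + |x|) ^ (-(2:ℝ))) := by
      simpa using integrable_one_add_norm (E := ℝ) (μ := volume) (r := 2) (by simp)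
    refine (h1.const_mul ((2 ^ A * (B0 + B) + 1) * 4)).mono' hcont.aestronglyMeasurable
      (Filter.Eventually.of_forall fun v => (hdecay v).trans ?_)
    have h2 := one_add_abs_le_norm_subsum (m := 1) (fun _ => v)
      (Finset.singleton_nonempty (0 : Fin 1))
    simp only [subsum_singleton, sig, Finset.sum_singleton] at h2
    have h3 : (0:ℝ) ≤ |v| := abs_nonneg v
    have h4 : 1 ≤ ‖1 - 2 * Real.pi * v * Complex.I‖ := by
      refine le_trans ?_ ((le_abs_self _).trans (Complex.abs_re_le_norm _))
      simp
    rw [mul_assoc _ (4 : ℝ)]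
    refine mul_le_mul_of_nonneg_left ?_ (by positivity)
    rw [Real.rpow_neg (by positivity), Real.rpow_two]
    rw [← div_eq_mul_inv, le_div_iff₀ (by positivity),
      inv_mul_le_iff₀ (pow_pos (zero_lt_one.trans_le h4) A)]
    have h5 : ‖1 - 2 * Real.pi * v * Complex.I‖ ^ 2 ≤ ‖1 - 2 * Real.pi * v * Complex.I‖ ^ A :=
      pow_le_pow_right₀ h4 hA2
    have h6 : (1 + |v|) ^ 2 ≤ (2 * ‖1 - 2 * Real.pi * v * Complex.I‖) ^ 2 := by gcongr
    rw [mul_pow] at h6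
    linarith
  refine ⟨𝓕 h, 2 ^ A * (B0 + B) + 1, hcont, by positivity, hdecay, hFint, fun t => ?_⟩
  rw [← congrFun (hh.continuous.fourierInv_fourier_eq hint0 hFint) t, Real.fourierInv_eq']
  refine integral_congr_ae (Filter.Eventually.of_forall fun v => ?_)
  simp only [smul_eq_mul]
  rw [mul_comm]
  congr 2
  simp
  ring

theorem exists_fourier {A : ℕ} (hA2 : 2 ≤ A) {f : ℝ → ℝ} (hsupp : ∀ t : ℝ, 1 < t → f t = 0)
    (hsmooth : ContDiff ℝ A f) :
    ∃ (F : ℝ → ℂ) (C : ℝ), Continuous F ∧ 0 < C ∧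
      (∀ v : ℝ, ‖F v‖ ≤ C * (‖1 - 2 * Real.pi * v * Complex.I‖ ^ A)⁻¹) ∧ Integrable F ∧
      ∀ t : ℝ, 0 ≤ t →
        (f t : ℂ) = ∫ v : ℝ, F v * Complex.exp (-((1 - 2 * Real.pi * v * Complex.I) * t)) := by
  let g : ℝ → ℝ := fun t => Real.exp t * f t * Real.smoothTransition (t + 1)
  have hg : ContDiff ℝ A g := by
    refine (Real.contDiff_exp.mul hsmooth).mul ?_
    exact (Real.smoothTransition.contDiff (n := A)).comp (contDiff_id.add contDiff_const)
  have hgc : HasCompactSupport g := by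
    refine HasCompactSupport.intro (isCompact_Icc (a := -1) (b := 1)) fun t ht => ?_
    rw [Set.mem_Icc, not_and_or, not_le, not_le] at ht
    rcases ht with ht | ht
    · simp [g, Real.smoothTransition.zero_of_nonpos (show t + 1 ≤ 0 by linarith)]
    · simp [g, hsupp t ht]
  obtain ⟨F, C, hF1, hC, hF2, hF3, hF4⟩ := exists_fourier_of_hasCompactSupport hA2
    (h := fun t => (g t : ℂ)) (Complex.ofRealCLM.contDiff.comp hg)
    (hgc.comp_left (g := fun x : ℝ => (x : ℂ)) (by simp))
  refine ⟨F, C, hF1, hC, hF2, hF3, fun t ht => ?_⟩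
  have h1 := hF4 t
  have h2 : (f t : ℂ) = Complex.exp (-t) * (g t : ℂ) := by
    simp only [g, Real.smoothTransition.one_of_one_le (show 1 ≤ t + 1 by linarith)]
    push_cast
    rw [mul_one, ← mul_assoc, ← Complex.exp_add]
    simp
  rw [h2, h1, ← integral_const_mul]
  refine integral_congr_ae (Filter.Eventually.of_forall fun v => ?_)
  simp only
  rw [mul_left_comm, ← Complex.exp_add]
  congr 2
  ring

end

theorem norm_cpow_neg_sub_le {s : ℂ} (hs : s ≠ 0) (ha : 0 ≤ s.re) {x t : ℝ} (hx : 0 < x)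
    (ht : t ∈ Set.Icc x (x + 1)) :
    ‖(t : ℂ) ^ (-s) - (x : ℂ) ^ (-s)‖ ≤ ‖s‖ * x ^ (-s.re - 1) := by
  have h := norm_image_sub_le_of_norm_deriv_le_segment' (f := fun y : ℝ => (y : ℂ) ^ (-s))
    (f' := fun y : ℝ => -s * (y : ℂ) ^ (-s - 1)) (a := x) (b := x + 1) (C := ‖s‖ * x ^ (-s.re - 1))
    (fun y hy => (hasDerivAt_ofReal_cpow_const (by linarith [hy.1] : y ≠ 0)
      (neg_ne_zero.2 hs)).hasDerivWithinAt) (fun y hy => ?_) t ht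
  · refine h.trans ?_
    have h0 : 0 ≤ ‖s‖ * x ^ (-s.re - 1) := by positivity
    nlinarith [ht.2]
  · have hy0 : 0 < y := by linarith [hy.1]
    rw [norm_mul, norm_neg, Complex.norm_cpow_eq_rpow_re_of_pos hy0]
    simp only [Complex.sub_re, Complex.neg_re, Complex.one_re]
    refine mul_le_mul_of_nonneg_left ?_ (norm_nonneg _)
    exact Real.rpow_le_rpow_of_nonpos hx hy.1 (by linarith)

/-- The difference between `x^{-s}` and the integral of `t^{-s}` over `[x, x + 1]`. -/
noncomputable def cpowGap (x : ℝ) (s : ℂ) : ℂ :=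
  (x : ℂ) ^ (-s) - (((x + 1 : ℝ) : ℂ) ^ (1 - s) - (x : ℂ) ^ (1 - s)) / (1 - s)

theorem norm_cpowGap_le {s : ℂ} (hs1 : s ≠ 1) {x B : ℝ} (hx : 0 < x)
    (hB : ∀ t ∈ Set.Icc x (x + 1), ‖(t : ℂ) ^ (-s) - (x : ℂ) ^ (-s)‖ ≤ B) :
    ‖cpowGap x s‖ ≤ B := by
  have hs1' : 1 - s ≠ 0 := sub_ne_zero.2 hs1.symm
  have h := norm_image_sub_le_of_norm_deriv_le_segment'
    (f := fun y : ℝ => (y : ℂ) ^ (1 - s) / (1 - s) - (y : ℂ) * (x : ℂ) ^ (-s))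
    (f' := fun y : ℝ => (y : ℂ) ^ (-s) - (x : ℂ) ^ (-s)) (a := x) (b := x + 1) (C := B)
    (fun y hy => ?_) (fun y hy => hB y ⟨hy.1, hy.2.le⟩) (x + 1) ⟨by linarith, le_rfl⟩
  · simp only [add_sub_cancel_left, mul_one] at h
    refine le_of_eq_of_le ?_ h
    rw [← norm_neg]
    congr 1
    unfold cpowGap
    push_cast
    ring
  · have hy0 : y ≠ 0 := by linarith [hy.1]
    have h1 := (hasDerivAt_ofReal_cpow_const hy0 hs1').div_const (1 - s)
    have h2 := (Complex.ofRealCLM.hasDerivAt (x := y)).mul_const ((x : ℂ) ^ (-s))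
    have h3 := h1.sub h2
    refine (h3.congr_deriv ?_).hasDerivWithinAt
    simp only [Complex.ofRealCLM_apply, Complex.ofReal_one, one_mul]
    rw [mul_div_cancel_left₀ _ hs1']
    congr 2
    ring

theorem norm_cpowGap_le_rpow {s : ℂ} (hs1 : s ≠ 1) (ha : 0 < s.re) {x η : ℝ} (hx : 1 ≤ x)
    (hη0 : 0 ≤ η) (hη1 : η ≤ 1) :
    ‖cpowGap x s‖ ≤ 2 * ‖s‖ ^ η * x ^ (-s.re - η) := by
  have hx0 : 0 < x := by linarith
  have hs0 : s ≠ 0 := by rintro rfl; simp at ha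
  have h1 : ‖cpowGap x s‖ ≤ ‖s‖ * x ^ (-s.re - 1) :=
    norm_cpowGap_le hs1 hx0 fun t ht => norm_cpow_neg_sub_le hs0 ha.le hx0 ht
  have h2 : ‖cpowGap x s‖ ≤ 2 * x ^ (-s.re) := by
    refine norm_cpowGap_le hs1 hx0 fun t ht => (norm_sub_le _ _).trans ?_
    have ht0 : 0 < t := by linarith [ht.1]
    rw [Complex.norm_cpow_eq_rpow_re_of_pos hx0, Complex.norm_cpow_eq_rpow_re_of_pos ht0,
      Complex.neg_re]
    linarith [Real.rpow_le_rpow_of_nonpos hx0 ht.1 (by linarith : -s.re ≤ 0)]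
  have h0 := norm_nonneg (cpowGap x s)
  calc ‖cpowGap x s‖ = ‖cpowGap x s‖ ^ η * ‖cpowGap x s‖ ^ (1 - η) := by
        rw [← Real.rpow_add_of_nonneg h0 hη0 (by linarith)]; simp
    _ ≤ (‖s‖ * x ^ (-s.re - 1)) ^ η * (2 * x ^ (-s.re)) ^ (1 - η) := by
        gcongr
    _ = 2 ^ (1 - η) * ‖s‖ ^ η * (x ^ ((-s.re - 1) * η) * x ^ (-s.re * (1 - η))) := by
        rw [Real.mul_rpow (norm_nonneg _) (by positivity), Real.mul_rpow (by norm_num)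
          (by positivity), ← Real.rpow_mul hx0.le, ← Real.rpow_mul hx0.le]
        ring
    _ = 2 ^ (1 - η) * ‖s‖ ^ η * x ^ (-s.re - η) := by
        rw [← Real.rpow_add hx0]; congr 2; ring
    _ ≤ 2 * ‖s‖ ^ η * x ^ (-s.re - η) := by
        gcongr
        calc (2:ℝ) ^ (1 - η) ≤ 2 ^ (1:ℝ) :=
              Real.rpow_le_rpow_of_exponent_le (by norm_num) (by linarith)
          _ = 2 := by norm_num

theorem summable_add_one_rpow {p : ℝ} (hp : p < -1) :
    Summable fun n : ℕ => ((n : ℝ) + 1) ^ p := by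
  have := (Real.summable_one_div_nat_add_rpow 1 (-p)).2 (by linarith)
  refine this.congr fun n => ?_
  rw [abs_of_nonneg (by positivity), Real.rpow_neg (by positivity)]
  simp

theorem hasSum_cpowGap {s : ℂ} (hs : 1 < s.re) :
    HasSum (fun n : ℕ => cpowGap (n + 1) s) (riemannZeta s - 1 / (s - 1)) := by
  have hs1 : s ≠ 1 := by rintro rfl; simp at hs
  have hs1' : 1 - s ≠ 0 := sub_ne_zero.2 hs1.symm
  have hsum : Summable fun n : ℕ => cpowGap (n + 1) s := by
    refine Summable.of_norm_bounded ((summable_add_one_rpow (p := -s.re - 0)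
      (by linarith)).mul_left (2 * ‖s‖ ^ (0 : ℝ))) fun n => ?_
    exact norm_cpowGap_le_rpow hs1 (by linarith) (by simp) le_rfl zero_le_one
  have hz : HasSum (fun n : ℕ => 1 / ((n : ℂ) + 1) ^ s) (riemannZeta s) := by
    rw [zeta_eq_tsum_one_div_nat_add_one_cpow hs]
    refine Summable.hasSum ?_
    have := (summable_nat_add_iff 1).2 (Complex.summable_one_div_nat_cpow.2 hs)
    simpa using this
  have h1 := hz.tendsto_sum_nat
  have h2 : ∀ N : ℕ, ∑ n ∈ Finset.range N, cpowGap (n + 1) s =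
      ∑ n ∈ Finset.range N, 1 / ((n : ℂ) + 1) ^ s -
        (((N : ℝ) + 1 : ℝ) : ℂ) ^ (1 - s) / (1 - s) + 1 / (1 - s) := by
    intro N
    induction N with
    | zero => simp
    | succ N ih =>
      rw [Finset.sum_range_succ, ih, Finset.sum_range_succ, cpowGap, Complex.cpow_neg]
      push_cast
      ring
  have h3 : Filter.Tendsto (fun N : ℕ => (((N : ℝ) + 1 : ℝ) : ℂ) ^ (1 - s) / (1 - s))
      Filter.atTop (nhds 0) := by
    rw [← zero_div (1 - s)]
    refine Filter.Tendsto.div_const ?_ _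
    rw [tendsto_zero_iff_norm_tendsto_zero]
    have h4 : ∀ N : ℕ, ‖(((N : ℝ) + 1 : ℝ) : ℂ) ^ (1 - s)‖ = ((N : ℝ) + 1) ^ (-(s.re - 1)) := by
      intro N
      rw [Complex.norm_cpow_eq_rpow_re_of_pos (by positivity)]
      simp
    simp only [h4]
    exact (tendsto_rpow_neg_atTop (by linarith)).comp
      (Filter.tendsto_atTop_add_const_right _ _ tendsto_natCast_atTop_atTop)
  have h5 := hsum.hasSum.tendsto_sum_nat
  simp only [h2] at h5
  have h6 := tendsto_nhds_unique h5 ((h1.sub h3).add_const (1 / (1 - s)))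
  rw [hsum.hasSum_iff, h6, ← neg_sub s 1, div_neg]
  ring

/-- The Riemann zeta function minus its polar part grows slower than any power. -/
theorem norm_zeta_sub_le {η : ℝ} (hη : 0 < η) (hη1 : η ≤ 1) :
    ∃ C : ℝ, 0 < C ∧ ∀ s : ℂ, 1 < s.re → ‖riemannZeta s - 1 / (s - 1)‖ ≤ C * ‖s‖ ^ η := by
  have hsum := summable_add_one_rpow (p := -1 - η) (by linarith)
  refine ⟨2 * ∑' n : ℕ, ((n : ℝ) + 1) ^ (-1 - η), ?_, fun s hs => ?_⟩
  · refine mul_pos two_pos (hsum.tsum_pos (fun n => by positivity) 0 (by simp))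
  have hs1 : s ≠ 1 := by rintro rfl; simp at hs
  rw [← (hasSum_cpowGap hs).tsum_eq]
  have h1 := hsum.hasSum.mul_left (2 * ‖s‖ ^ η)
  refine (tsum_of_norm_bounded h1 fun n => ?_).trans (le_of_eq (by ring))
  refine (norm_cpowGap_le_rpow hs1 (by linarith) (by simp) hη.le hη1).trans ?_
  refine mul_le_mul_of_nonneg_left ?_ (by positivity)
  exact Real.rpow_le_rpow_of_exponent_le (by simp) (by linarith)

theorem differentiableAt_cpowGap {x : ℝ} (hx : 0 < x) {s : ℂ} (hs : s ≠ 1) :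
    DifferentiableAt ℂ (cpowGap x) s := by
  have hx0 : (x : ℂ) ≠ 0 := by exact_mod_cast hx.ne'
  have hx1 : ((x + 1 : ℝ) : ℂ) ≠ 0 := by exact_mod_cast (by linarith : x + 1 ≠ 0)
  have hs1' : 1 - s ≠ 0 := sub_ne_zero.2 hs.symm
  unfold cpowGap
  have e1 : DifferentiableAt ℂ (fun s : ℂ => 1 - s) s := by fun_prop
  exact ((differentiableAt_id.neg).const_cpow (Or.inl hx0)).sub
    (((e1.const_cpow (Or.inl hx1)).sub (e1.const_cpow (Or.inl hx0))).div e1 hs1')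

/-- Away from the real axis, the zeta function minus its polar part varies slowly. -/
theorem norm_zeta_sub_zeta_le {η : ℝ} (hη : 0 < η) (hη1 : η ≤ 1) :
    ∃ C : ℝ, 0 < C ∧ ∀ σ σ₁ τ : ℝ, 1 < σ → σ ≤ σ₁ → σ₁ ≤ 2 → 2 ≤ |τ| →
      ‖(riemannZeta (σ + τ * Complex.I) - 1 / (σ + τ * Complex.I - 1)) -
        (riemannZeta (σ₁ + τ * Complex.I) - 1 / (σ₁ + τ * Complex.I - 1))‖ ≤
          C * (σ₁ - σ) * |τ| ^ η := by
  have hsum := summable_add_one_rpow (p := -1 - η / 2) (by linarith)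
  set S := ∑' n : ℕ, ((n : ℝ) + 1) ^ (-1 - η / 2) with hS
  have hSpos : 0 < S := hsum.tsum_pos (fun n => by positivity) 0 (by simp)
  refine ⟨4 / η * 3 ^ η * S, by positivity, fun σ σ₁ τ h1 h12 h2 hτ => ?_⟩
  have hre : ∀ x : ℝ, ((x : ℂ) + τ * Complex.I).re = x := fun x => by simp
  have hτ0 : (0:ℝ) < |τ| := by linarith
  rw [norm_sub_rev, ← (hasSum_cpowGap (s := σ + τ * Complex.I) (by rwa [hre])).tsum_eq,
    ← (hasSum_cpowGap (s := σ₁ + τ * Complex.I) (by rw [hre]; linarith)).tsum_eq,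
    ← Summable.tsum_sub (hasSum_cpowGap (by rw [hre]; linarith)).summable
      (hasSum_cpowGap (by rwa [hre])).summable]
  have h3 := hsum.hasSum.mul_left (4 / η * (3 * |τ|) ^ η * (σ₁ - σ))
  refine (tsum_of_norm_bounded h3 fun n => ?_).trans (le_of_eq ?_)
  swap
  · rw [Real.mul_rpow (by norm_num) hτ0.le]; ring
  have hn0 : (0:ℝ) < (n:ℝ) + 1 := by positivity
  let U : Set ℂ := {s | 1 ≤ s.re ∧ s.re ≤ 2 ∧ s.im = τ}
  have hUconv : Convex ℝ U := by
    have : U = (Complex.reLm ⁻¹' (Set.Icc 1 2)) ∩ (Complex.imLm ⁻¹' {τ}) := by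
      ext s; simp [U, and_assoc]
    rw [this]
    exact ((convex_Icc _ _).linear_preimage _).inter ((convex_singleton _).linear_preimage _)
  have hne1 : ∀ s : ℂ, |s.im - τ| ≤ η / 2 → s ≠ 1 := by
    rintro s hs rfl
    simp only [Complex.one_im, zero_sub, abs_neg] at hs
    linarith
  have hder : ∀ s ∈ U, ‖deriv (cpowGap (n + 1)) s‖ ≤
      4 / η * (3 * |τ|) ^ η * ((n:ℝ) + 1) ^ (-1 - η / 2) := by
    rintro s ⟨hs1, hs2, hs3⟩
    have hcl : ∀ z ∈ Metric.closedBall s (η / 2), |z.im - τ| ≤ η / 2 ∧ |z.re - s.re| ≤ η / 2 ∧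
        ‖z‖ ≤ 3 * |τ| := by
      intro z hz
      rw [mem_closedBall_iff_norm] at hz
      have e1 := (Complex.abs_im_le_norm (z - s)).trans hz
      have e2 := (Complex.abs_re_le_norm (z - s)).trans hz
      rw [Complex.sub_im, hs3] at e1
      refine ⟨e1, e2, ?_⟩
      have e3 : ‖s‖ ≤ 2 + |τ| := by
        refine (Complex.norm_le_abs_re_add_abs_im s).trans ?_
        rw [hs3, abs_of_nonneg (by linarith)]
        linarith
      have e4 := norm_sub_norm_le z s
      linarith
    have h4 : ‖deriv (cpowGap (n + 1)) s‖ ≤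
        (2 * (3 * |τ|) ^ η * ((n:ℝ) + 1) ^ (-1 - η / 2)) / (η / 2) := by
      refine Complex.norm_deriv_le_of_forall_mem_sphere_norm_le (by positivity) ?_ fun z hz => ?_
      · refine DifferentiableOn.diffContOnCl fun z hz => ?_
        rw [closure_ball _ (by positivity)] at hz
        exact (differentiableAt_cpowGap hn0 (hne1 z (hcl z hz).1)).differentiableWithinAt
      · obtain ⟨e1, e2, e3⟩ := hcl z (Metric.sphere_subset_closedBall hz)
        have e4 := (abs_le.1 e2).1
        refine (norm_cpowGap_le_rpow (hne1 z e1) (by linarith) (by simp) hη.le hη1).trans ?_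
        refine mul_le_mul (mul_le_mul_of_nonneg_left (Real.rpow_le_rpow (norm_nonneg _) e3 hη.le)
          two_pos.le) (Real.rpow_le_rpow_of_exponent_le (by simp) (by linarith))
          (by positivity) (by positivity)
    refine h4.trans (le_of_eq ?_)
    field_simp
    ring
  have h5 := hUconv.norm_image_sub_le_of_norm_deriv_le (𝕜 := ℂ) (f := cpowGap (n + 1))
    (x := σ + τ * Complex.I) (y := σ₁ + τ * Complex.I)
    (fun s hs => differentiableAt_cpowGap hn0 (hne1 s (by rw [hs.2.2]; simp; linarith))) hder
    ⟨by rw [hre]; linarith, by rw [hre]; linarith, by simp⟩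
    ⟨by rw [hre]; linarith, by rw [hre]; linarith, by simp⟩
  refine h5.trans (le_of_eq ?_)
  have : ‖(σ₁ : ℂ) + τ * Complex.I - (σ + τ * Complex.I)‖ = σ₁ - σ := by
    rw [add_sub_add_right_eq_sub, ← Complex.ofReal_sub, Complex.norm_real, Real.norm_eq_abs,
      abs_of_nonneg (by linarith)]
  rw [this]
  ring

theorem zeta_three_four_one {x : ℝ} (hx : 0 < x) (y : ℝ) :
    1 ≤ ‖riemannZeta ((1 + x : ℝ) : ℂ)‖ ^ 3 * ‖riemannZeta ((1 + x : ℝ) + y * Complex.I)‖ ^ 4 *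
      ‖riemannZeta ((1 + x : ℝ) + (2 * y : ℝ) * Complex.I)‖ := by
  have h := DirichletCharacter.norm_LFunction_product_ge_one (1 : DirichletCharacter ℂ 1) hx y
  rw [DirichletCharacter.LFunctionTrivChar, DirichletCharacter.LFunction_modOne_eq,
    DirichletCharacter.LFunction_modOne_eq, norm_mul, norm_mul, norm_pow, norm_pow] at h
  push_cast
  convert h using 4
  · ring_nf
  · ring_nf

theorem norm_zeta_real_le (B : ℝ) :
    ∃ C : ℝ, 0 < C ∧ ∀ x : ℝ, 0 < x → x ≤ B → ‖riemannZeta ((1 + x : ℝ) : ℂ)‖ ≤ C / x := by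
  obtain ⟨C, hC, h⟩ := norm_zeta_sub_le one_pos le_rfl
  refine ⟨1 + C * (1 + |B|) * |B|, by positivity, fun x hx hxB => ?_⟩
  have h1 := h ((1 + x : ℝ) : ℂ) (by simp; exact hx)
  have e1 : (((1 + x : ℝ) : ℂ) - 1) = (x : ℂ) := by push_cast; ring
  rw [e1, Complex.norm_real, Real.norm_of_nonneg (by linarith), Real.rpow_one] at h1
  have h2 : ‖riemannZeta ((1 + x : ℝ) : ℂ)‖ ≤ C * (1 + x) + 1 / x := by
    have h3 := norm_sub_norm_le (riemannZeta ((1 + x : ℝ) : ℂ)) (1 / (x : ℂ))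
    rw [norm_div, norm_one, Complex.norm_real, Real.norm_of_nonneg hx.le] at h3
    linarith
  refine h2.trans ?_
  rw [le_div_iff₀ hx, add_mul, one_div, inv_mul_cancel₀ hx.ne']
  have hB : x ≤ |B| := hxB.trans (le_abs_self B)
  have : C * (1 + x) * x ≤ C * (1 + |B|) * |B| := by gcongr
  linarith

theorem norm_zeta_im_le (B : ℝ) {θ : ℝ} (hθ : 0 < θ) (hθ1 : θ ≤ 1) :
    ∃ C : ℝ, 0 < C ∧ ∀ x y : ℝ, 0 < x → x ≤ B → 1 ≤ |y| →
      ‖riemannZeta ((1 + x : ℝ) + y * Complex.I)‖ ≤ C * |y| ^ θ := by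
  obtain ⟨C, hC, h⟩ := norm_zeta_sub_le hθ hθ1
  refine ⟨1 + C * (2 + |B|) ^ θ, by positivity, fun x y hx hxB hy => ?_⟩
  set s : ℂ := (1 + x : ℝ) + y * Complex.I with hs
  have h1 := h s (by simp [hs, hx])
  have h2 : ‖s‖ ≤ (2 + |B|) * |y| := by
    refine (Complex.norm_le_abs_re_add_abs_im s).trans ?_
    have e1 : s.re = 1 + x := by simp [hs]
    have e2 : s.im = y := by simp [hs]
    rw [e1, e2, abs_of_nonneg (by linarith)]
    have : x ≤ |B| := hxB.trans (le_abs_self B)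
    nlinarith [abs_nonneg B]
  have h3 : ‖1 / (s - 1)‖ ≤ 1 := by
    rw [norm_div, norm_one]
    refine div_le_one_of_le₀ (hy.trans ?_) (norm_nonneg _)
    have := Complex.abs_im_le_norm (s - 1)
    simpa [hs] using this
  have h4 := norm_sub_norm_le (riemannZeta s) (1 / (s - 1))
  have h5 : 1 ≤ |y| ^ θ := Real.one_le_rpow hy hθ.le
  have h6 : ‖s‖ ^ θ ≤ (2 + |B|) ^ θ * |y| ^ θ := by
    rw [← Real.mul_rpow (by positivity) (by positivity)]
    exact Real.rpow_le_rpow (norm_nonneg _) h2 hθ.le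
  nlinarith [mul_le_mul_of_nonneg_left h6 hC.le]

/-- A lower bound for the zeta function to the right of the line `Re s = 1`, far from the real
axis. -/
theorem norm_zeta_ge (B : ℝ) {η : ℝ} (hη : 0 < η) (hη1 : η ≤ 1) :
    ∃ c T : ℝ, 0 < c ∧ 2 ≤ T ∧ ∀ x y : ℝ, 0 < x → x ≤ B → T ≤ |y| →
      c * |y| ^ (-η) ≤ ‖riemannZeta ((1 + x : ℝ) + y * Complex.I)‖ := by
  set B' : ℝ := max B 1 with hB'
  obtain ⟨C₁, hC₁, h₁⟩ := norm_zeta_real_le B'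
  obtain ⟨C₂, hC₂, h₂⟩ := norm_zeta_im_le B' (θ := η / 10) (by linarith) (by linarith)
  obtain ⟨C₃, hC₃, h₃⟩ := norm_zeta_sub_zeta_le (η := η / 10) (by linarith) (by linarith)
  -- the range `x ≥ |y|^{-η}`
  obtain ⟨c, hc, hbig⟩ : ∃ c : ℝ, 0 < c ∧ ∀ x y : ℝ, x ≤ B' → 2 ≤ |y| → |y| ^ (-η) ≤ x →
      c * |y| ^ (-(31 / 40 * η)) ≤ ‖riemannZeta ((1 + x : ℝ) + y * Complex.I)‖ := by
    refine ⟨((C₁ ^ 3 * (C₂ * 2 ^ (η / 10)))⁻¹) ^ (1 / 4 : ℝ), by positivity,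
      fun x y hxB hy hxy => ?_⟩
    have hy0 : 0 < |y| := by linarith
    have hx : 0 < x := (Real.rpow_pos_of_pos hy0 _).trans_le hxy
    have e1 := h₁ x hx hxB
    have e2 := h₂ x (2 * y) hx hxB (by rw [abs_mul, abs_two]; linarith)
    have e3 := zeta_three_four_one hx y
    set Z := ‖riemannZeta ((1 + x : ℝ) + y * Complex.I)‖ with hZ
    rw [abs_mul, abs_two, Real.mul_rpow two_pos.le hy0.le] at e2
    have e4 : 1 ≤ (C₁ / x) ^ 3 * Z ^ 4 * (C₂ * (2 ^ (η / 10) * |y| ^ (η / 10))) := by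
      refine e3.trans ?_
      gcongr
    have e5 : (C₁ / x) ^ 3 ≤ C₁ ^ 3 * |y| ^ (3 * η) := by
      rw [div_pow, div_le_iff₀ (by positivity), mul_assoc]
      refine le_mul_of_one_le_right (by positivity) ?_
      have : (1:ℝ) = |y| ^ (3 * η) * (|y| ^ (-η)) ^ 3 := by
        rw [← Real.rpow_mul_natCast hy0.le, ← Real.rpow_add hy0]
        norm_num
        rw [show 3 * η + -(η * 3) = 0 by ring, Real.rpow_zero]
      rw [this]
      gcongr
    have e6 : 1 ≤ (C₁ ^ 3 * (C₂ * 2 ^ (η / 10))) * |y| ^ (31 / 10 * η) * Z ^ 4 := by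
      refine e4.trans ?_
      calc (C₁ / x) ^ 3 * Z ^ 4 * (C₂ * (2 ^ (η / 10) * |y| ^ (η / 10)))
          ≤ (C₁ ^ 3 * |y| ^ (3 * η)) * Z ^ 4 * (C₂ * (2 ^ (η / 10) * |y| ^ (η / 10))) := by
            gcongr
        _ = (C₁ ^ 3 * (C₂ * 2 ^ (η / 10))) * (|y| ^ (3 * η) * |y| ^ (η / 10)) * Z ^ 4 := by ring
        _ = _ := by rw [← Real.rpow_add hy0]; congr 3; ring
    have e7 : (C₁ ^ 3 * (C₂ * 2 ^ (η / 10)))⁻¹ * |y| ^ (-(31 / 10 * η)) ≤ Z ^ 4 := by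
      rw [Real.rpow_neg hy0.le, ← mul_inv, inv_le_iff_one_le_mul₀ (by positivity)]
      linarith
    calc ((C₁ ^ 3 * (C₂ * 2 ^ (η / 10)))⁻¹) ^ (1 / 4 : ℝ) * |y| ^ (-(31 / 40 * η))
        = ((C₁ ^ 3 * (C₂ * 2 ^ (η / 10)))⁻¹ * |y| ^ (-(31 / 10 * η))) ^ (1 / 4 : ℝ) := by
          rw [Real.mul_rpow (by positivity) (by positivity), ← Real.rpow_mul hy0.le]
          congr 2; ring
      _ ≤ (Z ^ 4) ^ (1 / 4 : ℝ) := Real.rpow_le_rpow (by positivity) e7 (by norm_num)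
      _ = Z := by
          rw [← Real.rpow_natCast, ← Real.rpow_mul (norm_nonneg _),
            show ((4 : ℕ) : ℝ) * (1 / 4) = 1 by norm_num, Real.rpow_one]
  set T : ℝ := max 2 ((2 * (C₃ + 1) / c) ^ (8 / η)) with hT
  refine ⟨c / 2, T, by positivity, le_max_left _ _, fun x y hx hxB hy => ?_⟩
  have hy2 : 2 ≤ |y| := (le_max_left _ _).trans hy
  have hy0 : 0 < |y| := by linarith
  have hy1 : 1 ≤ |y| := by linarith
  have hxB' : x ≤ B' := hxB.trans (le_max_left _ _)
  have hweak : |y| ^ (-η) ≤ |y| ^ (-(31 / 40 * η)) :=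
    Real.rpow_le_rpow_of_exponent_le hy1 (by linarith)
  rcases le_total (|y| ^ (-η)) x with hxy | hxy
  · have := hbig x y hxB' hy2 hxy
    have h0 : 0 < |y| ^ (-(31 / 40 * η)) := Real.rpow_pos_of_pos hy0 _
    nlinarith
  set x₁ := |y| ^ (-η) with hx₁
  have hx₁1 : x₁ ≤ 1 := Real.rpow_le_one_of_one_le_of_nonpos hy1 (by linarith)
  have e1 := hbig x₁ y (hx₁1.trans (le_max_right _ _)) hy2 le_rfl
  have e2 := h₃ (1 + x) (1 + x₁) y (by linarith) (by linarith) (by linarith) hy2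
  set s : ℂ := (1 + x : ℝ) + y * Complex.I with hs
  set s₁ : ℂ := (1 + x₁ : ℝ) + y * Complex.I with hs₁
  have him : (s - 1).im = y := by simp [hs]
  have him₁ : (s₁ - 1).im = y := by simp [hs₁]
  have hn : |y| ≤ ‖s - 1‖ := by rw [← him]; exact Complex.abs_im_le_norm _
  have hn₁ : |y| ≤ ‖s₁ - 1‖ := by rw [← him₁]; exact Complex.abs_im_le_norm _
  have e3 : ‖1 / (s - 1) - 1 / (s₁ - 1)‖ ≤ x₁ := by
    have h1 : s - 1 ≠ 0 := norm_pos_iff.1 (by linarith)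
    have h2 : s₁ - 1 ≠ 0 := norm_pos_iff.1 (by linarith)
    have h3 : 1 / (s - 1) - 1 / (s₁ - 1) = ((x₁ - x : ℝ) : ℂ) / ((s - 1) * (s₁ - 1)) := by
      field_simp
      simp [hs, hs₁]
    rw [h3, norm_div, norm_mul, Complex.norm_real, Real.norm_of_nonneg (by linarith)]
    refine (div_le_self (by linarith) ?_).trans (by linarith)
    nlinarith
  have e4 : ‖riemannZeta s - riemannZeta s₁‖ ≤ (C₃ + 1) * |y| ^ (-(9 / 10 * η)) := by
    have h1 : riemannZeta s - riemannZeta s₁ = ((riemannZeta s - 1 / (s - 1)) -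
        (riemannZeta s₁ - 1 / (s₁ - 1))) + (1 / (s - 1) - 1 / (s₁ - 1)) := by ring
    rw [h1]
    have h2 : x₁ * |y| ^ (η / 10) = |y| ^ (-(9 / 10 * η)) := by
      rw [hx₁, ← Real.rpow_add hy0]; congr 1; ring
    have h3 : x₁ ≤ |y| ^ (-(9 / 10 * η)) :=
      Real.rpow_le_rpow_of_exponent_le hy1 (by linarith)
    have h4 : C₃ * (1 + x₁ - (1 + x)) * |y| ^ (η / 10) ≤ C₃ * (x₁ * |y| ^ (η / 10)) := by
      rw [mul_assoc]
      gcongr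
      linarith
    rw [h2] at h4
    exact (norm_add_le _ _).trans (by linarith [e2.trans h4])
  have e5 : (C₃ + 1) * |y| ^ (-(9 / 10 * η)) ≤ c / 2 * |y| ^ (-(31 / 40 * η)) := by
    have h1 : |y| ^ (-(31 / 40 * η)) = |y| ^ (-(9 / 10 * η)) * |y| ^ (η / 8) := by
      rw [← Real.rpow_add hy0]; congr 1; ring
    have h2 : 2 * (C₃ + 1) / c ≤ |y| ^ (η / 8) := by
      have h3 : (2 * (C₃ + 1) / c) ^ (8 / η) ≤ |y| := (le_max_right _ _).trans hy
      calc 2 * (C₃ + 1) / c = ((2 * (C₃ + 1) / c) ^ (8 / η)) ^ (η / 8) := by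
            rw [← Real.rpow_mul (by positivity), show 8 / η * (η / 8) = 1 by field_simp,
              Real.rpow_one]
        _ ≤ _ := Real.rpow_le_rpow (by positivity) h3 (by positivity)
    rw [div_le_iff₀ hc] at h2
    rw [h1]
    nlinarith [Real.rpow_pos_of_pos hy0 (-(9 / 10 * η))]
  have e6 := norm_sub_norm_le (riemannZeta s₁) (riemannZeta s)
  rw [norm_sub_rev] at e6
  nlinarith

theorem exists_le_norm_mul_zeta {B T : ℝ} (hB : 0 ≤ B) (hT : 0 ≤ T) :
    ∃ c : ℝ, 0 < c ∧ ∀ z : ℂ, 0 < z.re → z.re ≤ B → |z.im| ≤ T →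
      c ≤ ‖z‖ * ‖riemannZeta (1 + z)‖ := by
  set g : ℂ → ℂ := Function.update (fun z => z * riemannZeta (1 + z)) 0 1 with hg
  have hg0 : g 0 = 1 := by simp [hg]
  have hgz : ∀ z, z ≠ 0 → g z = z * riemannZeta (1 + z) := fun z hz => by
    rw [hg, Function.update_of_ne hz]
  have hcont : Continuous g := by
    rw [continuous_iff_continuousAt]
    intro z
    rcases eq_or_ne z 0 with rfl | hz
    · rw [hg, continuousAt_update_same]
      have h := riemannZeta_residue_one
      have h2 : Filter.Tendsto (fun z : ℂ => 1 + z) (nhdsWithin 0 {0}ᶜ) (nhdsWithin 1 {1}ᶜ) := by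
        refine tendsto_nhdsWithin_iff.2 ⟨?_, ?_⟩
        · have : Filter.Tendsto (fun z : ℂ => 1 + z) (nhds 0) (nhds (1 + 0)) :=
            (continuous_const.add continuous_id).tendsto 0
          rw [add_zero] at this
          exact this.mono_left nhdsWithin_le_nhds
        · filter_upwards [self_mem_nhdsWithin] with z hz
          simpa using hz
      have h3 := h.comp h2
      refine h3.congr fun z => ?_
      simp
    · have h1 : ContinuousAt (fun z : ℂ => z * riemannZeta (1 + z)) z := by
        refine continuousAt_id.mul ?_
        have h2 : DifferentiableAt ℂ riemannZeta (1 + z) :=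
          differentiableAt_riemannZeta (by simpa using hz)
        exact ContinuousAt.comp' h2.continuousAt (continuousAt_const.add continuousAt_id)
      exact h1.congr (by
        filter_upwards [isOpen_ne.mem_nhds hz] with w hw
        exact (hgz w hw).symm)
  have hK : IsCompact (Set.Icc 0 B ×ℂ Set.Icc (-T) T) :=
    isCompact_Icc.reProdIm isCompact_Icc
  have hne : (Set.Icc 0 B ×ℂ Set.Icc (-T) T).Nonempty :=
    ⟨0, by simp [Complex.mem_reProdIm, hB, hT]⟩
  obtain ⟨w, hw, hmin⟩ := hK.exists_isMinOn hne hcont.norm.continuousOn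
  refine ⟨‖g w‖, ?_, fun z hz hzB hzT => ?_⟩
  · rw [norm_pos_iff]
    rcases eq_or_ne w 0 with rfl | hw0
    · rw [hg0]; exact one_ne_zero
    · rw [hgz w hw0]
      refine mul_ne_zero hw0 (riemannZeta_ne_zero_of_one_le_re ?_)
      have := hw.1.1
      simp only [Complex.add_re, Complex.one_re]
      linarith
  · have hz0 : z ≠ 0 := by rintro rfl; simp at hz
    have h := hmin (a := z) ⟨⟨hz.le, hzB⟩, abs_le.1 hzT⟩
    simp only [Set.mem_ofPred_eq] at h
    rwa [hgz z hz0, norm_mul] at h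

/-- Near the line `Re z = 0`, the size of `ζ (1 + z)` is that of `max (1 / ‖z‖) 1`, up to an
arbitrarily small power of `1 + ‖z‖`. -/
theorem abs_log_norm_zeta_add_le {B : ℝ} (hB : 0 ≤ B) {η : ℝ} (hη : 0 < η) (hη1 : η ≤ 1) :
    ∃ C : ℝ, 0 < C ∧ ∀ z : ℂ, 0 < z.re → z.re ≤ B →
      |Real.log ‖riemannZeta (1 + z)‖ + min (Real.log ‖z‖) 0| ≤ C + η * Real.log (1 + ‖z‖) := by
  obtain ⟨C₁, hC₁, h₁⟩ := norm_zeta_sub_le hη hη1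
  obtain ⟨c₂, T, hc₂, hT, h₂⟩ := norm_zeta_ge B hη hη1
  obtain ⟨c₃, hc₃, h₃⟩ := exists_le_norm_mul_zeta hB (T := T) (by linarith)
  refine ⟨1 + |Real.log (1 + C₁)| + |Real.log c₂| + |Real.log c₃| + |Real.log (c₃ / (B + T))|,
    by positivity, fun z hz hzB => ?_⟩
  have hz0 : z ≠ 0 := by rintro rfl; simp at hz
  have hn : 0 < ‖z‖ := norm_pos_iff.2 hz0
  have hζ : 0 < ‖riemannZeta (1 + z)‖ := norm_pos_iff.2
    (riemannZeta_ne_zero_of_one_le_re (by simp [hz.le]))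
  have hmin : min (Real.log ‖z‖) 0 = Real.log (min ‖z‖ 1) := by
    rcases le_total ‖z‖ 1 with h | h
    · rw [min_eq_left h, min_eq_left (Real.log_nonpos hn.le h)]
    · rw [min_eq_right h, min_eq_right (Real.log_nonneg h), Real.log_one]
  have hm : 0 < min ‖z‖ 1 := lt_min hn one_pos
  rw [hmin, ← Real.log_mul hζ.ne' hm.ne']
  have a1 := neg_abs_le (Real.log c₂)
  have a2 := neg_abs_le (Real.log c₃)
  have a3 := neg_abs_le (Real.log (c₃ / (B + T)))
  have a4 := le_abs_self (Real.log (1 + C₁))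
  have b1 := abs_nonneg (Real.log c₂)
  have b2 := abs_nonneg (Real.log c₃)
  have b3 := abs_nonneg (Real.log (c₃ / (B + T)))
  have b4 := abs_nonneg (Real.log (1 + C₁))
  have hl : 0 ≤ Real.log (1 + ‖z‖) := Real.log_nonneg (by linarith)
  have hl' : 0 ≤ η * Real.log (1 + ‖z‖) := by positivity
  refine abs_le.2 ⟨?_, ?_⟩
  · rcases le_total T |z.im| with hi | hi
    · have h := h₂ z.re z.im hz hzB hi
      have e1 : ((1 + z.re : ℝ) : ℂ) + z.im * Complex.I = 1 + z := by
        push_cast; rw [add_assoc, Complex.re_add_im]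
      rw [e1] at h
      have hi' := Complex.abs_im_le_norm z
      rw [min_eq_right (by linarith), mul_one]
      have hp : 0 < |z.im| := by linarith
      have := Real.log_le_log (by positivity) h
      rw [Real.log_mul hc₂.ne' (Real.rpow_pos_of_pos hp _).ne', Real.log_rpow hp] at this
      have h5 : Real.log |z.im| ≤ Real.log (1 + ‖z‖) := Real.log_le_log hp (by linarith)
      nlinarith
    · have h := h₃ z hz hzB hi
      rcases le_total ‖z‖ 1 with h1 | h1
      · rw [min_eq_left h1, mul_comm ‖riemannZeta (1 + z)‖]
        have := Real.log_le_log hc₃ h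
        linarith
      · rw [min_eq_right h1, mul_one]
        have hle : ‖z‖ ≤ B + T := by
          refine (Complex.norm_le_abs_re_add_abs_im z).trans ?_
          rw [abs_of_pos hz]
          linarith
        have : c₃ / (B + T) ≤ ‖riemannZeta (1 + z)‖ := by
          rw [div_le_iff₀ (by linarith)]
          nlinarith
        have := Real.log_le_log (by positivity) this
        linarith
  · have h := h₁ (1 + z) (by simp [hz])
    rw [add_sub_cancel_left] at h
    have h5 := norm_sub_norm_le (riemannZeta (1 + z)) (1 / z)
    rw [norm_div, norm_one] at h5
    have h6 : ‖1 + z‖ ^ η ≤ (1 + ‖z‖) ^ η := by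
      refine Real.rpow_le_rpow (norm_nonneg _) ?_ hη.le
      simpa using norm_add_le (1:ℂ) z
    have h7 : 1 ≤ (1 + ‖z‖) ^ η := Real.one_le_rpow (by linarith) hη.le
    have h8 : ‖riemannZeta (1 + z)‖ * min ‖z‖ 1 ≤ (1 + C₁) * (1 + ‖z‖) ^ η := by
      have e1 : ‖riemannZeta (1 + z)‖ ≤ C₁ * (1 + ‖z‖) ^ η + 1 / ‖z‖ := by nlinarith
      calc _ ≤ (C₁ * (1 + ‖z‖) ^ η + 1 / ‖z‖) * min ‖z‖ 1 := by gcongr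
        _ = C₁ * (1 + ‖z‖) ^ η * min ‖z‖ 1 + 1 / ‖z‖ * min ‖z‖ 1 := by ring
        _ ≤ C₁ * (1 + ‖z‖) ^ η * 1 + 1 / ‖z‖ * ‖z‖ := by
            gcongr
            · exact min_le_right _ _
            · exact min_le_left _ _
        _ ≤ _ := by rw [one_div, inv_mul_cancel₀ hn.ne']; linarith
    have := Real.log_le_log (by positivity) h8
    rw [Real.log_mul (x := 1 + C₁) (by positivity) (by positivity),
      Real.log_rpow (by positivity)] at this
    linarith

/-- Lipschitz bounds for `∏ (1 + q y i)` and for the part of it of degree at least two in `q`. -/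
theorem exists_prod_one_add_lipschitz {ι : Type*} (s : Finset ι) {K : ℝ} (hK : 0 ≤ K) :
    ∃ C : ℝ, 0 ≤ C ∧ ∀ (q : ℂ) (y y' : ι → ℂ) (δ : ℝ), ‖q‖ ≤ 1 → (∀ i, ‖y i‖ ≤ K) →
      (∀ i, ‖y' i‖ ≤ K) → (∀ i, ‖y i - y' i‖ ≤ δ) →
      ‖∏ i ∈ s, (1 + q * y i) - 1‖ ≤ C * ‖q‖ ∧
      ‖∏ i ∈ s, (1 + q * y i) - ∏ i ∈ s, (1 + q * y' i)‖ ≤ C * (‖q‖ * δ) ∧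
      ‖(∏ i ∈ s, (1 + q * y i) - q * ∑ i ∈ s, y i) -
        (∏ i ∈ s, (1 + q * y' i) - q * ∑ i ∈ s, y' i)‖ ≤ C * (‖q‖ ^ 2 * δ) := by
  induction s using Finset.induction_on with
  | empty => exact ⟨0, le_rfl, fun q y y' δ _ _ _ _ => by simp⟩
  | insert a s ha ih =>
    obtain ⟨C, hC, ih⟩ := ih
    refine ⟨1 + 2 * C + C * K + K + C, by positivity, fun q y y' δ hq hy hy' hδ => ?_⟩
    obtain ⟨h1, h2, h3⟩ := ih q y y' δ hq hy hy' hδ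
    have hδ0 : 0 ≤ δ := (norm_nonneg _).trans (hδ a)
    simp only [Finset.prod_insert ha, Finset.sum_insert ha]
    set P := ∏ i ∈ s, (1 + q * y i)
    set P' := ∏ i ∈ s, (1 + q * y' i)
    set Y := ∑ i ∈ s, y i
    set Y' := ∑ i ∈ s, y' i
    have hd := hδ a
    have hya := hy a
    have hya' := hy' a
    set α := y a
    set β := y' a
    have hP : ‖(α - β) * (P - 1) + β * (P - P')‖ ≤ (C + C * K) * (‖q‖ * δ) := by
      refine (norm_add_le _ _).trans ?_
      rw [norm_mul, norm_mul]
      have e1 : ‖α - β‖ * ‖P - 1‖ ≤ δ * (C * ‖q‖) := by gcongr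
      have e2 : ‖β‖ * ‖P - P'‖ ≤ K * (C * (‖q‖ * δ)) := by gcongr
      linarith
    have hq0 := norm_nonneg q
    have hqδ : 0 ≤ ‖q‖ * δ := by positivity
    refine ⟨?_, ?_, ?_⟩
    · have e : (1 + q * α) * P - 1 = (P - 1) + q * α * (P - 1) + q * α := by ring
      rw [e]
      refine (norm_add₃_le).trans ?_
      simp only [norm_mul]
      have e1 : ‖q‖ * ‖α‖ * ‖P - 1‖ ≤ 1 * K * (C * ‖q‖) := by gcongr
      have e2 : ‖q‖ * ‖α‖ ≤ ‖q‖ * K := by gcongr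
      nlinarith [mul_nonneg hC hq0]
    · have e : (1 + q * α) * P - (1 + q * β) * P' =
          (P - P') + q * ((α - β) * (P - 1) + β * (P - P')) + q * (α - β) := by ring
      rw [e]
      refine (norm_add₃_le).trans ?_
      rw [norm_mul q, norm_mul q]
      have e1 : ‖q‖ * ‖(α - β) * (P - 1) + β * (P - P')‖ ≤ 1 * ((C + C * K) * (‖q‖ * δ)) := by
        gcongr
      have e2 : ‖q‖ * ‖α - β‖ ≤ ‖q‖ * δ := by gcongr
      nlinarith [mul_nonneg hC hqδ, mul_nonneg hK hqδ]
    · have e : ((1 + q * α) * P - q * (α + Y)) - ((1 + q * β) * P' - q * (β + Y')) =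
          ((P - q * Y) - (P' - q * Y')) + q * ((α - β) * (P - 1) + β * (P - P')) := by ring
      rw [e]
      refine (norm_add_le _ _).trans ?_
      rw [norm_mul q]
      have e1 : ‖q‖ * ‖(α - β) * (P - 1) + β * (P - P')‖ ≤
          ‖q‖ * ((C + C * K) * (‖q‖ * δ)) := by gcongr
      have hq2 : 0 ≤ ‖q‖ ^ 2 * δ := by positivity
      nlinarith [mul_nonneg hC hq2, mul_nonneg hK hq2]

theorem norm_prod_sub_prod_le {ι : Type*} (s : Finset ι) (x : ι → ℂ) (hx : ∀ i, ‖x i‖ ≤ 1) :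
    ‖1 - ∏ i ∈ s, x i‖ ≤ ∑ i ∈ s, ‖1 - x i‖ := by
  induction s using Finset.induction_on with
  | empty => simp
  | insert a s ha ih =>
    rw [Finset.prod_insert ha, Finset.sum_insert ha]
    have e : 1 - x a * ∏ i ∈ s, x i = (1 - x a) + x a * (1 - ∏ i ∈ s, x i) := by ring
    rw [e]
    refine (norm_add_le _ _).trans ?_
    rw [norm_mul]
    have := mul_le_mul (hx a) ih (norm_nonneg _) zero_le_one
    linarith

theorem exists_local_factor_sub_one_le {m : ℕ} (hm : 1 ≤ m) :
    ∃ C : ℝ, 0 < C ∧ ∀ (q : ℂ) (x : Fin m → ℂ), ‖q‖ ≤ 1 / 2 → (∀ j, ‖x j‖ ≤ 1) →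
      ‖(1 + q * (∏ j, (1 - x j) - 1)) * ∏ J : Finset (Fin m) with J.Nonempty,
        (1 - q * ∏ j ∈ J, x j) ^ ((-1 : ℤ) ^ J.card) - 1‖ ≤ C * (‖q‖ ^ 2 * ∑ j, ‖1 - x j‖) := by
  set Ev : Finset (Finset (Fin m)) := Finset.univ.filter fun J => Even J.card with hEv
  set Od : Finset (Finset (Fin m)) := Finset.univ.filter fun J => ¬ Even J.card with hOd
  set K : ℝ := 2 ^ m + 1 with hK
  have hK0 : 0 ≤ K := by positivity
  have hK1 : 1 ≤ K := by rw [hK]; linarith [show (0:ℝ) ≤ 2 ^ m by positivity]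
  obtain ⟨C₁, hC₁, h₁⟩ := exists_prod_one_add_lipschitz Ev hK0
  obtain ⟨C₂, hC₂, h₂⟩ := exists_prod_one_add_lipschitz Od hK0
  refine ⟨(C₁ + C₂) * 2 ^ m * 2 ^ Od.card + 1, by positivity, fun q x hq hx => ?_⟩
  set δ : ℝ := ∑ j, ‖1 - x j‖ with hδ
  have hδ0 : 0 ≤ δ := Finset.sum_nonneg fun _ _ => norm_nonneg _
  set X : Finset (Fin m) → ℂ := fun J => ∏ j ∈ J, x j with hX
  have hX1 : ∀ J, ‖X J‖ ≤ 1 := fun J => by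
    rw [hX, norm_prod]
    exact Finset.prod_le_one (fun _ _ => norm_nonneg _) fun j _ => hx j
  set w : ℂ := ∏ j, (1 - x j) - 1 with hw
  set y : Finset (Fin m) → ℂ := fun J => if J = ∅ then w else -X J with hy
  have h1x : ∀ j, ‖1 - x j‖ ≤ 2 := fun j =>
    (norm_sub_le _ _).trans (by rw [norm_one]; linarith [hx j])
  have hprod : ‖∏ j, (1 - x j)‖ ≤ 2 ^ m := by
    rw [norm_prod]
    refine (Finset.prod_le_prod (fun _ _ => norm_nonneg _) fun j _ => h1x j).trans ?_
    simp
  have hwK : ‖w‖ ≤ K := by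
    refine (norm_sub_le _ _).trans ?_
    rw [norm_one]; linarith
  have hyK : ∀ J, ‖y J‖ ≤ K := fun J => by
    by_cases hJ : J = ∅
    · simpa [hy, hJ] using hwK
    · simpa [hy, hJ] using (hX1 J).trans hK1
  have h2m : (1:ℝ) ≤ 2 ^ m := one_le_pow₀ (by norm_num)
  have hydiff : ∀ J, ‖y J - (-1)‖ ≤ 2 ^ m * δ := fun J => by
    by_cases hJ : J = ∅
    · have e : y J - (-1) = ∏ j, (1 - x j) := by simp [hy, hJ, hw]
      rw [e, norm_prod]
      set j₀ : Fin m := ⟨0, hm⟩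
      rw [← Finset.mul_prod_erase _ _ (Finset.mem_univ j₀), mul_comm]
      have e1 : ∏ j ∈ Finset.univ.erase j₀, ‖1 - x j‖ ≤ 2 ^ m := by
        refine (Finset.prod_le_prod (fun _ _ => norm_nonneg _) fun j _ => h1x j).trans ?_
        rw [Finset.prod_const]
        refine pow_le_pow_right₀ (by norm_num) ((Finset.card_le_univ _).trans (by simp))
      have e2 : ‖1 - x j₀‖ ≤ δ :=
        Finset.single_le_sum (f := fun j => ‖1 - x j‖) (fun _ _ => norm_nonneg _)
          (Finset.mem_univ j₀)
      gcongr
    · have e : y J - (-1) = 1 - X J := by simp [hy, hJ]; ring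
      rw [e]
      refine (norm_prod_sub_prod_le J x hx).trans ?_
      refine (Finset.sum_le_sum_of_subset_of_nonneg (Finset.subset_univ J)
        fun _ _ _ => norm_nonneg _).trans ?_
      exact le_mul_of_one_le_left hδ0 h2m
  have hq1 : ‖q‖ ≤ 1 := by linarith
  have k₁ := (h₁ q y (fun _ => -1) _ hq1 hyK (fun _ => by simpa using hK1) hydiff).2.2
  have k₂ := (h₂ q y (fun _ => -1) _ hq1 hyK (fun _ => by simpa using hK1) hydiff).2.2
  have hne : (Finset.univ : Finset (Fin m)).Nonempty := ⟨⟨0, hm⟩, Finset.mem_univ _⟩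
  have hcard : Ev.card = Od.card := by
    have h := Finset.sum_powerset_neg_one_pow_card_of_nonempty hne
    rw [Finset.powerset_univ, ← Finset.sum_filter_add_sum_filter_not _
      (fun J : Finset (Fin m) => Even J.card)] at h
    rw [Finset.sum_congr rfl (g := fun _ => (1:ℤ)) fun J hJ =>
        Even.neg_one_pow (Finset.mem_filter.1 hJ).2,
      Finset.sum_congr (s₁ := Finset.univ.filter fun J : Finset (Fin m) => ¬ Even J.card) rfl
        (g := fun _ => (-1:ℤ)) fun J hJ =>
        Odd.neg_one_pow (Nat.not_even_iff_odd.1 (Finset.mem_filter.1 hJ).2)] at h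
    simp only [Finset.sum_const, nsmul_eq_mul, mul_one, mul_neg] at h
    have : (Ev.card : ℤ) = Od.card := by linarith
    exact_mod_cast this
  have hw' : w = ∑ J : Finset (Fin m) with J.Nonempty, (-1) ^ J.card * X J := by
    rw [hw, Finset.prod_sub]
    simp only [Finset.prod_const_one, mul_one, Finset.powerset_univ]
    rw [← Finset.sum_filter_add_sum_filter_not _ (fun J : Finset (Fin m) => J.Nonempty)]
    have : (Finset.univ.filter fun J : Finset (Fin m) => ¬ J.Nonempty) = {∅} := by
      ext J; simp [Finset.not_nonempty_iff_eq_empty]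
    rw [this]
    simp [hX]
  have e0 : (∅ : Finset (Fin m)) ∈ Ev := by simp [hEv]
  have e1 : (Finset.univ.filter fun J : Finset (Fin m) => J.Nonempty) = Ev.erase ∅ ∪ Od := by
    ext J
    by_cases hJ : J = ∅
    · simp [hJ, hOd]
    · simp [hEv, hOd, hJ, Finset.nonempty_iff_ne_empty, Nat.even_or_odd]
  have e2 : Disjoint (Ev.erase ∅) Od := by
    rw [Finset.disjoint_left]
    intro J hJ hJ'
    exact (Finset.mem_filter.1 hJ').2 (Finset.mem_filter.1 (Finset.mem_of_mem_erase hJ)).2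
  have hsum : ∑ J ∈ Ev, y J = ∑ J ∈ Od, y J := by
    rw [e1, Finset.sum_union e2] at hw'
    rw [← Finset.add_sum_erase _ _ e0]
    have e3 : ∑ J ∈ Ev.erase ∅, y J = -∑ J ∈ Ev.erase ∅, (-1) ^ J.card * X J := by
      rw [← Finset.sum_neg_distrib]
      refine Finset.sum_congr rfl fun J hJ => ?_
      rw [Even.neg_one_pow (Finset.mem_filter.1 (Finset.mem_of_mem_erase hJ)).2]
      simp [hy, Finset.ne_of_mem_erase hJ]
    have e4 : ∑ J ∈ Od, y J = ∑ J ∈ Od, (-1) ^ J.card * X J := by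
      refine Finset.sum_congr rfl fun J hJ => ?_
      have hJ' := (Finset.mem_filter.1 hJ).2
      have : J ≠ ∅ := by rintro rfl; simp at hJ'
      rw [Odd.neg_one_pow (Nat.not_even_iff_odd.1 hJ')]
      simp [hy, this]
    rw [e3, e4]
    have : y ∅ = w := by simp [hy]
    rw [this]
    linear_combination hw'
  have hbig : (1 + q * w) * ∏ J : Finset (Fin m) with J.Nonempty,
      (1 - q * X J) ^ ((-1 : ℤ) ^ J.card) =
        (∏ J ∈ Ev, (1 + q * y J)) * (∏ J ∈ Od, (1 + q * y J))⁻¹ := by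
    rw [e1, Finset.prod_union e2, ← Finset.mul_prod_erase _ _ e0, ← mul_assoc,
      ← Finset.prod_inv_distrib]
    congr 1
    · congr 1
      refine Finset.prod_congr rfl fun J hJ => ?_
      rw [Even.neg_one_pow (Finset.mem_filter.1 (Finset.mem_of_mem_erase hJ)).2, zpow_one]
      simp [hy, Finset.ne_of_mem_erase hJ, sub_eq_add_neg]
    · refine Finset.prod_congr rfl fun J hJ => ?_
      have hJ' := (Finset.mem_filter.1 hJ).2
      have : J ≠ ∅ := by rintro rfl; simp at hJ'
      rw [Odd.neg_one_pow (Nat.not_even_iff_odd.1 hJ'), zpow_neg_one]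
      simp [hy, this, sub_eq_add_neg]
  have hden : (1 / 2 : ℝ) ^ Od.card ≤ ‖∏ J ∈ Od, (1 + q * y J)‖ := by
    rw [norm_prod, ← Finset.prod_const]
    refine Finset.prod_le_prod (fun _ _ => by norm_num) fun J hJ => ?_
    have hJ' := (Finset.mem_filter.1 hJ).2
    have : J ≠ ∅ := by rintro rfl; simp at hJ'
    have e : 1 + q * y J = 1 - q * X J := by simp [hy, this, sub_eq_add_neg]
    rw [e]
    have h := norm_sub_norm_le 1 (q * X J)
    rw [norm_one, norm_mul] at h
    nlinarith [hX1 J, norm_nonneg (X J), norm_nonneg q]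
  have hden0 : ∏ J ∈ Od, (1 + q * y J) ≠ 0 := by
    rw [← norm_pos_iff]
    exact lt_of_lt_of_le (by positivity) hden
  rw [hbig]
  have hfin : (∏ J ∈ Ev, (1 + q * y J)) * (∏ J ∈ Od, (1 + q * y J))⁻¹ - 1 =
      (∏ J ∈ Ev, (1 + q * y J) - ∏ J ∈ Od, (1 + q * y J)) * (∏ J ∈ Od, (1 + q * y J))⁻¹ := by
    rw [sub_mul, mul_inv_cancel₀ hden0]
  have hnum : ‖∏ J ∈ Ev, (1 + q * y J) - ∏ J ∈ Od, (1 + q * y J)‖ ≤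
      (C₁ + C₂) * 2 ^ m * (‖q‖ ^ 2 * δ) := by
    simp only [Finset.prod_const, Finset.sum_const, hcard] at k₁ k₂
    rw [hsum] at k₁
    have := norm_sub_le_of_le k₁ k₂
    refine (le_of_eq ?_).trans (this.trans (le_of_eq (by ring)))
    congr 1
    ring
  rw [hfin, norm_mul, norm_inv]
  have hinv : ‖∏ J ∈ Od, (1 + q * y J)‖⁻¹ ≤ 2 ^ Od.card := by
    refine (inv_anti₀ (by positivity) hden).trans (le_of_eq ?_)
    rw [one_div, inv_pow, inv_inv]
  have hqδ : 0 ≤ ‖q‖ ^ 2 * δ := by positivity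
  calc _ ≤ (C₁ + C₂) * 2 ^ m * (‖q‖ ^ 2 * δ) * 2 ^ Od.card := by gcongr
    _ ≤ _ := by linarith

/-- The Euler factor at `p` of the multiple Dirichlet series attached to `∏ μ(d j) / lcm d`. -/
noncomputable def eulerFactor {m : ℕ} (z : Fin m → ℂ) (p : ℕ) : ℂ :=
  1 + (p : ℂ)⁻¹ * (∏ j, (1 - (p : ℂ) ^ (-z j)) - 1)

/-- The Euler product of the multiple Dirichlet series `∑ ∏ μ(d j) d j ^ (-z j) / lcm d`. -/
noncomputable def eulerProd {m : ℕ} (z : Fin m → ℂ) : ℂ :=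
  ∏' p : Nat.Primes, eulerFactor z p

theorem exists_norm_eulerFactor_sub_one_le (m : ℕ) :
    ∃ C : ℝ, 0 ≤ C ∧ ∀ (z : Fin m → ℂ) (σ : ℝ) (p : ℕ), 0 ≤ σ → (∀ j, σ ≤ (z j).re) → 1 ≤ p →
      ‖eulerFactor z p - 1‖ ≤ C * (p : ℝ) ^ (-1 - σ) := by
  obtain ⟨C, hC, h⟩ := exists_prod_one_add_lipschitz (Finset.univ : Finset (Fin m)) zero_le_one
  refine ⟨C, hC, fun z σ p hσ hz hp => ?_⟩
  have hp0 : (0 : ℝ) < p := by exact_mod_cast hp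
  have hp1 : (1 : ℝ) ≤ p := by exact_mod_cast hp
  set q : ℝ := (p : ℝ) ^ (-σ) with hq
  have hq0 : 0 < q := Real.rpow_pos_of_pos hp0 _
  have hqn : ‖(q : ℂ)‖ = q := by rw [Complex.norm_real, Real.norm_of_nonneg hq0.le]
  have hx : ∀ j, ‖-((p : ℂ) ^ (-z j) / q)‖ ≤ 1 := fun j => by
    rw [norm_neg, norm_div, hqn, Complex.norm_natCast_cpow_of_pos hp, div_le_one hq0]
    exact Real.rpow_le_rpow_of_exponent_le hp1 (by simpa using hz j)
  have h1 := (h q (fun j => -((p : ℂ) ^ (-z j) / q)) (fun _ => 0) 1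
    (by rw [hqn]; exact Real.rpow_le_one_of_one_le_of_nonpos hp1 (by linarith)) hx
    (by simp) (by simpa using hx)).1
  have e : ∀ j, 1 + (q : ℂ) * -((p : ℂ) ^ (-z j) / q) = 1 - (p : ℂ) ^ (-z j) := fun j => by
    have : (q : ℂ) ≠ 0 := by exact_mod_cast hq0.ne'
    field_simp
    ring
  simp only [e, hqn] at h1
  rw [eulerFactor, add_sub_cancel_left, norm_mul, norm_inv, Complex.norm_natCast,
    sub_eq_add_neg (-1 : ℝ), Real.rpow_add hp0, Real.rpow_neg_one]
  calc (p : ℝ)⁻¹ * _ ≤ (p : ℝ)⁻¹ * (C * q) := by gcongr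
    _ = _ := by ring

theorem hasProd_eulerFactor {m : ℕ} {z : Fin m → ℂ} {σ : ℝ} (hσ : 0 < σ)
    (hz : ∀ j, σ ≤ (z j).re) :
    HasProd (fun p : Nat.Primes => eulerFactor z p) (eulerProd z) := by
  obtain ⟨C, hC, h⟩ := exists_norm_eulerFactor_sub_one_le m
  have hs : Summable fun p : Nat.Primes => ‖eulerFactor z p - 1‖ := by
    refine Summable.of_nonneg_of_le (fun _ => norm_nonneg _)
      (fun p => h z σ p hσ.le hz p.2.one_lt.le) ?_
    exact (Nat.Primes.summable_rpow.2 (by linarith)).mul_left C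
  have := multipliable_one_add_of_summable hs
  simp only [add_sub_cancel] at this
  exact this.hasProd

theorem exp_mul_sub_one_le {a t : ℝ} (ha : 0 ≤ a) (ht0 : 0 ≤ t) (ht1 : t ≤ 1) :
    Real.exp (a * t) - 1 ≤ a * Real.exp a * t := by
  have e1 : Real.exp (a * t) - 1 ≤ a * t * Real.exp (a * t) := by
    have := Real.add_one_le_exp (-(a * t))
    have e3 : Real.exp (-(a * t)) * Real.exp (a * t) = 1 := by rw [← Real.exp_add]; simp
    nlinarith [Real.exp_pos (a * t)]
  have e2 : Real.exp (a * t) ≤ Real.exp a := Real.exp_le_exp.2 (by nlinarith)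
  have e3 : a * t * Real.exp (a * t) ≤ a * t * Real.exp a := by gcongr
  linarith

theorem norm_one_sub_exp_neg_le {u : ℂ} (hu : 0 ≤ u.re) : ‖1 - Complex.exp (-u)‖ ≤ 2 * ‖u‖ := by
  rcases le_total ‖u‖ 1 with h | h
  · rw [norm_sub_rev]
    simpa using Complex.norm_exp_sub_one_le (x := -u) (by simpa using h)
  · refine (norm_sub_le _ _).trans ?_
    rw [norm_one, Complex.norm_exp]
    have : Real.exp (-u).re ≤ 1 := Real.exp_le_one_iff.2 (by simpa using hu)
    linarith

theorem norm_one_sub_natCast_cpow_le {p : ℕ} (hp : 1 ≤ p) {z : ℂ} (hz : 0 ≤ z.re) :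
    ‖1 - (p : ℂ) ^ (-z)‖ ≤ 4 * (p : ℝ) ^ (1 / 2 : ℝ) * min 1 ‖z‖ := by
  have hp0 : (0 : ℝ) < p := by exact_mod_cast hp
  have hp1 : (1 : ℝ) ≤ p := by exact_mod_cast hp
  have h1 : 1 ≤ (p : ℝ) ^ (1 / 2 : ℝ) := Real.one_le_rpow hp1 (by norm_num)
  rcases le_total 1 ‖z‖ with h | h
  · rw [min_eq_left h]
    refine (norm_sub_le _ _).trans ?_
    rw [norm_one, Complex.norm_natCast_cpow_of_pos hp]
    have : (p : ℝ) ^ (-z).re ≤ 1 :=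
      Real.rpow_le_one_of_one_le_of_nonpos hp1 (by simpa using hz)
    linarith
  · rw [min_eq_right h, Complex.cpow_def_of_ne_zero (by exact_mod_cast hp0.ne'), mul_neg,
      ← Complex.ofReal_natCast, ← Complex.ofReal_log hp0.le]
    have hl := Real.log_nonneg hp1
    refine (norm_one_sub_exp_neg_le
      (by rw [Complex.re_ofReal_mul]; exact mul_nonneg hl hz)).trans ?_
    rw [norm_mul, Complex.norm_real, Real.norm_of_nonneg hl]
    have := Real.log_le_rpow_div hp0.le (ε := 1 / 2) (by norm_num)
    rw [div_eq_mul_inv] at this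
    norm_num at this
    have := mul_le_mul_of_nonneg_right this (norm_nonneg z)
    norm_num
    linarith

theorem prod_natCast_cpow_neg {m p : ℕ} (hp : 1 ≤ p) (z : Fin m → ℂ) (J : Finset (Fin m)) :
    ∏ j ∈ J, (p : ℂ) ^ (-z j) = (p : ℂ) ^ (-subsum z J) := by
  have hp0 : (p : ℂ) ≠ 0 := by exact_mod_cast (by omega : p ≠ 0)
  simp only [Complex.cpow_def_of_ne_zero hp0, ← Complex.exp_sum, subsum, mul_neg,
    Finset.sum_neg_distrib, Finset.mul_sum]

theorem subsum_re_pos {m : ℕ} {z : Fin m → ℂ} (hz : ∀ j, 0 < (z j).re) {J : Finset (Fin m)}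
    (hJ : J.Nonempty) : 0 < (subsum z J).re := by
  rw [subsum, Complex.re_sum]
  exact Finset.sum_pos (fun j _ => hz j) hJ

/-- The Euler product is a product of zeta values, up to a factor that is bounded, and close to
one near the origin. -/
theorem exists_norm_eulerProd_mul_sub_one_le {m : ℕ} (hm : 1 ≤ m) :
    ∃ C : ℝ, 0 < C ∧ ∀ z : Fin m → ℂ, (∀ j, 0 < (z j).re) →
      ‖eulerProd z * ∏ J : Finset (Fin m) with J.Nonempty,
        riemannZeta (1 + subsum z J) ^ (-(-1 : ℤ) ^ J.card) - 1‖ ≤ C * min 1 (∑ j, ‖z j‖) := by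
  obtain ⟨C, hC, h⟩ := exists_local_factor_sub_one_le hm
  have hS : Summable fun p : Nat.Primes => (p : ℝ) ^ (-3 / 2 : ℝ) :=
    Nat.Primes.summable_rpow.2 (by norm_num)
  set S := ∑' p : Nat.Primes, (p : ℝ) ^ (-3 / 2 : ℝ) with hSdef
  have hS0 : 0 ≤ S := tsum_nonneg fun p => by positivity
  set a : ℝ := C * (m * 4) * S with ha
  have ha0 : 0 ≤ a := by positivity
  refine ⟨a * Real.exp a + 1, by positivity, fun z hz => ?_⟩
  set t := min 1 (∑ j, ‖z j‖) with ht
  have ht0 : 0 ≤ t := le_min zero_le_one (Finset.sum_nonneg fun _ _ => norm_nonneg _)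
  have ht1 : t ≤ 1 := min_le_left _ _
  set g : Nat.Primes → ℂ := fun p => eulerFactor z p * ∏ J : Finset (Fin m) with J.Nonempty,
    (1 - (p : ℂ) ^ (-(1 + subsum z J))) ^ ((-1 : ℤ) ^ J.card) with hg
  have hgp : ∀ p : Nat.Primes, ‖g p - 1‖ ≤ C * (m * 4) * t * (p : ℝ) ^ (-3 / 2 : ℝ) := by
    intro p
    have hp1 : 1 ≤ (p : ℕ) := p.2.one_lt.le
    have hp2 : (2 : ℝ) ≤ (p : ℕ) := by exact_mod_cast p.2.two_le
    have hp0 : (0 : ℝ) < (p : ℕ) := by linarith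
    have hpc : ((p : ℕ) : ℂ) ≠ 0 := by exact_mod_cast hp0.ne'
    have e := h ((p : ℕ) : ℂ)⁻¹ (fun j => ((p : ℕ) : ℂ) ^ (-z j))
      (by
        rw [norm_inv, Complex.norm_natCast, one_div]
        exact inv_anti₀ (by norm_num) hp2)
      (fun j => by
        rw [Complex.norm_natCast_cpow_of_pos hp1]
        exact Real.rpow_le_one_of_one_le_of_nonpos (by linarith) (by simpa using (hz j).le))
    have e1 : ∀ J : Finset (Fin m), ((p : ℕ) : ℂ)⁻¹ * ∏ j ∈ J, ((p : ℕ) : ℂ) ^ (-z j) =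
        ((p : ℕ) : ℂ) ^ (-(1 + subsum z J)) := fun J => by
      rw [prod_natCast_cpow_neg hp1, neg_add, Complex.cpow_add _ _ hpc, Complex.cpow_neg_one]
    simp only [e1] at e
    refine e.trans ?_
    rw [norm_inv, Complex.norm_natCast]
    have e2 : ∑ j, ‖1 - ((p : ℕ) : ℂ) ^ (-z j)‖ ≤
        ∑ _j : Fin m, 4 * ((p : ℕ) : ℝ) ^ (1 / 2 : ℝ) * t := by
      refine Finset.sum_le_sum fun j _ => ?_
      refine (norm_one_sub_natCast_cpow_le hp1 (hz j).le).trans ?_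
      have : ‖z j‖ ≤ ∑ j, ‖z j‖ :=
        Finset.single_le_sum (f := fun j => ‖z j‖) (fun _ _ => norm_nonneg _) (Finset.mem_univ j)
      gcongr
      exact min_le_min le_rfl this
    rw [Finset.sum_const, Finset.card_univ, Fintype.card_fin, nsmul_eq_mul] at e2
    have e3 : ((p : ℕ) : ℝ) ^ (-3 / 2 : ℝ) =
        (((p : ℕ) : ℝ)⁻¹) ^ 2 * ((p : ℕ) : ℝ) ^ (1 / 2 : ℝ) := by
      rw [← Real.rpow_neg_one, ← Real.rpow_mul_natCast hp0.le, ← Real.rpow_add hp0]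
      norm_num
    rw [e3]
    calc _ ≤ C * ((((p : ℕ) : ℝ)⁻¹) ^ 2 * (m * (4 * ((p : ℕ) : ℝ) ^ (1 / 2 : ℝ) * t))) := by
          gcongr
      _ = _ := by ring
  have hbound : ∀ s : Finset Nat.Primes, ‖∏ p ∈ s, g p - 1‖ ≤ (a * Real.exp a + 1) * t := by
    intro s
    have e := Finset.norm_prod_one_add_sub_one_le s fun p => g p - 1
    simp only [add_sub_cancel] at e
    have e1 : ∑ p ∈ s, ‖g p - 1‖ ≤ a * t := by
      refine (Finset.sum_le_sum fun p _ => hgp p).trans ?_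
      rw [← Finset.mul_sum]
      have := hS.sum_le_tsum s fun p _ => by positivity
      calc _ ≤ C * (m * 4) * t * S := by gcongr
        _ = _ := by ring
    have e2 := exp_mul_sub_one_le ha0 ht0 ht1
    have e5 := Real.exp_le_exp.2 e1
    nlinarith
  have hlim : Filter.Tendsto (fun s : Finset Nat.Primes => ∏ p ∈ s, g p) Filter.atTop
      (nhds (eulerProd z * ∏ J : Finset (Fin m) with J.Nonempty,
        riemannZeta (1 + subsum z J) ^ (-(-1 : ℤ) ^ J.card))) := by
    have hmul : ∀ s : Finset Nat.Primes, ∏ p ∈ s, g p = (∏ p ∈ s, eulerFactor z p) *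
        ∏ J : Finset (Fin m) with J.Nonempty,
          (∏ p ∈ s, (1 - (p : ℂ) ^ (-(1 + subsum z J)))⁻¹) ^ (-(-1 : ℤ) ^ J.card) := fun s => by
      rw [hg, Finset.prod_mul_distrib, Finset.prod_comm]
      congr 1
      refine Finset.prod_congr rfl fun J _ => ?_
      rw [Finset.prod_inv_distrib, inv_zpow', neg_neg, Finset.prod_zpow]
    simp only [hmul]
    refine Filter.Tendsto.mul ?_ (tendsto_finsetProd _ fun J hJ => ?_)
    · have hσ : ∃ σ : ℝ, 0 < σ ∧ ∀ j, σ ≤ (z j).re := by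
        have hne : (Finset.univ : Finset (Fin m)).Nonempty := ⟨⟨0, hm⟩, Finset.mem_univ _⟩
        obtain ⟨i, _, hi⟩ := Finset.exists_min_image Finset.univ (fun j => (z j).re) hne
        exact ⟨(z i).re, hz i, fun j => hi j (Finset.mem_univ j)⟩
      obtain ⟨σ, hσ, hzσ⟩ := hσ
      exact hasProd_eulerFactor hσ hzσ
    · have hre := subsum_re_pos hz (Finset.mem_filter.1 hJ).2
      have h1 : 1 < (1 + subsum z J).re := by simpa using hre
      exact Filter.Tendsto.zpow₀ (riemannZeta_eulerProduct_hasProd h1) _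
        (Or.inl (riemannZeta_ne_zero_of_one_le_re h1.le))
  exact le_of_tendsto ((hlim.sub_const 1).norm) (Filter.Eventually.of_forall hbound)

/-- The limit of `L * eulerProd (σ / L)` as `L → ∞`. -/
noncomputable def eulerLim {m : ℕ} (σ : Fin m → ℂ) : ℂ :=
  ∏ J : Finset (Fin m) with J.Nonempty, subsum σ J ^ (-(-1 : ℤ) ^ J.card)

theorem sum_nonempty_neg_one_pow_card {m : ℕ} (hm : 1 ≤ m) :
    ∑ J : Finset (Fin m) with J.Nonempty, (-1 : ℤ) ^ J.card = -1 := by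
  have hne : (Finset.univ : Finset (Fin m)).Nonempty := ⟨⟨0, hm⟩, Finset.mem_univ _⟩
  have h := Finset.sum_powerset_neg_one_pow_card_of_nonempty hne
  rw [Finset.powerset_univ, ← Finset.sum_filter_add_sum_filter_not _
    (fun J : Finset (Fin m) => J.Nonempty)] at h
  have : (Finset.univ.filter fun J : Finset (Fin m) => ¬ J.Nonempty) = {∅} := by
    ext J; simp [Finset.not_nonempty_iff_eq_empty]
  rw [this] at h
  simp only [Finset.sum_singleton, Finset.card_empty, pow_zero] at h
  linarith

theorem subsum_div {m : ℕ} (σ : Fin m → ℂ) (c : ℂ) (J : Finset (Fin m)) :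
    subsum (fun j => σ j / c) J = subsum σ J / c := by
  simp [subsum, Finset.sum_div]

theorem norm_subsum_le {m : ℕ} (σ : Fin m → ℂ) (J : Finset (Fin m)) :
    ‖subsum σ J‖ ≤ ∑ j, ‖σ j‖ :=
  (norm_sum_le _ _).trans
    (Finset.sum_le_sum_of_subset_of_nonneg (Finset.subset_univ J) fun _ _ _ => norm_nonneg _)

theorem abs_neg_one_pow_mul (n : ℕ) (x : ℝ) : |(-1) ^ n * x| = |x| := by
  rw [abs_mul, abs_pow, abs_neg, abs_one, one_pow, one_mul]

theorem exists_mul_norm_eulerProd_le {m : ℕ} (hm : 1 ≤ m) {η : ℝ} (hη : 0 < η) (hη1 : η ≤ 1) :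
    ∃ C : ℝ, 0 < C ∧ ∀ (σ : Fin m → ℂ) (L : ℝ), (∀ j, (σ j).re = 1) → 1 ≤ L →
      L * ‖eulerProd fun j => σ j / L‖ ≤
        C * (Real.exp (logKer σ (Real.log L)) * (1 + (∑ j, ‖σ j‖) / L) ^ η) := by
  obtain ⟨C₀, hC₀, h₀⟩ := exists_norm_eulerProd_mul_sub_one_le hm
  set N : ℝ := ((Finset.univ.filter fun J : Finset (Fin m) => J.Nonempty).card : ℝ) with hN
  have hN0 : 0 ≤ N := Nat.cast_nonneg _
  obtain ⟨C₁, hC₁, h₁⟩ := abs_log_norm_zeta_add_le (B := m) (Nat.cast_nonneg m)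
    (η := η / (N + 1)) (by positivity) (by
      rw [div_le_one (by positivity)]; linarith)
  refine ⟨(1 + C₀) * Real.exp (N * C₁), by positivity, fun σ L hσ hL => ?_⟩
  have hL0 : 0 < L := by linarith
  have hLc : (L : ℂ) ≠ 0 := by exact_mod_cast hL0.ne'
  set M := ∑ j, ‖σ j‖ with hM
  have hM0 : 0 ≤ M := Finset.sum_nonneg fun _ _ => norm_nonneg _
  set z : Fin m → ℂ := fun j => σ j / L with hz
  have hzre : ∀ j, 0 < (z j).re := fun j => by
    simp only [hz, Complex.div_ofReal_re, hσ]
    positivity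
  have hzJ : ∀ J, subsum z J = subsum σ J / L := fun J => subsum_div σ L J
  set W := ∏ J : Finset (Fin m) with J.Nonempty,
    riemannZeta (1 + subsum z J) ^ (-(-1 : ℤ) ^ J.card) with hW
  have hζ : ∀ J : Finset (Fin m), J.Nonempty → riemannZeta (1 + subsum z J) ≠ 0 := fun J hJ =>
    riemannZeta_ne_zero_of_one_le_re (by simpa using (subsum_re_pos hzre hJ).le)
  have hlogW : -Real.log ‖W‖ ≤ logKer σ (Real.log L) - Real.log L + N * C₁ +
      η * Real.log (1 + M / L) := by
    have hlog0 : 0 ≤ Real.log (1 + M / L) := Real.log_nonneg (by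
      have : 0 ≤ M / L := by positivity
      linarith)
    have e1 : -Real.log ‖W‖ = ∑ J : Finset (Fin m) with J.Nonempty,
        (-1) ^ J.card * Real.log ‖riemannZeta (1 + subsum z J)‖ := by
      rw [hW, norm_prod, Real.log_prod (fun J hJ => by
          rw [norm_ne_zero_iff]
          exact zpow_ne_zero _ (hζ J (Finset.mem_filter.1 hJ).2)), ← Finset.sum_neg_distrib]
      refine Finset.sum_congr rfl fun J _ => ?_
      rw [norm_zpow, Real.log_zpow]
      push_cast
      ring
    have e2 : logKer σ (Real.log L) - Real.log L =
        ∑ J : Finset (Fin m) with J.Nonempty,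
          (-1) ^ J.card * (-min (Real.log ‖subsum z J‖) 0) := by
      have e3 : Real.log L = -∑ J : Finset (Fin m) with J.Nonempty,
          (-1 : ℝ) ^ J.card * Real.log L := by
        have := congrArg (Int.cast : ℤ → ℝ) (sum_nonempty_neg_one_pow_card hm)
        push_cast at this
        rw [← Finset.sum_mul, this]
        ring
      nth_rewrite 2 [e3]
      rw [logKer, sub_neg_eq_add, ← Finset.sum_add_distrib]
      refine Finset.sum_congr rfl fun J hJ => ?_
      have hne : ‖subsum σ J‖ ≠ 0 := by
        have := one_le_norm_subsum hσ (Finset.mem_filter.1 hJ).2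
        linarith
      rw [hzJ, norm_div, Complex.norm_real, Real.norm_of_nonneg hL0.le,
        Real.log_div hne hL0.ne', ← sub_self (Real.log L), min_sub_sub_right]
      ring
    have e4 : -Real.log ‖W‖ - (logKer σ (Real.log L) - Real.log L) ≤
        ∑ J : Finset (Fin m) with J.Nonempty, (C₁ + η / (N + 1) * Real.log (1 + M / L)) := by
      rw [e1, e2, ← Finset.sum_sub_distrib]
      refine Finset.sum_le_sum fun J hJ => ?_
      have hJ' := (Finset.mem_filter.1 hJ).2
      have hre : (subsum z J).re ≤ m := by
        rw [hzJ, Complex.div_ofReal_re, subsum_re hσ]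
        have : (J.card : ℝ) ≤ m := by
          exact_mod_cast (Finset.card_le_univ J).trans (by simp)
        rw [div_le_iff₀ hL0]
        nlinarith [(Nat.cast_nonneg m : (0:ℝ) ≤ m)]
      have h := h₁ (subsum z J) (subsum_re_pos hzre hJ') hre
      rw [← mul_sub, sub_neg_eq_add]
      refine (le_abs_self _).trans ?_
      rw [abs_neg_one_pow_mul]
      refine h.trans ?_
      have hle : ‖subsum z J‖ ≤ M / L := by
        rw [hzJ, norm_div, Complex.norm_real, Real.norm_of_nonneg hL0.le]
        have := norm_subsum_le σ J
        gcongr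
      gcongr
    rw [Finset.sum_const, nsmul_eq_mul, ← hN] at e4
    have e5 : N * (η / (N + 1)) ≤ η := by
      rw [mul_div_assoc', div_le_iff₀ (by positivity)]
      nlinarith
    nlinarith
  have hW0 : 0 < ‖W‖ := by
    rw [norm_pos_iff, hW]
    exact Finset.prod_ne_zero_iff.2 fun J hJ => zpow_ne_zero _ (hζ J (Finset.mem_filter.1 hJ).2)
  have hP := h₀ z hzre
  have hP1 : ‖eulerProd z‖ * ‖W‖ ≤ 1 + C₀ := by
    rw [← norm_mul]
    have e1 := norm_sub_norm_le (eulerProd z * W) 1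
    have e2 : C₀ * min 1 (∑ j, ‖z j‖) ≤ C₀ * 1 := by gcongr; exact min_le_left _ _
    rw [norm_one] at e1
    linarith
  have hinv : ‖W‖⁻¹ ≤ Real.exp (N * C₁) * (Real.exp (logKer σ (Real.log L)) *
      (1 + M / L) ^ η) / L := by
    have hpos : 0 < 1 + M / L := by positivity
    have e : ‖W‖⁻¹ * L = Real.exp (-Real.log ‖W‖ + Real.log L) := by
      rw [Real.exp_add, Real.exp_neg, Real.exp_log hW0, Real.exp_log hL0]
    rw [le_div_iff₀ hL0, e, Real.rpow_def_of_pos hpos, ← Real.exp_add, ← Real.exp_add]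
    refine Real.exp_le_exp.2 ?_
    linarith
  have hPle : ‖eulerProd z‖ ≤ (1 + C₀) * ‖W‖⁻¹ := by
    rw [← div_eq_mul_inv, le_div_iff₀ hW0]
    exact hP1
  calc L * ‖eulerProd z‖ ≤ L * ((1 + C₀) * (Real.exp (N * C₁) *
        (Real.exp (logKer σ (Real.log L)) * (1 + M / L) ^ η) / L)) := by
        gcongr
        exact hPle.trans (by gcongr)
    _ = _ := by field_simp

theorem exists_norm_zpow_mul_zeta_sub_one_le :
    ∃ C : ℝ, 0 < C ∧ ∀ z : ℂ, 0 < z.re → ‖z‖ ≤ 1 → ∀ n : ℕ,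
      ‖(z * riemannZeta (1 + z)) ^ ((-1 : ℤ) ^ n) - 1‖ ≤ C * ‖z‖ := by
  obtain ⟨C, hC, h⟩ := norm_zeta_sub_le one_pos le_rfl
  obtain ⟨c, hc, hge⟩ := exists_le_norm_mul_zeta (B := 1) (T := 1) zero_le_one zero_le_one
  refine ⟨2 * C + 2 * C / c, by positivity, fun z hz hz1 n => ?_⟩
  have hz0 : z ≠ 0 := by rintro rfl; simp at hz
  have e1 : ‖z * riemannZeta (1 + z) - 1‖ ≤ 2 * C * ‖z‖ := by
    have e2 : z * riemannZeta (1 + z) - 1 = z * (riemannZeta (1 + z) - 1 / (1 + z - 1)) := by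
      rw [add_sub_cancel_left]
      field_simp
    have e3 := h (1 + z) (by simpa using hz)
    rw [Real.rpow_one] at e3
    have e4 : ‖1 + z‖ ≤ 2 := (norm_add_le _ _).trans (by rw [norm_one]; linarith)
    rw [e2, norm_mul]
    have : C * ‖1 + z‖ ≤ C * 2 := by gcongr
    nlinarith [norm_nonneg z]
  have hcz : 0 ≤ 2 * C / c * ‖z‖ := by positivity
  rcases neg_one_pow_eq_or ℤ n with hn | hn
  · rw [hn, zpow_one]
    linarith
  · have hu := hge z hz ((Complex.re_le_norm z).trans hz1) ((Complex.abs_im_le_norm z).trans hz1)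
    rw [← norm_mul] at hu
    have hu0 : z * riemannZeta (1 + z) ≠ 0 := norm_pos_iff.1 (hc.trans_le hu)
    have e5 : (z * riemannZeta (1 + z))⁻¹ - 1 =
        -(z * riemannZeta (1 + z) - 1) / (z * riemannZeta (1 + z)) := by
      rw [eq_div_iff hu0, sub_mul, inv_mul_cancel₀ hu0]
      ring
    rw [hn, zpow_neg_one, e5, norm_div, norm_neg]
    calc _ ≤ 2 * C * ‖z‖ / c := by gcongr
      _ ≤ _ := by
        have : 0 ≤ 2 * C * ‖z‖ := by positivity
        have e6 : 2 * C * ‖z‖ / c = 2 * C / c * ‖z‖ := by ring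
        rw [e6]
        linarith

theorem eulerLim_ne_zero {m : ℕ} {σ : Fin m → ℂ} (hσ : ∀ j, (σ j).re = 1) : eulerLim σ ≠ 0 :=
  Finset.prod_ne_zero_iff.2 fun _ hJ => zpow_ne_zero _ (norm_pos_iff.1
    (zero_lt_one.trans_le (one_le_norm_subsum hσ (Finset.mem_filter.1 hJ).2)))

theorem norm_eulerLim {m : ℕ} {σ : Fin m → ℂ} (hσ : ∀ j, (σ j).re = 1) {ℓ : ℝ}
    (hℓ : Real.log (∑ j, ‖σ j‖) ≤ ℓ) : ‖eulerLim σ‖ = Real.exp (logKer σ ℓ) := by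
  rw [← Real.exp_log (norm_pos_iff.2 (eulerLim_ne_zero hσ))]
  congr 1
  have hJ1 : ∀ J ∈ Finset.univ.filter fun J : Finset (Fin m) => J.Nonempty, 1 ≤ ‖subsum σ J‖ :=
    fun J hJ => one_le_norm_subsum hσ (Finset.mem_filter.1 hJ).2
  rw [eulerLim, norm_prod, Real.log_prod (fun J hJ => by
    rw [norm_ne_zero_iff]
    exact zpow_ne_zero _ (norm_pos_iff.1 (zero_lt_one.trans_le (hJ1 J hJ)))), logKer]
  refine Finset.sum_congr rfl fun J hJ => ?_
  have h1 := hJ1 J hJ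
  rw [norm_zpow, Real.log_zpow, min_eq_left]
  · push_cast
    ring
  · exact (Real.log_le_log (by linarith) (norm_subsum_le σ J)).trans hℓ

theorem prod_zpow_eq_zpow_sum {ι K : Type*} [DecidableEq ι] [Field K] {a : K} (ha : a ≠ 0)
    (s : Finset ι) (g : ι → ℤ) : ∏ i ∈ s, a ^ g i = a ^ ∑ i ∈ s, g i := by
  induction s using Finset.induction_on with
  | empty => simp
  | insert i s hi ih => rw [Finset.prod_insert hi, Finset.sum_insert hi, zpow_add₀ ha, ih]

theorem exists_norm_eulerProd_sub_le {m : ℕ} (hm : 1 ≤ m) :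
    ∃ C : ℝ, 0 < C ∧ ∀ (σ : Fin m → ℂ) (L : ℝ), (∀ j, (σ j).re = 1) → 1 ≤ L →
      ∑ j, ‖σ j‖ ≤ L →
      ‖L * (eulerProd fun j => σ j / L) - eulerLim σ‖ ≤
        C * (‖eulerLim σ‖ * ((∑ j, ‖σ j‖) / L)) := by
  obtain ⟨C₀, hC₀, h₀⟩ := exists_norm_eulerProd_mul_sub_one_le hm
  obtain ⟨C₁, hC₁, h₁⟩ := exists_norm_zpow_mul_zeta_sub_one_le
  set N : ℝ := ((Finset.univ.filter fun J : Finset (Fin m) => J.Nonempty).card : ℝ) with hN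
  have hN0 : 0 ≤ N := Nat.cast_nonneg _
  set a : ℝ := N * C₁ with ha
  have ha0 : 0 ≤ a := by positivity
  refine ⟨C₀ + a * Real.exp a + C₀ * (a * Real.exp a), by positivity,
    fun σ L hσ hL hML => ?_⟩
  have hL0 : 0 < L := by linarith
  have hLc : (L : ℂ) ≠ 0 := by exact_mod_cast hL0.ne'
  set M := ∑ j, ‖σ j‖ with hM
  have hM0 : 0 ≤ M := Finset.sum_nonneg fun _ _ => norm_nonneg _
  set t := M / L with ht
  have ht0 : 0 ≤ t := by positivity
  have ht1 : t ≤ 1 := (div_le_one hL0).2 hML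
  set z : Fin m → ℂ := fun j => σ j / L with hz
  have hzre : ∀ j, 0 < (z j).re := fun j => by
    simp only [hz, Complex.div_ofReal_re, hσ]
    positivity
  have hzJ : ∀ J, subsum z J = subsum σ J / L := fun J => subsum_div σ L J
  have hzt : ∀ J, ‖subsum z J‖ ≤ t := fun J => by
    rw [hzJ, norm_div, Complex.norm_real, Real.norm_of_nonneg hL0.le]
    exact div_le_div_of_nonneg_right (norm_subsum_le σ J) hL0.le
  set W := ∏ J : Finset (Fin m) with J.Nonempty,
    riemannZeta (1 + subsum z J) ^ (-(-1 : ℤ) ^ J.card) with hW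
  set U := ∏ J : Finset (Fin m) with J.Nonempty,
    (subsum z J * riemannZeta (1 + subsum z J)) ^ ((-1 : ℤ) ^ J.card) with hU
  have hW0 : W ≠ 0 := Finset.prod_ne_zero_iff.2 fun J hJ => zpow_ne_zero _
    (riemannZeta_ne_zero_of_one_le_re
      (by simpa using (subsum_re_pos hzre (Finset.mem_filter.1 hJ).2).le))
  have hUW : U * W * eulerLim σ = L := by
    have e1 : U * W * eulerLim σ =
        ∏ J : Finset (Fin m) with J.Nonempty, (L : ℂ) ^ (-(-1 : ℤ) ^ J.card) := by
      rw [hU, hW, eulerLim, ← Finset.prod_mul_distrib, ← Finset.prod_mul_distrib]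
      refine Finset.prod_congr rfl fun J hJ => ?_
      have hJ' := (Finset.mem_filter.1 hJ).2
      have hζ : riemannZeta (1 + subsum z J) ≠ 0 := riemannZeta_ne_zero_of_one_le_re
        (by simpa using (subsum_re_pos hzre hJ').le)
      have hσJ : subsum σ J ≠ 0 :=
        norm_pos_iff.1 (zero_lt_one.trans_le (one_le_norm_subsum hσ hJ'))
      rw [mul_zpow, mul_assoc (subsum z J ^ _), ← zpow_add₀ hζ, add_neg_cancel, zpow_zero,
        mul_one, hzJ, div_zpow, zpow_neg, zpow_neg]
      have := zpow_ne_zero ((-1 : ℤ) ^ J.card) hσJ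
      field_simp
    have e2 : ∑ J : Finset (Fin m) with J.Nonempty, (-(-1 : ℤ) ^ J.card) = 1 := by
      rw [Finset.sum_neg_distrib, sum_nonempty_neg_one_pow_card hm, neg_neg]
    rw [e1, prod_zpow_eq_zpow_sum hLc, e2, zpow_one]
  have hUn : ‖U - 1‖ ≤ a * Real.exp a * t := by
    have e1 := Finset.norm_prod_one_add_sub_one_le
      (Finset.univ.filter fun J : Finset (Fin m) => J.Nonempty) fun J =>
        (subsum z J * riemannZeta (1 + subsum z J)) ^ ((-1 : ℤ) ^ J.card) - 1
    simp only [add_sub_cancel] at e1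
    refine e1.trans (le_trans ?_ (exp_mul_sub_one_le ha0 ht0 ht1))
    refine sub_le_sub_right (Real.exp_le_exp.2 ?_) _
    refine (Finset.sum_le_sum (g := fun _ => C₁ * t) fun J hJ => ?_).trans ?_
    · refine (h₁ _ (subsum_re_pos hzre (Finset.mem_filter.1 hJ).2)
        ((hzt J).trans ht1) J.card).trans ?_
      have := hzt J
      gcongr
    · rw [Finset.sum_const, nsmul_eq_mul, ← hN, ha, mul_assoc]
  have hPn : ‖eulerProd z * W - 1‖ ≤ C₀ * t := by
    refine (h₀ z hzre).trans ?_
    refine mul_le_mul_of_nonneg_left ((min_le_right _ _).trans (le_of_eq ?_)) hC₀.le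
    simp only [hz, norm_div, Complex.norm_real, Real.norm_of_nonneg hL0.le]
    rw [← Finset.sum_div]
  have hmain : L * eulerProd z - eulerLim σ =
      eulerLim σ * ((eulerProd z * W - 1) + (U - 1) + (eulerProd z * W - 1) * (U - 1)) := by
    linear_combination (-eulerProd z) * hUW
  rw [hmain, norm_mul]
  have e1 : ‖(eulerProd z * W - 1) + (U - 1) + (eulerProd z * W - 1) * (U - 1)‖ ≤
      (C₀ + a * Real.exp a + C₀ * (a * Real.exp a)) * t := by
    refine norm_add₃_le.trans ?_
    rw [norm_mul]
    have e2 : ‖eulerProd z * W - 1‖ * ‖U - 1‖ ≤ (C₀ * t) * (a * Real.exp a * 1) := by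
      have : a * Real.exp a * t ≤ a * Real.exp a * 1 := by gcongr
      exact mul_le_mul hPn (hUn.trans this) (norm_nonneg _) (by positivity)
    linarith
  calc _ ≤ ‖eulerLim σ‖ * ((C₀ + a * Real.exp a + C₀ * (a * Real.exp a)) * t) := by gcongr
    _ = _ := by ring

/-- The Euler product against its limit, in terms of the kernel. -/
theorem exists_norm_eulerProd_sub_eulerLim_le {m : ℕ} (hm : 1 ≤ m) {δ : ℝ} (hδ : 0 < δ)
    (hδ1 : δ < 1) :
    ∃ C : ℝ, 0 < C ∧ ∀ (σ : Fin m → ℂ) (L : ℝ), (∀ j, (σ j).re = 1) → 1 ≤ L →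
      ‖L * (eulerProd fun j => σ j / L) - eulerLim σ‖ ≤
        C * L ^ (-(1 - δ)) * ((Real.exp (logKer σ (Real.log L)) +
          Real.exp (logKer σ (Real.log (∑ j, ‖σ j‖)))) * (∑ j, ‖σ j‖) ^ (1 - δ)) := by
  obtain ⟨C₁, hC₁, h₁⟩ := exists_mul_norm_eulerProd_le hm (η := 1 - δ) (by linarith) (by linarith)
  obtain ⟨C₂, hC₂, h₂⟩ := exists_norm_eulerProd_sub_le hm
  refine ⟨2 * C₁ + C₂ + 1, by positivity, fun σ L hσ hL => ?_⟩
  have hL0 : 0 < L := by linarith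
  have h₁ := h₁ σ L hσ hL
  have h₂ := h₂ σ L hσ hL
  rw [← norm_eulerLim hσ le_rfl]
  set M := ∑ j, ‖σ j‖ with hM
  have hM0 : 0 ≤ M := Finset.sum_nonneg fun _ _ => norm_nonneg _
  set E := Real.exp (logKer σ (Real.log L)) with hE
  have hE0 : 0 < E := Real.exp_pos _
  set Q := ‖eulerLim σ‖ with hQ
  have hQ0 : 0 ≤ Q := norm_nonneg _
  have e1 : L ^ (-(1 - δ)) * M ^ (1 - δ) = (M / L) ^ (1 - δ) := by
    rw [Real.div_rpow hM0 hL0.le, Real.rpow_neg hL0.le, div_eq_inv_mul]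
  have e2 : ∀ K : ℝ, K * L ^ (-(1 - δ)) * ((E + Q) * M ^ (1 - δ)) =
      K * (E + Q) * (M / L) ^ (1 - δ) := fun K => by rw [← e1]; ring
  rw [e2]
  rcases le_total M L with h | h
  · have ht0 : 0 ≤ M / L := by positivity
    have ht1 : M / L ≤ 1 := (div_le_one hL0).2 h
    have e3 : M / L ≤ (M / L) ^ (1 - δ) := by
      rcases ht0.eq_or_lt with h0 | h0
      · rw [← h0, Real.zero_rpow (by linarith)]
      · have := Real.rpow_le_rpow_of_exponent_ge h0 ht1 (show 1 - δ ≤ 1 by linarith)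
        rwa [Real.rpow_one] at this
    refine (h₂ h).trans ?_
    calc C₂ * (Q * (M / L)) ≤ (2 * C₁ + C₂ + 1) * ((E + Q) * (M / L) ^ (1 - δ)) := by
          gcongr <;> linarith
      _ = _ := by ring
  · have ht1 : 1 ≤ M / L := (one_le_div hL0).2 h
    have e3 : 1 ≤ (M / L) ^ (1 - δ) := Real.one_le_rpow ht1 (by linarith)
    have e4 : (1 + M / L) ^ (1 - δ) ≤ 2 * (M / L) ^ (1 - δ) := by
      calc (1 + M / L) ^ (1 - δ) ≤ (2 * (M / L)) ^ (1 - δ) := by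
            gcongr
            linarith
        _ = 2 ^ (1 - δ) * (M / L) ^ (1 - δ) := Real.mul_rpow (by norm_num) (by positivity)
        _ ≤ 2 ^ (1 : ℝ) * (M / L) ^ (1 - δ) := by
            gcongr
            · norm_num
            · linarith
        _ = _ := by rw [Real.rpow_one]
    refine (norm_sub_le _ _).trans ?_
    rw [norm_mul, Complex.norm_real, Real.norm_of_nonneg hL0.le]
    have e5 : C₁ * (E * (1 + M / L) ^ (1 - δ)) ≤ C₁ * (E * (2 * (M / L) ^ (1 - δ))) := by gcongr
    have e6 : Q * 1 ≤ Q * (M / L) ^ (1 - δ) := by gcongr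
    have p1 : 0 ≤ C₁ * (Q * (M / L) ^ (1 - δ)) := by positivity
    have p2 : 0 ≤ C₂ * ((E + Q) * (M / L) ^ (1 - δ)) := by positivity
    have p3 : 0 ≤ E * (M / L) ^ (1 - δ) := by positivity
    linarith

theorem squarefree_prod_primes {P : Finset ℕ} (hP : ∀ p ∈ P, p.Prime) :
    Squarefree (∏ p ∈ P, p) :=
  Finset.squarefree_prod_of_pairwise_isCoprime (fun p hp q hq hpq =>
    Nat.coprime_iff_isRelPrime.1 ((Nat.coprime_primes (hP p hp) (hP q hq)).2 hpq))
    fun p hp => (hP p hp).prime.squarefree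

/-- The probability that a random set of primes in `P`, each `p` being selected independently with
probability `1 / p`, equals `B`. -/
noncomputable def sieveWeight (P B : Finset ℕ) : ℝ :=
  (∏ p ∈ B, (p : ℝ)⁻¹) * ∏ p ∈ P \ B, (1 - (p : ℝ)⁻¹)

theorem sieveWeight_nonneg {P B : Finset ℕ} : 0 ≤ sieveWeight P B :=
  mul_nonneg (Finset.prod_nonneg fun p _ => inv_nonneg.2 p.cast_nonneg)
    (Finset.prod_nonneg fun p _ => sub_nonneg.2 (Nat.cast_inv_le_one p))

theorem sum_sieveWeight_dvd {P : Finset ℕ} (hP : ∀ p ∈ P, p.Prime) {D : ℕ} (hD : Squarefree D)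
    (hDP : D.primeFactors ⊆ P) :
    ∑ B ∈ P.powerset, sieveWeight P B * (if D ∣ ∏ p ∈ B, p then 1 else 0) = (D : ℝ)⁻¹ := by
  have h1 : ∀ B ∈ P.powerset, sieveWeight P B * (if D ∣ ∏ p ∈ B, p then 1 else 0) =
      (∏ p ∈ B, (p : ℝ)⁻¹) *
        ∏ p ∈ P \ B, (1 - (p : ℝ)⁻¹) * (if p ∉ D.primeFactors then 1 else 0) := by
    intro B hB
    have hB' := Finset.mem_powerset.1 hB
    have hBp : ∀ p ∈ B, p.Prime := fun p hp => hP p (hB' hp)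
    have hB0 : ∏ p ∈ B, p ≠ 0 := Finset.prod_ne_zero_iff.2 fun p hp => (hBp p hp).ne_zero
    have hiff : D ∣ ∏ p ∈ B, p ↔ ∀ p ∈ P \ B, p ∉ D.primeFactors := by
      rw [← Nat.prod_primeFactors_of_squarefree hD, Nat.prod_primeFactors_dvd_iff hB0,
        Nat.prod_primeFactors_of_squarefree hD, Nat.primeFactors_prod hBp]
      constructor
      · exact fun h p hp hpD => (Finset.mem_sdiff.1 hp).2 (h hpD)
      · intro h p hpD
        by_contra hpB
        exact h p (Finset.mem_sdiff.2 ⟨hDP hpD, hpB⟩) hpD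
    rw [Finset.prod_mul_distrib, Finset.prod_boole, sieveWeight, ← mul_assoc]
    simp only [hiff]
  rw [Finset.sum_congr rfl h1, ← Finset.prod_add]
  have h2 : ∀ p ∈ P, (p : ℝ)⁻¹ + (1 - (p : ℝ)⁻¹) * (if p ∉ D.primeFactors then 1 else 0) =
      if p ∈ D.primeFactors then (p : ℝ)⁻¹ else 1 := by
    intro p _
    split_ifs <;> ring
  rw [Finset.prod_congr rfl h2, Finset.prod_ite_mem, Finset.inter_eq_right.2 hDP,
    Finset.prod_inv_distrib, ← Nat.cast_prod, Nat.prod_primeFactors_of_squarefree hD]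

theorem mf_eq_sum_Icc {f : ℝ → ℝ} (hsupp : ∀ t : ℝ, 1 < t → f t = 0) {R : ℝ} (hR : 1 < R)
    {n : ℕ} (hn : n ≠ 0) :
    Mf f n R = ∑ d ∈ Finset.Icc 1 ⌊R⌋₊,
      ((ArithmeticFunction.moebius d : ℤ) : ℝ) * f (Real.log d / Real.log R) *
        (if d ∣ n then 1 else 0) := by
  have hL : 0 < Real.log R := Real.log_pos hR
  simp only [mul_ite, mul_one, mul_zero]
  rw [← Finset.sum_filter, Mf]
  symm
  refine Finset.sum_subset (fun d hd => ?_) fun d hd hd' => ?_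
  · exact Nat.mem_divisors.2 ⟨(Finset.mem_filter.1 hd).2, hn⟩
  · have hdn := Nat.dvd_of_mem_divisors hd
    have hd0 : 1 ≤ d := Nat.pos_of_mem_divisors hd
    have hdR : R < d := by
      by_contra! h
      exact hd' (Finset.mem_filter.2 ⟨Finset.mem_Icc.2 ⟨hd0, Nat.le_floor h⟩, hdn⟩)
    rw [hsupp _ ((one_lt_div hL).2 (Real.log_lt_log (by linarith) hdR)), mul_zero]

/-- The coefficient of the indicator of `∀ j, d j ∣ n` in the `m`-th power of `Mf f n R`. -/
noncomputable def tupleCoeff (f : ℝ → ℝ) (R : ℝ) {m : ℕ} (d : Fin m → ℕ) : ℝ :=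
  ∏ j, ((ArithmeticFunction.moebius (d j) : ℤ) : ℝ) * f (Real.log (d j) / Real.log R)

theorem mf_pow_eq {f : ℝ → ℝ} (hsupp : ∀ t : ℝ, 1 < t → f t = 0) {R : ℝ} (hR : 1 < R)
    {n : ℕ} (hn : n ≠ 0) (m : ℕ) :
    Mf f n R ^ m = ∑ d ∈ Fintype.piFinset fun _ : Fin m => Finset.Icc 1 ⌊R⌋₊,
      tupleCoeff f R d * (if Finset.univ.lcm d ∣ n then 1 else 0) := by
  have h1 : Mf f n R ^ m = ∏ _j : Fin m, Mf f n R := by simp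
  rw [h1, mf_eq_sum_Icc hsupp hR hn, Finset.prod_univ_sum]
  refine Finset.sum_congr rfl fun d _ => ?_
  rw [Finset.prod_mul_distrib, Finset.prod_boole, tupleCoeff]
  simp only [Finset.lcm_dvd_iff]
  congr

/-- The expected main term of the `m`-th moment. -/
noncomputable def mainSum (f : ℝ → ℝ) (R : ℝ) (m : ℕ) : ℝ :=
  ∑ d ∈ Fintype.piFinset fun _ : Fin m => Finset.Icc 1 ⌊R⌋₊,
    tupleCoeff f R d * ((Finset.univ.lcm d : ℕ) : ℝ)⁻¹

theorem mainSum_eq {f : ℝ → ℝ} (hsupp : ∀ t : ℝ, 1 < t → f t = 0) {R : ℝ} (hR : 1 < R)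
    {P : Finset ℕ} (hP : ∀ p ∈ P, p.Prime) (hRP : ∀ p : ℕ, p.Prime → (p : ℝ) ≤ R → p ∈ P)
    (m : ℕ) :
    mainSum f R m = ∑ B ∈ P.powerset, sieveWeight P B * Mf f (∏ p ∈ B, p) R ^ m := by
  have h1 : ∀ B ∈ P.powerset, sieveWeight P B * Mf f (∏ p ∈ B, p) R ^ m =
      ∑ d ∈ Fintype.piFinset fun _ : Fin m => Finset.Icc 1 ⌊R⌋₊, tupleCoeff f R d *
        (sieveWeight P B * (if Finset.univ.lcm d ∣ ∏ p ∈ B, p then 1 else 0)) := by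
    intro B hB
    have hB' := Finset.mem_powerset.1 hB
    rw [mf_pow_eq hsupp hR (Finset.prod_ne_zero_iff.2 fun p hp => (hP p (hB' hp)).ne_zero),
      Finset.mul_sum]
    exact Finset.sum_congr rfl fun d _ => by ring
  rw [Finset.sum_congr rfl h1, Finset.sum_comm, mainSum]
  refine Finset.sum_congr rfl fun d hd => ?_
  rw [← Finset.mul_sum]
  by_cases hsq : ∀ j, Squarefree (d j)
  · have hPsq := squarefree_prod_primes hP
    have hP0 : ∏ p ∈ P, p ≠ 0 := hPsq.ne_zero
    have hdvd : Finset.univ.lcm d ∣ ∏ p ∈ P, p := by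
      refine Finset.lcm_dvd fun j _ => ?_
      rw [← Nat.prod_primeFactors_of_squarefree (hsq j)]
      refine Finset.prod_dvd_prod_of_subset _ _ _ fun p hp => ?_
      have hj := Finset.mem_Icc.1 (Fintype.mem_piFinset.1 hd j)
      refine hRP p (Nat.prime_of_mem_primeFactors hp) ?_
      have h2 : (p : ℝ) ≤ ⌊R⌋₊ := by
        exact_mod_cast (Nat.le_of_dvd hj.1 (Nat.dvd_of_mem_primeFactors hp)).trans hj.2
      exact h2.trans (Nat.floor_le (by linarith))
    have hsub := Nat.primeFactors_mono hdvd hP0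
    rw [Nat.primeFactors_prod hP] at hsub
    rw [sum_sieveWeight_dvd hP (hPsq.squarefree_of_dvd hdvd) hsub]
  · push Not at hsq
    obtain ⟨j, hj⟩ := hsq
    have : tupleCoeff f R d = 0 := Finset.prod_eq_zero (Finset.mem_univ j) (by
      rw [ArithmeticFunction.moebius_eq_zero_of_not_squarefree hj]
      simp)
    rw [this, zero_mul, zero_mul]

theorem abs_sum_dvd_sub_le {x : ℝ} (hx : 0 < x) {D : ℕ} (hD : D ≠ 0) :
    |(1 / x) * ∑ n ∈ Finset.Icc 1 ⌊x⌋₊, (if D ∣ n then (1 : ℝ) else 0) - (D : ℝ)⁻¹| ≤ 1 / x := by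
  have hD' : (0 : ℝ) < D := by exact_mod_cast Nat.pos_of_ne_zero hD
  have h1 : ∑ n ∈ Finset.Icc 1 ⌊x⌋₊, (if D ∣ n then (1 : ℝ) else 0) = ⌊x / D⌋₊ := by
    rw [Finset.sum_boole, Nat.floor_div_natCast, ← Nat.Ioc_filter_dvd_card_eq_div]
    rfl
  have h2 : (1 / x) * (⌊x / D⌋₊ : ℝ) - (D : ℝ)⁻¹ = (1 / x) * (⌊x / D⌋₊ - x / D) := by
    field_simp
  rw [h1, h2, abs_mul, abs_of_pos (by positivity : 0 < 1 / x)]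
  refine mul_le_of_le_one_right (by positivity) ?_
  have h3 := Nat.floor_le (by positivity : 0 ≤ x / D)
  have h4 := Nat.lt_floor_add_one (x / D)
  rw [abs_le]
  constructor <;> linarith

theorem abs_tupleCoeff_le {f : ℝ → ℝ} {B : ℝ} (hB : ∀ t, |f t| ≤ B) (R : ℝ) {m : ℕ}
    (d : Fin m → ℕ) : |tupleCoeff f R d| ≤ B ^ m := by
  have hB0 : 0 ≤ B := (abs_nonneg _).trans (hB 0)
  rw [tupleCoeff, Finset.abs_prod]
  have : ∏ _j : Fin m, B = B ^ m := by simp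
  rw [← this]
  refine Finset.prod_le_prod (fun _ _ => abs_nonneg _) fun j _ => ?_
  rw [abs_mul]
  have h1 : |((ArithmeticFunction.moebius (d j) : ℤ) : ℝ)| ≤ 1 := by
    exact_mod_cast ArithmeticFunction.abs_moebius_le_one
  exact (mul_le_mul h1 (hB _) (abs_nonneg _) zero_le_one).trans_eq (one_mul B)

theorem abs_mean_sub_mainSum_le {f : ℝ → ℝ} (hsupp : ∀ t : ℝ, 1 < t → f t = 0) {B : ℝ}
    (hB : ∀ t, |f t| ≤ B) {R : ℝ} (hR : 1 < R) {x : ℝ} (hx : 0 < x) (m : ℕ) :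
    |(1 / x) * ∑ n ∈ Finset.Icc 1 ⌊x⌋₊, Mf f n R ^ m - mainSum f R m| ≤ B ^ m * R ^ m / x := by
  have hB0 : 0 ≤ B := (abs_nonneg _).trans (hB 0)
  have h1 : (1 / x) * ∑ n ∈ Finset.Icc 1 ⌊x⌋₊, Mf f n R ^ m - mainSum f R m =
      ∑ d ∈ Fintype.piFinset fun _ : Fin m => Finset.Icc 1 ⌊R⌋₊, tupleCoeff f R d *
        ((1 / x) * ∑ n ∈ Finset.Icc 1 ⌊x⌋₊, (if Finset.univ.lcm d ∣ n then (1 : ℝ) else 0) -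
          ((Finset.univ.lcm d : ℕ) : ℝ)⁻¹) := by
    rw [Finset.sum_congr rfl fun n hn => mf_pow_eq hsupp hR
      (Nat.one_le_iff_ne_zero.1 (Finset.mem_Icc.1 hn).1) m, Finset.sum_comm, mainSum,
      Finset.mul_sum, ← Finset.sum_sub_distrib]
    refine Finset.sum_congr rfl fun d _ => ?_
    rw [← Finset.mul_sum]
    ring
  rw [h1]
  refine (Finset.abs_sum_le_sum_abs _ _).trans ?_
  refine (Finset.sum_le_sum (g := fun _ => B ^ m * (1 / x)) fun d hd => ?_).trans ?_
  · rw [abs_mul]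
    refine mul_le_mul (abs_tupleCoeff_le hB R d) (abs_sum_dvd_sub_le hx ?_) (abs_nonneg _)
      (by positivity)
    rw [Ne, Finset.lcm_eq_zero_iff]
    rintro ⟨j, _, hj⟩
    have := Finset.mem_Icc.1 (Fintype.mem_piFinset.1 hd j)
    omega
  · rw [Finset.sum_const, nsmul_eq_mul, Fintype.card_piFinset]
    simp only [Nat.card_Icc, add_tsub_cancel_right, Finset.prod_const, Finset.card_univ,
      Fintype.card_fin, Nat.cast_pow]
    have h2 : (⌊R⌋₊ : ℝ) ≤ R := Nat.floor_le (by linarith)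
    calc (⌊R⌋₊ : ℝ) ^ m * (B ^ m * (1 / x)) ≤ R ^ m * (B ^ m * (1 / x)) := by gcongr
      _ = _ := by ring

section

open MeasureTheory

theorem sum_divisors_moebius_mul_cpow {n : ℕ} (hn : Squarefree n) {w : ℂ} (hw : w ≠ 0) :
    ∑ d ∈ n.divisors, ((ArithmeticFunction.moebius d : ℤ) : ℂ) * (d : ℂ) ^ (-w) =
      ∏ p ∈ n.primeFactors, (1 - (p : ℂ) ^ (-w)) := by
  let h : ArithmeticFunction ℂ := ⟨fun d => (d : ℂ) ^ (-w), by
    simp [Complex.zero_cpow (neg_ne_zero.2 hw)]⟩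
  have hh : h.IsMultiplicative := by
    refine ⟨?_, fun {a b} _ => ?_⟩
    · change ((1 : ℕ) : ℂ) ^ (-w) = 1
      simp
    · change ((a * b : ℕ) : ℂ) ^ (-w) = (a : ℂ) ^ (-w) * (b : ℂ) ^ (-w)
      rw [Nat.cast_mul, Complex.natCast_mul_natCast_cpow]
  exact (hh.prodPrimeFactors_one_sub_of_squarefree h hn).symm

variable {f : ℝ → ℝ} {F : ℝ → ℂ}

theorem integrable_mul_exp (hFc : Continuous F) (hFi : Integrable F) {t : ℝ} (ht : 0 ≤ t) :
    Integrable fun v : ℝ => F v * Complex.exp (-((1 - 2 * Real.pi * v * Complex.I) * t)) := by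
  refine hFi.mono (by fun_prop) (Filter.Eventually.of_forall fun v => ?_)
  rw [norm_mul, Complex.norm_exp]
  refine mul_le_of_le_one_right (norm_nonneg _) (Real.exp_le_one_iff.2 ?_)
  simpa using ht

theorem natCast_cpow_neg_div {d : ℕ} (hd : 0 < d) (s : ℂ) (L : ℝ) :
    (d : ℂ) ^ (-(s / L)) = Complex.exp (-(s * ((Real.log d / L : ℝ) : ℂ))) := by
  rw [Complex.cpow_def_of_ne_zero (by exact_mod_cast hd.ne'), ← Complex.natCast_log]
  push_cast
  ring_nf

theorem one_sub_two_pi_mul_I_ne_zero (v : ℝ) : (1 - 2 * Real.pi * v * Complex.I : ℂ) ≠ 0 := by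
  intro h
  simpa using congrArg Complex.re h

theorem sum_divisors_fourier {n : ℕ} (hn : Squarefree n) {L : ℝ} (hL : 0 < L) (v : ℝ) :
    ∑ d ∈ n.divisors, ((ArithmeticFunction.moebius d : ℤ) : ℂ) * (F v *
      Complex.exp (-((1 - 2 * Real.pi * v * Complex.I) * ((Real.log d / L : ℝ) : ℂ)))) =
    F v * ∏ p ∈ n.primeFactors,
      (1 - (p : ℂ) ^ (-((1 - 2 * Real.pi * v * Complex.I) / L))) := by
  rw [← sum_divisors_moebius_mul_cpow hn
    (div_ne_zero (one_sub_two_pi_mul_I_ne_zero v) (by exact_mod_cast hL.ne')), Finset.mul_sum]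
  refine Finset.sum_congr rfl fun d hd => ?_
  rw [natCast_cpow_neg_div (Nat.pos_of_mem_divisors hd)]
  ring

theorem mf_eq_integral (hFc : Continuous F) (hFi : Integrable F)
    (hF : ∀ t : ℝ, 0 ≤ t →
      (f t : ℂ) = ∫ v : ℝ, F v * Complex.exp (-((1 - 2 * Real.pi * v * Complex.I) * t)))
    {n : ℕ} (hn : Squarefree n) {R : ℝ} (hR : 1 < R) :
    (Mf f n R : ℂ) = ∫ v : ℝ, F v * ∏ p ∈ n.primeFactors,
      (1 - (p : ℂ) ^ (-((1 - 2 * Real.pi * v * Complex.I) / Real.log R))) := by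
  have hL : 0 < Real.log R := Real.log_pos hR
  have ht : ∀ d ∈ n.divisors, 0 ≤ Real.log d / Real.log R := fun d _ =>
    div_nonneg (Real.log_natCast_nonneg d) hL.le
  simp only [← sum_divisors_fourier hn hL]
  rw [integral_finsetSum _ fun d hd => (integrable_mul_exp hFc hFi (ht d hd)).const_mul _, Mf]
  simp only [Complex.ofReal_sum, Complex.ofReal_mul, Complex.ofReal_intCast]
  refine Finset.sum_congr rfl fun d hd => ?_
  rw [integral_const_mul, hF _ (ht d hd)]

theorem integrable_mul_prod (hFc : Continuous F) (hFi : Integrable F) {n : ℕ}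
    (hn : Squarefree n) {L : ℝ} (hL : 0 < L) :
    Integrable fun v : ℝ => F v * ∏ p ∈ n.primeFactors,
      (1 - (p : ℂ) ^ (-((1 - 2 * Real.pi * v * Complex.I) / L))) := by
  simp only [← sum_divisors_fourier hn hL]
  exact integrable_finsetSum _ fun d _ => (integrable_mul_exp hFc hFi
    (div_nonneg (Real.log_natCast_nonneg d) hL.le)).const_mul _

theorem prod_eulerFactor_eq {m : ℕ} (z : Fin m → ℂ) (P : Finset ℕ) :
    ∏ p ∈ P, eulerFactor z p =
      ∑ B ∈ P.powerset, (sieveWeight P B : ℂ) * ∏ j, ∏ p ∈ B, (1 - (p : ℂ) ^ (-z j)) := by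
  have h1 : ∀ p ∈ P, eulerFactor z p =
      (p : ℂ)⁻¹ * ∏ j, (1 - (p : ℂ) ^ (-z j)) + (1 - (p : ℂ)⁻¹) := fun p _ => by
    rw [eulerFactor]
    ring
  rw [Finset.prod_congr rfl h1, Finset.prod_add]
  refine Finset.sum_congr rfl fun B _ => ?_
  rw [Finset.prod_mul_distrib, sieveWeight, Finset.prod_comm (s := Finset.univ)]
  push_cast
  ring

theorem mainSum_eq_integral_prod (hsupp : ∀ t : ℝ, 1 < t → f t = 0)
    (hFc : Continuous F) (hFi : Integrable F)
    (hF : ∀ t : ℝ, 0 ≤ t →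
      (f t : ℂ) = ∫ v : ℝ, F v * Complex.exp (-((1 - 2 * Real.pi * v * Complex.I) * t)))
    {R : ℝ} (hR : 1 < R) {P : Finset ℕ} (hP : ∀ p ∈ P, p.Prime)
    (hRP : ∀ p : ℕ, p.Prime → (p : ℝ) ≤ R → p ∈ P) (m : ℕ) :
    (mainSum f R m : ℂ) = ∫ v : Fin m → ℝ, (∏ j, F (v j)) *
      ∏ p ∈ P, eulerFactor (fun j => sig v j / Real.log R) p := by
  have hL : 0 < Real.log R := Real.log_pos hR
  have h1 : ∀ v : Fin m → ℝ, (∏ j, F (v j)) *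
      ∏ p ∈ P, eulerFactor (fun j => sig v j / Real.log R) p =
      ∑ B ∈ P.powerset, (sieveWeight P B : ℂ) * ∏ j, (F (v j) *
        ∏ p ∈ B, (1 - (p : ℂ) ^ (-((1 - 2 * Real.pi * (v j) * Complex.I) / Real.log R)))) := by
    intro v
    rw [prod_eulerFactor_eq, Finset.mul_sum]
    refine Finset.sum_congr rfl fun B _ => ?_
    rw [Finset.prod_mul_distrib]
    simp only [sig]
    ring
  have hB : ∀ B ∈ P.powerset, ∀ p ∈ B, p.Prime := fun B hB p hp =>
    hP p (Finset.mem_powerset.1 hB hp)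
  have hint : ∀ B ∈ P.powerset, Integrable fun v : ℝ => F v *
      ∏ p ∈ B, (1 - (p : ℂ) ^ (-((1 - 2 * Real.pi * v * Complex.I) / Real.log R))) := by
    intro B hB'
    have := integrable_mul_prod hFc hFi (squarefree_prod_primes (hB B hB')) hL
    rwa [Nat.primeFactors_prod (hB B hB')] at this
  simp only [h1]
  rw [volume_pi, integral_finsetSum _ fun B hB' =>
    (Integrable.fintype_prod (ι := Fin m) fun _ => hint B hB').const_mul _,
    mainSum_eq hsupp hR hP hRP]
  push_cast
  refine Finset.sum_congr rfl fun B hB' => ?_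
  have h2 := mf_eq_integral hFc hFi hF (squarefree_prod_primes (hB B hB')) hR
  rw [Nat.primeFactors_prod (hB B hB')] at h2
  rw [integral_const_mul]
  refine congrArg _ (Eq.trans ?_ (integral_fintype_prod_eq_prod (ι := Fin m) (E := fun _ => ℝ)
    (μ := fun _ => volume) fun _ v => F v *
      ∏ p ∈ B, (1 - (p : ℂ) ^ (-((1 - 2 * Real.pi * v * Complex.I) / Real.log R)))).symm)
  rw [← h2]
  simp

/-- The primes up to `N`. -/
def primesLE (N : ℕ) : Finset ℕ := (Finset.range (N + 1)).filter Nat.Prime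

theorem tendsto_prod_primesLE {m : ℕ} {z : Fin m → ℂ} {σ : ℝ} (hσ : 0 < σ)
    (hz : ∀ j, σ ≤ (z j).re) :
    Filter.Tendsto (fun N => ∏ p ∈ primesLE N, eulerFactor z p) Filter.atTop
      (nhds (eulerProd z)) := by
  have h1 := (hasProd_eulerFactor hσ hz)
  have h2 : Filter.Tendsto (fun N => (primesLE N).subtype Nat.Prime) Filter.atTop
      Filter.atTop := by
    refine Filter.tendsto_atTop_finset_of_monotone (fun a b hab p hp => ?_) fun p =>
      ⟨p, ?_⟩
    · simp only [primesLE, Finset.mem_subtype, Finset.mem_filter, Finset.mem_range] at hp ⊢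
      exact ⟨by omega, hp.2⟩
    · simp [primesLE, p.2]
  refine (h1.comp h2).congr fun N => ?_
  have h3 : primesLE N = ((primesLE N).subtype Nat.Prime).map (Function.Embedding.subtype _) := by
    rw [Finset.subtype_map, Finset.filter_true_of_mem]
    exact fun p hp => (Finset.mem_filter.1 hp).2
  conv_rhs => rw [h3, Finset.prod_map]
  rfl

theorem exists_norm_prod_eulerFactor_le (m : ℕ) {σ : ℝ} (hσ : 0 < σ) :
    ∃ C : ℝ, ∀ (z : Fin m → ℂ) (P : Finset ℕ), (∀ p ∈ P, p.Prime) → (∀ j, σ ≤ (z j).re) →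
      ‖∏ p ∈ P, eulerFactor z p‖ ≤ C := by
  obtain ⟨C, hC, h⟩ := exists_norm_eulerFactor_sub_one_le m
  have hs : Summable fun n : ℕ => C * (n : ℝ) ^ (-1 - σ) :=
    (Real.summable_nat_rpow.2 (by linarith)).mul_left C
  refine ⟨Real.exp (∑' n : ℕ, C * (n : ℝ) ^ (-1 - σ)), fun z P hP hz => ?_⟩
  have hnn : ∀ n : ℕ, 0 ≤ C * (n : ℝ) ^ (-1 - σ) := fun n =>
    mul_nonneg hC (Real.rpow_nonneg n.cast_nonneg _)
  rw [norm_prod]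
  calc ∏ p ∈ P, ‖eulerFactor z p‖
      ≤ ∏ p ∈ P, Real.exp (C * (p : ℝ) ^ (-1 - σ)) := by
        refine Finset.prod_le_prod (fun _ _ => norm_nonneg _) fun p hp => ?_
        have h1 := h z σ p hσ.le hz (hP p hp).one_le
        have h2 := norm_le_norm_sub_add (eulerFactor z p) 1
        rw [norm_one] at h2
        have h3 := Real.add_one_le_exp (C * (p : ℝ) ^ (-1 - σ))
        linarith
    _ = Real.exp (∑ p ∈ P, C * (p : ℝ) ^ (-1 - σ)) := (Real.exp_sum _ _).symm
    _ ≤ _ := Real.exp_le_exp.2 (hs.sum_le_tsum P fun n _ => hnn n)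

theorem continuous_eulerFactor {m : ℕ} {p : ℕ} (hp : 0 < p) (L : ℝ) :
    Continuous fun v : Fin m → ℝ => eulerFactor (fun j => sig v j / L) p := by
  unfold eulerFactor sig
  have : ((p : ℕ) : ℂ) ≠ 0 := by exact_mod_cast hp.ne'
  refine continuous_const.add (continuous_const.mul ((continuous_finsetProd _ fun j _ =>
    continuous_const.sub (Continuous.const_cpow ?_ (Or.inl this))).sub continuous_const))
  fun_prop

theorem aestronglyMeasurable_prod_mul (hFc : Continuous F) {m : ℕ} (P : Finset ℕ)
    (hP : ∀ p ∈ P, p.Prime) (L : ℝ) :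
    AEStronglyMeasurable (fun v : Fin m → ℝ => (∏ j, F (v j)) *
      ∏ p ∈ P, eulerFactor (fun j => sig v j / L) p) := by
  refine Continuous.aestronglyMeasurable (Continuous.mul (by fun_prop) ?_)
  exact continuous_finsetProd _ fun p hp => continuous_eulerFactor (hP p hp).pos L

/-- The main term as an integral of the Euler product. -/
theorem mainSum_eq_integral (hsupp : ∀ t : ℝ, 1 < t → f t = 0)
    (hFc : Continuous F) (hFi : Integrable F)
    (hF : ∀ t : ℝ, 0 ≤ t →
      (f t : ℂ) = ∫ v : ℝ, F v * Complex.exp (-((1 - 2 * Real.pi * v * Complex.I) * t)))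
    {R : ℝ} (hR : 1 < R) (m : ℕ) :
    Integrable (fun v : Fin m → ℝ => (∏ j, F (v j)) *
      eulerProd fun j => sig v j / Real.log R) ∧
    (mainSum f R m : ℂ) = ∫ v : Fin m → ℝ, (∏ j, F (v j)) *
      eulerProd fun j => sig v j / Real.log R := by
  have hL : 0 < Real.log R := Real.log_pos hR
  set L := Real.log R with hLdef
  have hre : ∀ (v : Fin m → ℝ) j, L⁻¹ ≤ (sig v j / L).re := fun v j => by
    rw [Complex.div_ofReal_re, sig_re, one_div]
  obtain ⟨C, hC⟩ := exists_norm_prod_eulerFactor_le m (inv_pos.2 hL)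
  have hPN : ∀ N, ∀ p ∈ primesLE N, p.Prime := fun N p hp => (Finset.mem_filter.1 hp).2
  have hlim : ∀ v : Fin m → ℝ, Filter.Tendsto (fun N => (∏ j, F (v j)) *
      ∏ p ∈ primesLE N, eulerFactor (fun j => sig v j / L) p) Filter.atTop
      (nhds ((∏ j, F (v j)) * eulerProd fun j => sig v j / L)) := fun v =>
    (tendsto_prod_primesLE (inv_pos.2 hL) (hre v)).const_mul _
  have hbound : ∀ N, ∀ v : Fin m → ℝ, ‖(∏ j, F (v j)) *
      ∏ p ∈ primesLE N, eulerFactor (fun j => sig v j / L) p‖ ≤ ‖∏ j, F (v j)‖ * C :=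
    fun N v => by
      rw [norm_mul]
      exact mul_le_mul_of_nonneg_left (hC _ _ (hPN N) (hre v)) (norm_nonneg _)
  have hdom : Integrable fun v : Fin m → ℝ => ‖∏ j, F (v j)‖ * C :=
    (Integrable.fintype_prod (ι := Fin m) fun _ => hFi).norm.mul_const C
  have hmeas := fun N => aestronglyMeasurable_prod_mul (m := m) hFc (primesLE N) (hPN N) L
  refine ⟨hdom.mono' (aestronglyMeasurable_of_tendsto_ae Filter.atTop hmeas
    (Filter.Eventually.of_forall hlim)) (Filter.Eventually.of_forall fun v =>
      le_of_tendsto (hlim v).norm (Filter.Eventually.of_forall fun N => hbound N v)), ?_⟩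
  have hD := tendsto_integral_of_dominated_convergence _ hmeas hdom
    (fun N => Filter.Eventually.of_forall (hbound N)) (Filter.Eventually.of_forall hlim)
  refine tendsto_nhds_unique (tendsto_const_nhds.congr' ?_) hD
  filter_upwards [Filter.eventually_ge_atTop ⌊R⌋₊] with N hN
  refine mainSum_eq_integral_prod hsupp hFc hFi hF hR (hPN N) (fun p hp hpR => ?_) m
  exact Finset.mem_filter.2 ⟨Finset.mem_range.2 (Nat.lt_succ_of_le
    ((Nat.le_floor hpR).trans hN)), hp⟩

end

theorem tendsto_prod_primesLE_zeta {x : ℝ} (hx : 0 < x) :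
    Filter.Tendsto (fun N => ∏ p ∈ primesLE N, (1 - (p : ℝ) ^ (-(1 + x)))⁻¹) Filter.atTop
      (nhds ‖riemannZeta ((1 + x : ℝ) : ℂ)‖) := by
  have h := ((riemannZeta_eulerProduct (s := ((1 + x : ℝ) : ℂ)) (by simpa using hx)).norm).comp
    (Filter.tendsto_add_atTop_nat 1)
  refine h.congr fun N => ?_
  simp only [Function.comp_apply, norm_prod]
  refine Finset.prod_congr rfl fun p hp => ?_
  have hp1 : (1 : ℝ) ≤ p := by exact_mod_cast (Nat.prime_of_mem_primesBelow hp).one_le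
  have h1 : (p : ℂ) ^ (-((1 + x : ℝ) : ℂ)) = (((p : ℝ) ^ (-(1 + x)) : ℝ) : ℂ) := by
    rw [Complex.ofReal_cpow (by linarith)]
    push_cast
    rfl
  have h2 : (p : ℝ) ^ (-(1 + x)) ≤ 1 := Real.rpow_le_one_of_one_le_of_nonpos hp1 (by linarith)
  rw [h1, norm_inv, ← Complex.ofReal_one, ← Complex.ofReal_sub, Complex.norm_real,
    Real.norm_of_nonneg (by linarith)]

theorem monotone_prod_primesLE {g : ℕ → ℝ} (hg : ∀ p : ℕ, p.Prime → 1 ≤ g p) :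
    Monotone fun N => ∏ p ∈ primesLE N, g p := by
  intro a b hab
  exact Finset.prod_le_prod_of_subset_of_one_le
    (Finset.filter_subset_filter _ (Finset.range_mono (by omega)))
    (fun p hp => zero_le_one.trans (hg p (Finset.mem_filter.1 hp).2))
    fun p hp _ => hg p (Finset.mem_filter.1 hp).2

theorem rpow_neg_one_add_le_half {p : ℕ} (hp : p.Prime) {x : ℝ} (hx : 0 ≤ x) :
    (p : ℝ) ^ (-(1 + x)) ≤ 1 / 2 := by
  have h2 : (2 : ℝ) ≤ p := by exact_mod_cast hp.two_le
  calc (p : ℝ) ^ (-(1 + x)) ≤ (p : ℝ) ^ (-1 : ℝ) :=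
        Real.rpow_le_rpow_of_exponent_le (by linarith) (by linarith)
    _ = (p : ℝ)⁻¹ := Real.rpow_neg_one _
    _ ≤ 2⁻¹ := by gcongr
    _ = 1 / 2 := by norm_num

theorem prod_primesLE_inv_le_zeta {x : ℝ} (hx : 0 < x) (N : ℕ) :
    ∏ p ∈ primesLE N, (1 - (p : ℝ) ^ (-(1 + x)))⁻¹ ≤ ‖riemannZeta ((1 + x : ℝ) : ℂ)‖ := by
  refine (monotone_prod_primesLE fun p hp => ?_).ge_of_tendsto (tendsto_prod_primesLE_zeta hx) N
  have h1 := rpow_neg_one_add_le_half hp hx.le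
  have h2 : 0 ≤ (p : ℝ) ^ (-(1 + x)) := Real.rpow_nonneg p.cast_nonneg _
  exact (one_le_inv₀ (by linarith)).2 (by linarith)

theorem prod_primesLE_one_add_sub_le {x y : ℝ} (hx : 0 < x) (hxy : x ≤ y) (N : ℕ) :
    ∏ p ∈ primesLE N, (1 + ((p : ℝ) ^ (-(1 + x)) - (p : ℝ) ^ (-(1 + y)))) ≤
      ‖riemannZeta ((1 + x : ℝ) : ℂ)‖ / ‖riemannZeta ((1 + y : ℝ) : ℂ)‖ := by
  have hy : 0 < y := hx.trans_le hxy
  have hle : ∀ p : ℕ, p.Prime → (p : ℝ) ^ (-(1 + y)) ≤ (p : ℝ) ^ (-(1 + x)) := fun p hp =>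
    Real.rpow_le_rpow_of_exponent_le (by exact_mod_cast hp.one_le) (by linarith)
  have hkey : ∀ p : ℕ, p.Prime → 1 + ((p : ℝ) ^ (-(1 + x)) - (p : ℝ) ^ (-(1 + y))) ≤
      (1 - (p : ℝ) ^ (-(1 + x)))⁻¹ / (1 - (p : ℝ) ^ (-(1 + y)))⁻¹ := fun p hp => by
    have h1 := rpow_neg_one_add_le_half hp hx.le
    have h2 := hle p hp
    have h3 : 0 ≤ (p : ℝ) ^ (-(1 + x)) := Real.rpow_nonneg p.cast_nonneg _
    rw [div_inv_eq_mul, inv_mul_eq_div, le_div_iff₀ (by linarith)]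
    nlinarith
  have hone : ∀ p : ℕ, p.Prime →
      1 ≤ (1 - (p : ℝ) ^ (-(1 + x)))⁻¹ / (1 - (p : ℝ) ^ (-(1 + y)))⁻¹ := fun p hp =>
    le_trans (by linarith [hle p hp]) (hkey p hp)
  have hζ : ‖riemannZeta ((1 + y : ℝ) : ℂ)‖ ≠ 0 :=
    norm_ne_zero_iff.2 (riemannZeta_ne_zero_of_one_lt_re (by simpa using hy))
  refine le_trans (Finset.prod_le_prod (fun p hp => ?_) fun p hp =>
    hkey p (Finset.mem_filter.1 hp).2) ((monotone_prod_primesLE hone).ge_of_tendsto ?_ N)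
  · linarith [hle p (Finset.mem_filter.1 hp).2]
  · simp only [Finset.prod_div_distrib]
    exact (tendsto_prod_primesLE_zeta hx).div (tendsto_prod_primesLE_zeta hy) hζ

theorem inv_one_sub_inv_le {p : ℕ} (hp : p.Prime) {L : ℝ} (hL : 1 ≤ L) (hpL : Real.log p ≤ L) :
    (1 - (p : ℝ)⁻¹)⁻¹ ≤ (1 - (p : ℝ) ^ (-(1 + 1 / L)))⁻¹ *
      (1 + ((p : ℝ) ^ (-(1 + 1 / L)) - (p : ℝ) ^ (-(1 + 2 / L)))) ^ 6 := by
  have hL0 : 0 < L := by linarith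
  have hp2 : (2 : ℝ) ≤ p := by exact_mod_cast hp.two_le
  have hp0 : (0 : ℝ) < p := by linarith
  set u := (p : ℝ) ^ (-(1 / L)) with hu
  have hu0 : 0 < u := Real.rpow_pos_of_pos hp0 _
  have hu1 : u ≤ 1 := Real.rpow_le_one_of_one_le_of_nonpos (by linarith)
    (by have : 0 < 1 / L := by positivity
        linarith)
  have hu3 : 1 / 3 ≤ u := by
    have h1 : u = Real.exp (-(Real.log p / L)) := by
      rw [hu, Real.rpow_def_of_pos hp0]
      congr 1
      ring
    have h2 : Real.exp (-1) ≤ u := by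
      rw [h1]
      have := (div_le_one hL0).2 hpL
      exact Real.exp_le_exp.2 (by linarith)
    have h3 : (1 : ℝ) / 3 ≤ Real.exp (-1) := by
      rw [Real.exp_neg, one_div]
      exact inv_anti₀ (Real.exp_pos 1) (by linarith [Real.exp_one_lt_d9])
    linarith
  set q := (p : ℝ)⁻¹ with hq
  have hq0 : 0 < q := by positivity
  have hq2 : q ≤ 1 / 2 := by
    rw [hq, one_div]
    gcongr
  have ha : (p : ℝ) ^ (-(1 + 1 / L)) = q * u := by
    rw [hu, hq, ← Real.rpow_neg_one, ← Real.rpow_add hp0]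
    ring_nf
  have hb : (p : ℝ) ^ (-(1 + 2 / L)) = q * u * u := by
    rw [hu, hq, ← Real.rpow_neg_one, ← Real.rpow_add hp0, ← Real.rpow_add hp0]
    ring_nf
  rw [ha, hb]
  have hqu : q * u ≤ q := mul_le_of_le_one_right hq0.le hu1
  have hv0 : 0 ≤ q * (1 - u) := mul_nonneg hq0.le (by linarith)
  have hy : q * (1 - u) ≤ 3 * (q * u - q * u * u) := by nlinarith
  have hbern : 1 + 6 * (q * u - q * u * u) ≤ (1 + (q * u - q * u * u)) ^ 6 := by
    have := one_add_mul_le_pow (a := q * u - q * u * u) (by linarith) 6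
    exact_mod_cast this
  refine le_trans ?_ (mul_le_mul_of_nonneg_left hbern (inv_nonneg.2 (by linarith)))
  rw [inv_mul_eq_div, le_div_iff₀ (by linarith), inv_mul_le_iff₀ (by linarith)]
  nlinarith

/-- A lower bound of Mertens type. -/
theorem exists_le_prod_one_sub_inv :
    ∃ c : ℝ, 0 < c ∧ ∀ R : ℝ, 3 ≤ R →
      c / Real.log R ≤ ∏ p ∈ primesLE ⌊R⌋₊, (1 - (p : ℝ)⁻¹) := by
  obtain ⟨C, hC, h1⟩ := norm_zeta_real_le 1
  obtain ⟨c, hc, h2⟩ := exists_le_norm_mul_zeta (B := 2) (T := 0) (by norm_num) le_rfl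
  refine ⟨(C * (2 * C / c) ^ 6)⁻¹, by positivity, fun R hR => ?_⟩
  set L := Real.log R with hLdef
  have hL : 1 ≤ L := by
    rw [hLdef, Real.le_log_iff_exp_le (by linarith)]
    linarith [Real.exp_one_lt_d9]
  have hL0 : 0 < L := by linarith
  have hx : 1 / L ≤ 1 := (div_le_one hL0).2 hL
  have hζ1 := h1 (1 / L) (by positivity) hx
  have hζ2 : c * L / 2 ≤ ‖riemannZeta ((1 + 2 / L : ℝ) : ℂ)‖ := by
    have e := h2 ((2 / L : ℝ) : ℂ) (by simpa using hL0)
      (by rw [Complex.ofReal_re, div_le_iff₀ hL0]; linarith) (by simp)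
    rw [Complex.norm_real, Real.norm_of_nonneg (by positivity)] at e
    have e3 : ((1 + 2 / L : ℝ) : ℂ) = 1 + ((2 / L : ℝ) : ℂ) := by push_cast; rfl
    rw [e3, div_le_iff₀ two_pos]
    rw [div_mul_eq_mul_div, le_div_iff₀ hL0] at e
    linarith
  have hprime : ∀ p ∈ primesLE ⌊R⌋₊, p.Prime := fun p hp => (Finset.mem_filter.1 hp).2
  have hprod : ∏ p ∈ primesLE ⌊R⌋₊, (1 - (p : ℝ)⁻¹)⁻¹ ≤ C * L * (2 * C / c) ^ 6 := by
    calc ∏ p ∈ primesLE ⌊R⌋₊, (1 - (p : ℝ)⁻¹)⁻¹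
        ≤ ∏ p ∈ primesLE ⌊R⌋₊, ((1 - (p : ℝ) ^ (-(1 + 1 / L)))⁻¹ *
          (1 + ((p : ℝ) ^ (-(1 + 1 / L)) - (p : ℝ) ^ (-(1 + 2 / L)))) ^ 6) := by
          refine Finset.prod_le_prod (fun p _ => inv_nonneg.2 (sub_nonneg.2
            (Nat.cast_inv_le_one p))) fun p hp => inv_one_sub_inv_le (hprime p hp) hL ?_
          have e1 : p ≤ ⌊R⌋₊ := Nat.lt_succ_iff.1 (Finset.mem_range.1 (Finset.mem_filter.1 hp).1)
          exact Real.log_le_log (by exact_mod_cast (hprime p hp).pos)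
            ((Nat.le_floor_iff (by linarith)).1 e1)
      _ = (∏ p ∈ primesLE ⌊R⌋₊, (1 - (p : ℝ) ^ (-(1 + 1 / L)))⁻¹) *
          (∏ p ∈ primesLE ⌊R⌋₊, (1 + ((p : ℝ) ^ (-(1 + 1 / L)) -
            (p : ℝ) ^ (-(1 + 2 / L))))) ^ 6 := by
          rw [Finset.prod_mul_distrib, Finset.prod_pow]
      _ ≤ (C / (1 / L)) * ((C / (1 / L)) / (c * L / 2)) ^ 6 := by
          have e1 := (prod_primesLE_inv_le_zeta (x := 1 / L) (by positivity) ⌊R⌋₊).trans hζ1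
          have e2 := prod_primesLE_one_add_sub_le (x := 1 / L) (y := 2 / L) (by positivity)
            (by gcongr; norm_num) ⌊R⌋₊
          have e3 : ‖riemannZeta ((1 + 1 / L : ℝ) : ℂ)‖ / ‖riemannZeta ((1 + 2 / L : ℝ) : ℂ)‖ ≤
              (C / (1 / L)) / (c * L / 2) :=
            div_le_div₀ (by positivity) hζ1 (by positivity) hζ2
          have e4 : 0 ≤ ∏ p ∈ primesLE ⌊R⌋₊, (1 + ((p : ℝ) ^ (-(1 + 1 / L)) -
              (p : ℝ) ^ (-(1 + 2 / L)))) := by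
            refine Finset.prod_nonneg fun p hp => ?_
            have := rpow_neg_one_add_le_half (hprime p hp) (x := 2 / L) (by positivity)
            have := Real.rpow_nonneg (Nat.cast_nonneg (α := ℝ) p) (-(1 + 1 / L))
            linarith
          exact mul_le_mul e1 (pow_le_pow_left₀ e4 (e2.trans e3) 6) (pow_nonneg e4 6)
            (by positivity)
      _ = C * L * (2 * C / c) ^ 6 := by
          field_simp
  rw [Finset.prod_inv_distrib] at hprod
  have hpos : 0 < ∏ p ∈ primesLE ⌊R⌋₊, (1 - (p : ℝ)⁻¹) := Finset.prod_pos fun p hp =>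
    sub_pos.2 (inv_lt_one_of_one_lt₀ (by exact_mod_cast (hprime p hp).one_lt))
  rw [inv_le_comm₀ hpos (by positivity)] at hprod
  refine le_trans (le_of_eq ?_) hprod
  field_simp

theorem exists_le_mainSum {f : ℝ → ℝ} (hsupp : ∀ t : ℝ, 1 < t → f t = 0) (hf0 : f 0 ≠ 0)
    (k : ℕ) :
    ∃ c : ℝ, 0 < c ∧ ∀ R : ℝ, 3 ≤ R → c / Real.log R ≤ mainSum f R (2 * k) := by
  obtain ⟨c, hc, h⟩ := exists_le_prod_one_sub_inv
  have hf : 0 < f 0 ^ (2 * k) := (even_two_mul k).pow_pos hf0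
  refine ⟨f 0 ^ (2 * k) * c, by positivity, fun R hR => ?_⟩
  have h1 := mainSum_eq hsupp (by linarith : 1 < R) (P := primesLE ⌊R⌋₊)
    (fun p hp => (Finset.mem_filter.1 hp).2) (fun p hp hpR => Finset.mem_filter.2
      ⟨Finset.mem_range.2 (Nat.lt_succ_of_le (Nat.le_floor hpR)), hp⟩) (2 * k)
  have h2 : f 0 ^ (2 * k) * ∏ p ∈ primesLE ⌊R⌋₊, (1 - (p : ℝ)⁻¹) =
      sieveWeight (primesLE ⌊R⌋₊) ∅ * Mf f (∏ p ∈ ∅, p) R ^ (2 * k) := by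
    simp [sieveWeight, Mf, mul_comm]
  rw [h1, mul_div_assoc]
  refine (mul_le_mul_of_nonneg_left (h R hR) hf.le).trans (h2.le.trans ?_)
  exact Finset.single_le_sum (f := fun B => sieveWeight (primesLE ⌊R⌋₊) B *
    Mf f (∏ p ∈ B, p) R ^ (2 * k)) (fun B _ => mul_nonneg sieveWeight_nonneg
      ((even_two_mul k).pow_nonneg _)) (Finset.empty_mem_powerset _)

section

open MeasureTheory

theorem one_le_sum_norm {m : ℕ} (hm : 1 ≤ m) {σ : Fin m → ℂ} (hσ : ∀ j, (σ j).re = 1) :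
    1 ≤ ∑ j, ‖σ j‖ := by
  have h1 : 1 ≤ ‖σ ⟨0, hm⟩‖ := by
    have := Complex.re_le_norm (σ ⟨0, hm⟩)
    rwa [hσ] at this
  exact h1.trans (Finset.single_le_sum (f := fun j => ‖σ j‖) (fun _ _ => norm_nonneg _)
    (Finset.mem_univ _))

theorem continuous_eulerLim (m : ℕ) : Continuous fun v : Fin m → ℝ => eulerLim (sig v) := by
  unfold eulerLim
  refine continuous_finsetProd _ fun J hJ => Continuous.zpow₀ ?_ _ fun v => Or.inl ?_
  · unfold subsum sig
    fun_prop
  · exact norm_pos_iff.1 (zero_lt_one.trans_le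
      (one_le_norm_subsum (sig_re v) (Finset.mem_filter.1 hJ).2))

theorem norm_prod_fourier_le {A m : ℕ} {F : ℝ → ℂ} {C : ℝ}
    (hC : ∀ v : ℝ, ‖F v‖ ≤ C * (‖1 - 2 * Real.pi * v * Complex.I‖ ^ A)⁻¹) (v : Fin m → ℝ) :
    ‖∏ j, F (v j)‖ ≤ C ^ m * (∏ j, ‖sig v j‖ ^ A)⁻¹ := by
  rw [norm_prod]
  refine (Finset.prod_le_prod (fun _ _ => norm_nonneg _) fun j _ => hC (v j)).trans_eq ?_
  rw [Finset.prod_mul_distrib, Finset.prod_inv_distrib]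
  simp [sig]

/-- The asymptotic formula for the main term. -/
theorem exists_abs_log_mul_mainSum_sub_le {k A : ℕ} (hk : 1 ≤ k) (hA2 : 2 ≤ A)
    (hA : (2 * k).choose k + 2 ≤ 2 * k * A) {δ : ℝ} (hδ : 0 < δ) (hδ1 : δ < 1) {f : ℝ → ℝ}
    (hsupp : ∀ t : ℝ, 1 < t → f t = 0) (hsmooth : ContDiff ℝ A f) :
    ∃ c K : ℝ, 0 < K ∧ ∀ R : ℝ, 3 ≤ R →
      |Real.log R * mainSum f R (2 * k) - c| ≤ K * Real.log R ^ (-(1 - δ)) := by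
  obtain ⟨F, C, hFc, hC, hFC, hFi, hF⟩ := exists_fourier hA2 hsupp hsmooth
  obtain ⟨G, hG, hGle⟩ := exists_integrable_majorant hk hA2 hA hδ
  have hm : 1 ≤ 2 * k := by omega
  obtain ⟨D, hD, hDle⟩ := exists_norm_eulerProd_sub_eulerLim_le hm hδ hδ1
  have hM : ∀ v : Fin (2 * k) → ℝ, 1 ≤ ∑ j, ‖sig v j‖ := fun v => one_le_sum_norm hm (sig_re v)
  have hlogM : ∀ v : Fin (2 * k) → ℝ, 0 ≤ Real.log (∑ j, ‖sig v j‖) := fun v =>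
    Real.log_nonneg (hM v)
  have hprod0 : ∀ v : Fin (2 * k) → ℝ, 0 ≤ (∏ j, ‖sig v j‖ ^ A)⁻¹ := fun v =>
    inv_nonneg.2 (Finset.prod_nonneg fun _ _ => by positivity)
  have hG0 : ∀ v, 0 ≤ G v := fun v => le_trans (mul_nonneg (hprod0 v) (mul_nonneg
    (Real.exp_pos _).le (Real.rpow_nonneg (zero_le_one.trans (hM v)) _))) (hGle v 0 le_rfl)
  have hlim : Integrable fun v : Fin (2 * k) → ℝ => (∏ j, F (v j)) * eulerLim (sig v) := by
    refine (hG.const_mul (C ^ (2 * k))).mono' (Continuous.aestronglyMeasurable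
      (Continuous.mul (by fun_prop) (continuous_eulerLim _)))
      (Filter.Eventually.of_forall fun v => ?_)
    rw [norm_mul, norm_eulerLim (sig_re v) le_rfl]
    calc _ ≤ (C ^ (2 * k) * (∏ j, ‖sig v j‖ ^ A)⁻¹) *
          (Real.exp (logKer (sig v) (Real.log (∑ j, ‖sig v j‖))) *
            (∑ j, ‖sig v j‖) ^ (1 - δ)) := by
          refine mul_le_mul (norm_prod_fourier_le hFC v) (le_mul_of_one_le_right
            (Real.exp_pos _).le (Real.one_le_rpow (hM v) (by linarith))) (Real.exp_pos _).le
            (mul_nonneg (by positivity) (hprod0 v))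
      _ ≤ C ^ (2 * k) * G v := by
          rw [mul_assoc]
          exact mul_le_mul_of_nonneg_left (hGle v _ (hlogM v)) (by positivity)
  refine ⟨(∫ v : Fin (2 * k) → ℝ, (∏ j, F (v j)) * eulerLim (sig v)).re,
    C ^ (2 * k) * D * 2 * (∫ v, G v) + 1, ?_, fun R hR => ?_⟩
  · have : 0 ≤ ∫ v, G v := integral_nonneg (show 0 ≤ G from hG0)
    positivity
  have hL : 1 ≤ Real.log R := by
    rw [Real.le_log_iff_exp_le (by linarith)]
    linarith [Real.exp_one_lt_d9]
  set L := Real.log R with hLdef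
  have hL0 : 0 < L := by linarith
  obtain ⟨hint, hS⟩ := mainSum_eq_integral hsupp hFc hFi hF (by linarith : 1 < R) (2 * k)
  rw [← hLdef] at hint hS
  have h1 : (L : ℂ) * mainSum f R (2 * k) -
      ∫ v : Fin (2 * k) → ℝ, (∏ j, F (v j)) * eulerLim (sig v) =
      ∫ v : Fin (2 * k) → ℝ, (∏ j, F (v j)) *
        (L * (eulerProd fun j => sig v j / L) - eulerLim (sig v)) := by
    rw [hS, ← integral_const_mul, ← integral_sub (hint.const_mul _) hlim]
    refine integral_congr_ae (Filter.Eventually.of_forall fun v => ?_)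
    ring
  have h2 : L * mainSum f R (2 * k) -
      (∫ v : Fin (2 * k) → ℝ, (∏ j, F (v j)) * eulerLim (sig v)).re =
      ((L : ℂ) * mainSum f R (2 * k) -
        ∫ v : Fin (2 * k) → ℝ, (∏ j, F (v j)) * eulerLim (sig v)).re := by
    rw [Complex.sub_re, ← Complex.ofReal_mul, Complex.ofReal_re]
  rw [h2, h1]
  refine (Complex.abs_re_le_norm _).trans ?_
  refine (norm_integral_le_of_norm_le (g := fun v => C ^ (2 * k) * D * 2 * L ^ (-(1 - δ)) * G v)
    (hG.const_mul _) (Filter.Eventually.of_forall fun v => ?_)).trans ?_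
  · rw [norm_mul]
    refine (mul_le_mul (norm_prod_fourier_le hFC v) (hDle _ L (sig_re v) hL) (norm_nonneg _)
      (mul_nonneg (by positivity) (hprod0 v))).trans ?_
    have e1 := hGle v _ (Real.log_nonneg hL)
    have e2 := hGle v _ (hlogM v)
    have e3 : 0 ≤ C ^ (2 * k) * D * L ^ (-(1 - δ)) := by positivity
    have e4 := mul_le_mul_of_nonneg_left (add_le_add e1 e2) e3
    refine (le_of_eq ?_).trans (e4.trans_eq ?_) <;> ring
  · rw [integral_const_mul, mul_right_comm]
    exact mul_le_mul_of_nonneg_right (by linarith) (by positivity)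

end

end SieveMoment

/-- Let `k ≥ 1` and `A ≥ 2` with `A > binom(2k,k)/(2k)`, let `ε ∈ (0,1)`, and let `f`
be supported on `(−∞,1]`, of class `C^A` with `f, f′, …, f^{(A)}` uniformly bounded and
`f(0) ≠ 0`. Then there are constants `c_{k,f} > 0` and `C(k,f,ε) > 0` such that for
`R ≥ 3` and `x ≥ R^{2k}(log R)²`,
`(1/x)·Σ_{n ≤ x} M_f(n;R)^{2k} = c_{k,f}/log R + O(1/(log R)^{2−ε})`. -/
theorem moment_smooth_asymp (k A : ℕ) (hk : 1 ≤ k) (hA2 : 2 ≤ A)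
    (hA : Nat.choose (2 * k) k < 2 * k * A)
    (ε : ℝ) (hε0 : 0 < ε) (hε1 : ε < 1)
    (f : ℝ → ℝ) (hsupp : ∀ t : ℝ, 1 < t → f t = 0)
    (hsmooth : ContDiff ℝ A f)
    (hbdd : ∀ i ≤ A, ∃ B : ℝ, ∀ x : ℝ, |iteratedDeriv i f x| ≤ B)
    (hf0 : f 0 ≠ 0) :
    ∃ c C : ℝ, 0 < c ∧ 0 < C ∧ ∀ R x : ℝ, 3 ≤ R →
      R ^ (2 * k) * Real.log R ^ 2 ≤ x →
      |(1 / x) * ∑ n ∈ Finset.Icc 1 ⌊x⌋₊, Mf f n R ^ (2 * k) - c / Real.log R| ≤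
        C / Real.log R ^ (2 - ε) := by
  have hA' : (2 * k).choose k + 2 ≤ 2 * k * A := by
    have h1 : 2 ∣ (2 * k).choose k := Nat.two_dvd_centralBinom_of_one_le hk
    have h2 : 2 ∣ 2 * k * A := ⟨k * A, by ring⟩
    omega
  obtain ⟨c, K, hK, hcK⟩ :=
    SieveMoment.exists_abs_log_mul_mainSum_sub_le hk hA2 hA' hε0 hε1 hsupp hsmooth
  obtain ⟨c', hc', hlow⟩ := SieveMoment.exists_le_mainSum hsupp hf0 k
  obtain ⟨B, hB⟩ := hbdd 0 (Nat.zero_le A)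
  simp only [iteratedDeriv_zero] at hB
  have hlog : ∀ R : ℝ, 3 ≤ R → 1 ≤ Real.log R := fun R hR => by
    rw [Real.le_log_iff_exp_le (by linarith)]
    linarith [Real.exp_one_lt_d9]
  have hc : c' ≤ c := by
    have h1 : Filter.Tendsto (fun R : ℝ => c + K * Real.log R ^ (-(1 - ε))) Filter.atTop
        (nhds (c + K * 0)) :=
      (((tendsto_rpow_neg_atTop (by linarith : 0 < 1 - ε)).comp
        Real.tendsto_log_atTop).const_mul K).const_add c
    rw [mul_zero, add_zero] at h1
    refine ge_of_tendsto h1 ?_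
    filter_upwards [Filter.eventually_ge_atTop 3] with R hR
    have h2 := hlow R hR
    rw [div_le_iff₀ (by linarith [hlog R hR]), mul_comm] at h2
    linarith [(abs_le.1 (hcK R hR)).2]
  refine ⟨c, B ^ (2 * k) + K, hc'.trans_le hc, by
    have := (even_two_mul k).pow_nonneg B
    linarith, fun R x hR hx => ?_⟩
  have hL := hlog R hR
  set L := Real.log R
  have hL0 : 0 < L := by linarith
  have hR0 : 0 < R := by linarith
  have hx0 : 0 < x := lt_of_lt_of_le (by positivity) hx
  have hB0 : 0 ≤ B := (abs_nonneg _).trans (hB 0)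
  have hpow : L ^ (2 - ε) ≤ L ^ 2 := by
    rw [← Real.rpow_two]
    exact Real.rpow_le_rpow_of_exponent_le hL (by linarith)
  have hpow0 : 0 < L ^ (2 - ε) := Real.rpow_pos_of_pos hL0 _
  have h1 : |(1 / x) * ∑ n ∈ Finset.Icc 1 ⌊x⌋₊, Mf f n R ^ (2 * k) -
      SieveMoment.mainSum f R (2 * k)| ≤ B ^ (2 * k) / L ^ (2 - ε) := by
    refine (SieveMoment.abs_mean_sub_mainSum_le hsupp hB (by linarith) hx0 (2 * k)).trans ?_
    rw [div_le_div_iff₀ hx0 hpow0, mul_assoc]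
    exact mul_le_mul_of_nonneg_left ((mul_le_mul_of_nonneg_left hpow (by positivity)).trans hx)
      (by positivity)
  have h2 : |SieveMoment.mainSum f R (2 * k) - c / L| ≤ K / L ^ (2 - ε) := by
    have e1 : SieveMoment.mainSum f R (2 * k) - c / L =
        (L * SieveMoment.mainSum f R (2 * k) - c) / L := by
      field_simp
    rw [e1, abs_div, abs_of_pos hL0, div_le_div_iff₀ hL0 hpow0]
    have e2 : L ^ (-(1 - ε)) * L ^ (2 - ε) = L := by
      rw [← Real.rpow_add hL0]
      ring_nf
      exact Real.rpow_one L
    calc _ ≤ K * L ^ (-(1 - ε)) * L ^ (2 - ε) :=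
          mul_le_mul_of_nonneg_right (hcK R hR) hpow0.le
      _ = K * L := by rw [mul_assoc, e2]
  rw [add_div]
  exact (abs_sub_le _ _ _).trans (add_le_add h1 h2)
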